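/- arXiv:2201.09164 — 2 statements merged into one kernel-verified Lean document; each statement's English description precedes it below -/
import Mathlib

section
/- Commutator estimate (weighted version): there exists a constant C>0 such that for all bounded Lipschitz functions f,g on ℝ with f_x∈B^0_{∞,1}(ℝ) and g∈B^1_{∞,1}(ℝ), the commutators R_j := Δ_j(f g_x) − f Δ_j g_x satisfy ∑_{j≥−1} 2^j ‖R_j‖_{L^∞} ≤ C‖f_x‖_{B^0_{∞,1}}‖g‖_{B^1_{∞,1}}. -/
open MeasureTheory Set Filter
open scoped ENNReal NNReal Topology

noncomputable section

/-- Littlewood–Paley data on `ℝ`: a radial smooth even cutoff `chi` supported in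
`{|ξ| ≤ 4/3}`, and a radial smooth cutoff `phi` supported in `{3/4 ≤ |ξ| ≤ 8/3}`,
forming a dyadic partition of unity. -/
structure LPData where
  chi : ℝ → ℝ
  phi : ℝ → ℝ
  chi_smooth : ContDiff ℝ (⊤ : ℕ∞) chi
  chi_even : ∀ ξ, chi (-ξ) = chi ξ
  chi_mem : ∀ ξ, chi ξ ∈ Set.Icc (0:ℝ) 1
  chi_supp : ∀ ξ : ℝ, (4:ℝ)/3 < |ξ| → chi ξ = 0
  phi_smooth : ContDiff ℝ (⊤ : ℕ∞) phi
  phi_mem : ∀ ξ, phi ξ ∈ Set.Icc (0:ℝ) 1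
  phi_supp : ∀ ξ : ℝ, (|ξ| < 3/4 ∨ (8:ℝ)/3 < |ξ|) → phi ξ = 0
  partition : ∀ ξ : ℝ, chi ξ + ∑' j : ℕ, phi ((2:ℝ) ^ (-(j:ℤ)) * ξ) = 1

/-- The inverse Fourier transform `𝓕⁻¹ g (x) = (2π)⁻¹ ∫ e^{i x ξ} g(ξ) dξ`. -/
def invFT (g : ℝ → ℂ) : ℝ → ℂ :=
  fun x => (1 / (2 * Real.pi) : ℂ) * ∫ ξ : ℝ, Complex.exp (Complex.I * (x:ℂ) * (ξ:ℂ)) * g ξ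

/-- The Littlewood–Paley block `Δ_j f`: `Δ_{-1} f = 𝓕⁻¹(χ 𝓕 f)`,
`Δ_j f = 𝓕⁻¹(φ(2^{-j}·) 𝓕 f)` for `j ≥ 0` and `Δ_j f = 0` for `j ≤ -2`;
realized as convolution with the inverse Fourier transform of the cutoff. -/
def LPblock (D : LPData) (j : ℤ) (f : ℝ → ℝ) : ℝ → ℝ :=
  if j = -1 then
    fun x => (∫ y : ℝ, invFT (fun ξ => (D.chi ξ : ℂ)) y * (f (x - y) : ℂ)).re
  else if 0 ≤ j then
    fun x => (∫ y : ℝ, invFT (fun ξ => (D.phi ((2:ℝ) ^ (-j) * ξ) : ℂ)) y * (f (x - y) : ℂ)).re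
  else fun _ => 0

/-- The nonhomogeneous Besov norm `‖f‖_{B^s_{p,1}} = ∑_{j ≥ -1} 2^{js} ‖Δ_j f‖_{L^p}`. -/
def besovNorm (D : LPData) (s : ℝ) (p : ℝ≥0∞) (f : ℝ → ℝ) : ℝ≥0∞ :=
  ∑' j : ℤ, ENNReal.ofReal ((2:ℝ) ^ ((j:ℝ) * s)) * eLpNorm (LPblock D j f) p volume

/-- The logarithmic Besov norm `‖f‖_{B^s_{∞,∞,1}} = sup_{j ≥ 1} j · 2^{js} ‖Δ_j f‖_{L^∞}`. -/
def besovLogNorm (D : LPData) (s : ℝ) (f : ℝ → ℝ) : ℝ≥0∞ :=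
  ⨆ j : ℕ, (j : ℝ≥0∞) * ENNReal.ofReal ((2:ℝ) ^ ((j:ℝ) * s)) *
    eLpNorm (LPblock D (j : ℤ) f) ⊤ volume

/-- The operator `(1 - ∂_{xx})⁻¹`, the Fourier multiplier with symbol `(1+ξ²)⁻¹`,
realized as convolution with its kernel `½ e^{-|x|}`. -/
def invOneSub (f : ℝ → ℝ) : ℝ → ℝ :=
  fun x => (1/2) * ∫ y : ℝ, Real.exp (-|y|) * f (x - y)

/-- `sup`-norm of a real function. -/
def supNormR (f : ℝ → ℝ) : ℝ := ⨆ x : ℝ, |f x|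

/-- The `C^{0,1}` norm `‖f‖_{L^∞} + ‖f_x‖_{L^∞}`. -/
def C01NormR (f : ℝ → ℝ) : ℝ := supNormR f + supNormR (deriv f)

/-- Membership in `C^{0,1}(ℝ)`: bounded and Lipschitz. -/
def MemC01 (f : ℝ → ℝ) : Prop :=
  (∃ K : ℝ≥0, LipschitzWith K f) ∧ BddAbove (Set.range fun x => |f x|)

/-- The nonlocal force term of the R-CH equation:
`G(u) = -∂_x (1-∂_{xx})⁻¹ (½ u_x² + c₁ u² + c₂ u³ + c₃ u⁴)`. -/
def RCHForce (c₁ c₂ c₃ : ℝ) (v : ℝ → ℝ) : ℝ → ℝ :=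
  fun x => - deriv (invOneSub (fun y =>
      (deriv v y) ^ 2 / 2 + c₁ * v y ^ 2 + c₂ * v y ^ 3 + c₃ * v y ^ 4)) x

/-- `u` solves the R-CH equation `u_t + u u_x = G(u)` on the time interval `[0,T]`. -/
def IsRCHSol (c₁ c₂ c₃ T : ℝ) (u : ℝ → ℝ → ℝ) : Prop :=
  ∀ t ∈ Set.Icc (0:ℝ) T, ∀ x : ℝ,
    HasDerivAt (fun s => u s x)
      (- u t x * deriv (u t) x + RCHForce c₁ c₂ c₃ (u t) x) t

/-- `E(v) = -∂_x (1-∂_{xx})⁻¹ (v_x²/2)`. -/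
def Edef (v : ℝ → ℝ) : ℝ → ℝ :=
  fun x => - deriv (invOneSub fun y => (deriv v y) ^ 2 / 2) x

/-- The Heaviside function `1_{x ≥ 0}`. -/
def heaviside : ℝ → ℝ := fun x => if 0 ≤ x then 1 else 0

/-- The partial sum `S_N f = ∑_{-1 ≤ j < N} Δ_j f`. -/
def SNsum (D : LPData) (N : ℕ) (f : ℝ → ℝ) : ℝ → ℝ :=
  fun x => ∑ j ∈ Finset.range (N + 1), LPblock D ((j : ℤ) - 1) f x

/-- The explicit initial datum
`u₀(x) = -N^{-1/10} (1-∂_{xx})⁻¹ ∂_x [cos(2^{N+5} x) (1 + N^{-1/10} S_N h(x))]`. -/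
def u0def (D : LPData) (N : ℕ) : ℝ → ℝ :=
  fun x => -((N:ℝ) ^ (-(1:ℝ)/10)) *
    invOneSub (deriv (fun y =>
      Real.cos ((2:ℝ) ^ (N + 5) * y) *
        (1 + (N:ℝ) ^ (-(1:ℝ)/10) * SNsum D N heaviside y))) x

/-- Continuity in time with values in the Besov space `B^s_{p,1}`, on `[0,T]`. -/
def BesovContOn (D : LPData) (s : ℝ) (p : ℝ≥0∞) (T : ℝ) (u : ℝ → ℝ → ℝ) : Prop :=
  (∀ t ∈ Set.Icc (0:ℝ) T, besovNorm D s p (u t) < ⊤) ∧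
  ∀ t ∈ Set.Icc (0:ℝ) T, ∀ ε : ℝ, 0 < ε → ∃ δ > (0:ℝ), ∀ t' ∈ Set.Icc (0:ℝ) T,
    |t' - t| < δ → besovNorm D s p (fun x => u t' x - u t x) < ENNReal.ofReal ε

/-- The source term `F` in the transport equation satisfied by
`E = -(1-∂_{xx})⁻¹ ∂_x (u_x²/2)`. -/
def RCH_F (c₁ c₂ c₃ : ℝ) (v : ℝ → ℝ) : ℝ → ℝ := fun x =>
  c₁/3 * v x ^ 3 + c₂/4 * v x ^ 4 + c₃/5 * v x ^ 5
    - v x * invOneSub (fun y => (deriv v y) ^ 2 / 2) x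
    - invOneSub (fun y =>
        c₁/3 * v y ^ 3 + c₂/4 * v y ^ 4 + c₃/5 * v y ^ 5
          - (1/2) * v y * (deriv v y) ^ 2
          - deriv (fun z => deriv v z *
              invOneSub (fun w =>
                (deriv v w) ^ 2 / 2 + c₁ * v w ^ 2 + c₂ * v w ^ 3 + c₃ * v w ^ 4) z) y) x

end

open scoped SchwartzMap FourierTransform ContDiff

namespace CW

noncomputable section

lemma phi_eq (D : LPData) (ξ : ℝ) : D.phi ξ = D.chi ((2:ℝ)⁻¹ * ξ) - D.chi ξ := by
  have hfin : ∀ ξ : ℝ, Summable (fun j : ℕ => D.phi ((2:ℝ) ^ (-(j:ℤ)) * ξ)) := by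
    intro ξ
    obtain ⟨N, hN⟩ := exists_nat_gt (4/3 * |ξ|)
    refine summable_of_ne_finset_zero (s := Finset.range N) ?_
    intro j hj
    apply D.phi_supp
    left
    have hj' : N ≤ j := by simpa using hj
    have h2 : (j:ℝ) < 2 ^ j := by exact_mod_cast Nat.lt_two_pow_self
    have h3 : (N:ℝ) ≤ j := by exact_mod_cast hj'
    rw [abs_mul, zpow_neg, zpow_natCast, abs_of_pos (by positivity), inv_mul_lt_iff₀ (by positivity)]
    linarith
  have h1 := D.partition ξ
  have h2 := D.partition ((2:ℝ)⁻¹ * ξ)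
  rw [(hfin ξ).tsum_eq_zero_add] at h1
  have : ∀ j : ℕ, (2:ℝ) ^ (-((j + 1 : ℕ):ℤ)) * ξ = (2:ℝ) ^ (-(j:ℤ)) * ((2:ℝ)⁻¹ * ξ) := by
    intro j
    rw [zpow_neg, zpow_neg, zpow_natCast, zpow_natCast, pow_succ, mul_inv]; ring
  simp only [this] at h1
  simp at h1 h2
  linarith

lemma chi_one (D : LPData) (ξ : ℝ) (h : |ξ| < 3/4) : D.chi ξ = 1 := by
  have h1 := D.partition ξ
  have : ∀ j : ℕ, D.phi ((2:ℝ) ^ (-(j:ℤ)) * ξ) = 0 := by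
    intro j
    apply D.phi_supp
    left
    rw [abs_mul, zpow_neg, zpow_natCast, abs_of_pos (by positivity), inv_mul_lt_iff₀ (by positivity)]
    have : (1:ℝ) ≤ 2 ^ j := one_le_pow₀ (by norm_num)
    nlinarith
  simp only [this, tsum_zero, add_zero] at h1
  exact h1

/-- The product `χ(2^{-b}ξ) χ(2^{-a}ξ) = χ(2^{-a}ξ)` for `a < b`. -/
lemma chi_mul (D : LPData) {a b : ℤ} (hab : a < b) (ξ : ℝ) :
    D.chi ((2:ℝ) ^ (-b) * ξ) * D.chi ((2:ℝ) ^ (-a) * ξ) = D.chi ((2:ℝ) ^ (-a) * ξ) := by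
  by_cases h : (4:ℝ)/3 < |(2:ℝ) ^ (-a) * ξ|
  · rw [D.chi_supp _ h, mul_zero]
  · rw [chi_one D ((2:ℝ) ^ (-b) * ξ), one_mul]
    push Not at h
    rw [abs_mul, abs_of_pos (by positivity)] at h ⊢
    have h1 : (2:ℝ) ^ (-b) ≤ (2:ℝ) ^ (-a) / 2 := by
      have : (2:ℝ) ^ (-a) / 2 = (2:ℝ) ^ (-a - 1) := by
        rw [zpow_sub_one₀ (by norm_num)]; rfl
      rw [this]
      exact zpow_le_zpow_right₀ (by norm_num) (by omega)
    have := abs_nonneg ξ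
    nlinarith

/-- symbol function in the Mathlib frequency convention -/
def symF (D : LPData) (a : ℤ) : ℝ → ℂ := fun η => (D.chi ((2:ℝ) ^ (-a) * (2 * Real.pi * η)) : ℂ)

lemma symF_smooth (D : LPData) (a : ℤ) : ContDiff ℝ ∞ (symF D a) := by
  unfold symF
  have := D.chi_smooth
  apply Complex.ofRealCLM.contDiff.comp
  apply this.comp
  fun_prop

lemma symF_compact (D : LPData) (a : ℤ) : HasCompactSupport (symF D a) := by
  apply HasCompactSupport.of_support_subset_isCompact (K := Metric.closedBall 0 ((2:ℝ) ^ a * 2))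
    (isCompact_closedBall _ _)
  intro η hη
  by_contra hc
  apply hη
  simp only [Metric.mem_closedBall, dist_zero_right, Real.norm_eq_abs, not_le] at hc
  unfold symF
  rw [D.chi_supp, Complex.ofReal_zero]
  rw [abs_mul, abs_mul, abs_of_pos (by positivity), abs_of_pos (by positivity), zpow_neg,
    lt_inv_mul_iff₀ (by positivity)]
  have := Real.pi_gt_three
  have h3 : (0:ℝ) < 2 ^ a := by positivity
  nlinarith [abs_nonneg η]

/-- symbol as a Schwartz function -/
def sym (D : LPData) (a : ℤ) : 𝓢(ℝ, ℂ) := (symF_compact D a).toSchwartzMap (symF_smooth D a)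

lemma sym_apply (D : LPData) (a : ℤ) (η : ℝ) :
    sym D a η = (D.chi ((2:ℝ) ^ (-a) * (2 * Real.pi * η)) : ℂ) := rfl

/-- complex low-pass kernel -/
def Lc (D : LPData) (a : ℤ) : 𝓢(ℝ, ℂ) := 𝓕⁻ (sym D a)

/-- real low-pass kernel -/
def Lr (D : LPData) (a : ℤ) : 𝓢(ℝ, ℝ) := (Lc D a).postcompCLM Complex.reCLM

lemma Lr_apply (D : LPData) (a : ℤ) (y : ℝ) : Lr D a y = (Lc D a y).re := rfl

lemma Lc_eq_int (D : LPData) (a : ℤ) (y : ℝ) :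
    Lc D a y = ∫ η : ℝ, Complex.exp (Complex.I * (y:ℂ) * ((2 * Real.pi * η : ℝ):ℂ)) *
      (D.chi ((2:ℝ) ^ (-a) * (2 * Real.pi * η)) : ℂ) := by
  unfold Lc
  rw [SchwartzMap.fourierInv_coe, Real.fourierInv_eq']
  congr 1
  ext η
  rw [smul_eq_mul, sym_apply]
  congr 2
  simp
  ring

lemma invFT_eq (D : LPData) (a : ℤ) (y : ℝ) :
    invFT (fun ξ => (D.chi ((2:ℝ) ^ (-a) * ξ) : ℂ)) y = Lc D a y := by
  rw [Lc_eq_int, invFT]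
  have := MeasureTheory.Measure.integral_comp_mul_left
    (fun ξ : ℝ => Complex.exp (Complex.I * (y:ℂ) * (ξ:ℂ)) * (D.chi ((2:ℝ) ^ (-a) * ξ) : ℂ)) (2 * Real.pi)
  rw [this, abs_of_pos (by positivity), Complex.real_smul]
  push_cast
  simp

lemma Lc_scale (D : LPData) (a : ℤ) (y : ℝ) :
    Lc D a y = ((2:ℝ) ^ a : ℝ) * Lc D 0 ((2:ℝ) ^ a * y) := by
  rw [Lc_eq_int, Lc_eq_int]
  have := MeasureTheory.Measure.integral_comp_mul_left
    (fun η : ℝ => Complex.exp (Complex.I * (((2:ℝ) ^ a * y : ℝ):ℂ) * ((2 * Real.pi * η : ℝ):ℂ)) *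
      (D.chi ((2:ℝ) ^ (-(0:ℤ)) * (2 * Real.pi * η)) : ℂ)) ((2:ℝ) ^ (-a))
  rw [abs_of_pos (by positivity), Complex.real_smul, zpow_neg, inv_inv] at this
  rw [← this]
  congr 1
  ext η
  have h2 : (2:ℝ) ^ a ≠ 0 := by positivity
  congr 2
  · push_cast
    have h3 : (2:ℂ) ^ a ≠ 0 := zpow_ne_zero _ (by norm_num)
    field_simp
  · congr 1
    rw [zpow_neg]; simp; ring

lemma Lc_real (D : LPData) (a : ℤ) (y : ℝ) : Lc D a y = (Lr D a y : ℂ) := by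
  rw [Lr_apply]
  symm
  rw [← Complex.conj_eq_iff_re, Lc_eq_int, ← integral_conj]
  rw [← integral_neg_eq_self]
  congr 1
  ext η
  rw [map_mul, ← Complex.exp_conj, Complex.conj_ofReal]
  congr 2
  · rw [map_mul, map_mul, Complex.conj_I, Complex.conj_ofReal, Complex.conj_ofReal]
    push_cast
    ring
  · rw [← D.chi_even]; congr 1; ring

lemma Lr_scale (D : LPData) (a : ℤ) (y : ℝ) :
    Lr D a y = (2:ℝ) ^ a * Lr D 0 ((2:ℝ) ^ a * y) := by
  have := Lc_scale D a y
  rw [Lc_real, Lc_real] at this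
  exact_mod_cast this

lemma fourier_Lc (D : LPData) (a : ℤ) : 𝓕 (Lc D a) = sym D a := by
  unfold Lc; simp

lemma Lr_integral (D : LPData) : ∫ y, Lr D 0 y = 1 := by
  have h : 𝓕 (Lc D 0) 0 = 1 := by
    rw [fourier_Lc, sym_apply, chi_one] <;> norm_num
  rw [SchwartzMap.fourier_coe, Real.fourier_eq'] at h
  simp [Lc_real, integral_complex_ofReal] at h
  exact_mod_cast h

lemma Lc_conv (D : LPData) {a b : ℤ} (hab : a < b) :
    SchwartzMap.convolution (ContinuousLinearMap.mul ℂ ℂ) (Lc D b) (Lc D a) = Lc D a := by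
  have : 𝓕 (SchwartzMap.convolution (ContinuousLinearMap.mul ℂ ℂ) (Lc D b) (Lc D a)) = sym D a := by
    rw [SchwartzMap.fourier_convolution, fourier_Lc, fourier_Lc]
    ext η
    simp only [SchwartzMap.pairing_apply_apply, ContinuousLinearMap.mul_apply', sym_apply]
    exact_mod_cast chi_mul D hab _
  have h2 := congrArg (fun s : 𝓢(ℝ, ℂ) => (𝓕⁻ s : 𝓢(ℝ, ℂ))) this
  simpa [Lc] using h2

lemma Lr_conv (D : LPData) {a b : ℤ} (hab : a < b) (x : ℝ) :
    ∫ y, Lr D b y * Lr D a (x - y) = Lr D a x := by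
  have := congrArg (fun s : 𝓢(ℝ, ℂ) => s x) (Lc_conv D hab)
  simp only [SchwartzMap.convolution_apply, MeasureTheory.convolution_def, Lc_real,
    ContinuousLinearMap.mul_apply', ← Complex.ofReal_mul, integral_complex_ofReal] at this
  exact_mod_cast this

/-- symbols with primitive -/
lemma exists_div (s : 𝓢(ℝ, ℂ)) (hc : HasCompactSupport s) (r : ℝ) (hr : 0 < r)
    (h0 : ∀ η : ℝ, |η| < r → s η = 0) :
    ∃ t : 𝓢(ℝ, ℂ), HasCompactSupport t ∧ (∀ η : ℝ, |η| < r → t η = 0) ∧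
      ∀ η : ℝ, (2 * Real.pi * Complex.I * η) * t η = s η := by
  set t : ℝ → ℂ := fun η => s η * (2 * Real.pi * Complex.I * η)⁻¹ with ht
  have hcs : HasCompactSupport t := hc.mul_right
  have ht0 : ∀ η : ℝ, |η| < r → t η = 0 := fun η h => by simp [ht, h0 η h]
  have hsm : ContDiff ℝ ∞ t := by
    rw [contDiff_iff_contDiffAt]
    intro η
    by_cases hη : η = 0
    · have : t =ᶠ[𝓝 η] fun _ => 0 := by
        rw [hη]
        filter_upwards [Metric.ball_mem_nhds (0:ℝ) hr] with z hz
        exact ht0 z (by simpa using hz)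
      exact contDiffAt_const.congr_of_eventuallyEq this
    · apply (s.contDiffAt ⊤).mul
      apply ContDiffAt.inv
      · apply ContDiffAt.mul contDiffAt_const
        exact Complex.ofRealCLM.contDiff.contDiffAt
      · simp [hη, Real.pi_ne_zero]
  refine ⟨hcs.toSchwartzMap hsm, hcs, ht0, fun η => ?_⟩
  change (2 * Real.pi * Complex.I * η) * (s η * (2 * Real.pi * Complex.I * η)⁻¹) = s η
  by_cases hη : η = 0
  · rw [hη, h0 0 (by simpa using hr)]; simp
  · have : (2 * Real.pi * Complex.I * η : ℂ) ≠ 0 := by simp [hη, Real.pi_ne_zero]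
    rw [mul_comm, mul_assoc, inv_mul_cancel₀ this, mul_one]

lemma exists_prim (s : 𝓢(ℝ, ℂ)) (hc : HasCompactSupport s) (r : ℝ) (hr : 0 < r)
    (h0 : ∀ η : ℝ, |η| < r → s η = 0) :
    ∃ t : 𝓢(ℝ, ℂ), HasCompactSupport t ∧ (∀ η : ℝ, |η| < r → t η = 0) ∧
      ∀ x : ℝ, HasDerivAt (𝓕⁻ t : 𝓢(ℝ, ℂ)) ((𝓕⁻ s : 𝓢(ℝ, ℂ)) x) x := by
  obtain ⟨t, h1, h2, h3⟩ := exists_div s hc r hr h0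
  refine ⟨t, h1, h2, fun x => ?_⟩
  have key : SchwartzMap.derivCLM ℂ ℂ (𝓕⁻ t : 𝓢(ℝ, ℂ)) = (𝓕⁻ s : 𝓢(ℝ, ℂ)) := by
    have : 𝓕 (SchwartzMap.derivCLM ℂ ℂ (𝓕⁻ t : 𝓢(ℝ, ℂ))) = s := by
      ext η
      rw [SchwartzMap.fourier_coe]
      have h := Real.fourier_deriv (f := (𝓕⁻ t : 𝓢(ℝ, ℂ))) (SchwartzMap.integrable _)
        (SchwartzMap.differentiable _)
        (SchwartzMap.integrable (SchwartzMap.derivCLM ℂ ℂ (𝓕⁻ t : 𝓢(ℝ, ℂ))))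
      have h' := congrFun h η
      rw [← SchwartzMap.fourier_coe] at h'
      refine Eq.trans h' ?_
      rw [← h3 η]
      simp
    rw [← this]; simp
  rw [← key]
  exact SchwartzMap.hasDerivAt _ x

lemma hasDerivAt_re {u : ℝ → ℂ} {v : ℂ} {x : ℝ} (h : HasDerivAt u v x) :
    HasDerivAt (fun y => (u y).re) v.re x :=
  (Complex.reCLM.hasFDerivAt.comp_hasDerivAt x h)

lemma diff_symbol (D : LPData) {a b : ℤ} (hab : a < b) :
    HasCompactSupport (sym D b - sym D a) ∧
      ∀ η : ℝ, |η| < (2:ℝ) ^ a / 10 → (sym D b - sym D a) η = 0 := by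
  constructor
  · exact (symF_compact D b).sub (symF_compact D a)
  · intro η hη
    have h1 : (2:ℝ) ^ a ≤ (2:ℝ) ^ b := zpow_le_zpow_right₀ (by norm_num) hab.le
    have := Real.pi_lt_d2
    have ha : (0:ℝ) < 2 ^ a := by positivity
    have h0 := abs_nonneg η
    rw [sub_apply, sym_apply, sym_apply, chi_one, chi_one, sub_self]
    · rw [abs_mul, abs_mul, abs_of_pos (by positivity), abs_of_pos (by positivity), zpow_neg,
        inv_mul_lt_iff₀ (by positivity)]
      nlinarith
    · rw [abs_mul, abs_mul, abs_of_pos (by positivity), abs_of_pos (by positivity), zpow_neg,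
        inv_mul_lt_iff₀ (by positivity)]
      nlinarith

/-- Differences of low-pass kernels have Schwartz second primitives. -/
lemma exists_prim_diff (D : LPData) {a b : ℤ} (hab : a < b) :
    ∃ P Q : 𝓢(ℝ, ℝ), (∀ x, HasDerivAt P (Q x) x) ∧
      (∀ x, HasDerivAt Q (Lr D b x - Lr D a x) x) := by
  obtain ⟨hc, h0⟩ := diff_symbol D hab
  obtain ⟨t, t1, t2, t3⟩ := exists_prim _ hc _ (by positivity) h0
  obtain ⟨w, w1, w2, w3⟩ := exists_prim _ t1 _ (by positivity) t2
  refine ⟨(𝓕⁻ w : 𝓢(ℝ, ℂ)).postcompCLM Complex.reCLM, (𝓕⁻ t : 𝓢(ℝ, ℂ)).postcompCLM Complex.reCLM,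
    fun x => hasDerivAt_re (w3 x), fun x => ?_⟩
  have h := hasDerivAt_re (t3 x)
  have : (𝓕⁻ (sym D b - sym D a) : 𝓢(ℝ, ℂ)) = Lc D b - Lc D a := by
    unfold Lc; exact map_sub (FourierTransform.fourierInvCLM ℂ 𝓢(ℝ, ℂ)) _ _
  rw [this] at h
  exact h

end

end CW
namespace CW

noncomputable section

/-- convolution of a Schwartz kernel with a bounded function -/
def cv (κ : 𝓢(ℝ, ℝ)) (u : ℝ → ℝ) (x : ℝ) : ℝ := ∫ y, κ y * u (x - y)

/-- bounded measurable functions -/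
def BM (u : ℝ → ℝ) (C : ℝ) : Prop := Measurable u ∧ ∀ x, |u x| ≤ C

/-- derivative of a Schwartz function -/
abbrev sd (κ : 𝓢(ℝ, ℝ)) : 𝓢(ℝ, ℝ) := SchwartzMap.derivCLM ℝ ℝ κ

lemma sd_hasDerivAt (κ : 𝓢(ℝ, ℝ)) (x : ℝ) : HasDerivAt κ (sd κ x) x := κ.hasDerivAt x

/-- L1 norm -/
def N0 (κ : 𝓢(ℝ, ℝ)) : ℝ := ∫ y, |κ y|
/-- first absolute moment -/
def N1 (κ : 𝓢(ℝ, ℝ)) : ℝ := ∫ y, |y| * |κ y|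

lemma N0_nonneg (κ : 𝓢(ℝ, ℝ)) : 0 ≤ N0 κ := integral_nonneg fun _ => abs_nonneg _
lemma N1_nonneg (κ : 𝓢(ℝ, ℝ)) : 0 ≤ N1 κ := integral_nonneg fun _ => by positivity

lemma N0_int (κ : 𝓢(ℝ, ℝ)) : Integrable (fun y => |κ y|) := κ.integrable.abs
lemma N1_int (κ : 𝓢(ℝ, ℝ)) : Integrable (fun y => |y| * |κ y|) := by
  simpa using κ.integrable_pow_mul volume 1

/-- master bound: a kernel integral against a function of linear growth -/
lemma lin_int (κ : 𝓢(ℝ, ℝ)) {q : ℝ → ℝ} (hq : Measurable q) {a b : ℝ}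
    (h : ∀ z, |q z| ≤ a + b * |z|) :
    Integrable (fun z => κ z * q z) ∧ |∫ z, κ z * q z| ≤ a * N0 κ + b * N1 κ := by
  have hg : Integrable (fun z => a * |κ z| + b * (|z| * |κ z|)) :=
    ((N0_int κ).const_mul a).add ((N1_int κ).const_mul b)
  have hb : ∀ z, ‖κ z * q z‖ ≤ a * |κ z| + b * (|z| * |κ z|) := by
    intro z
    rw [Real.norm_eq_abs, abs_mul]
    nlinarith [h z, abs_nonneg (κ z)]
  refine ⟨hg.mono' (κ.continuous.measurable.mul hq).aestronglyMeasurable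
    (Eventually.of_forall hb), ?_⟩
  have := norm_integral_le_of_norm_le hg (Eventually.of_forall hb)
  rw [Real.norm_eq_abs] at this
  refine this.trans (le_of_eq ?_)
  rw [integral_add ((N0_int κ).const_mul a) ((N1_int κ).const_mul b), integral_const_mul,
    integral_const_mul]
  rfl

lemma BM.shift {u : ℝ → ℝ} {C : ℝ} (hu : BM u C) (x : ℝ) : Measurable fun y => u (x - y) :=
  hu.1.comp (measurable_const.sub measurable_id)

lemma cv_int (κ : 𝓢(ℝ, ℝ)) {u : ℝ → ℝ} {C : ℝ} (hu : BM u C) (x : ℝ) :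
    Integrable fun y => κ y * u (x - y) :=
  (lin_int κ (hu.shift x) (a := C) (b := 0) (fun z => by simpa using hu.2 _)).1

lemma cv_bound (κ : 𝓢(ℝ, ℝ)) {u : ℝ → ℝ} {C : ℝ} (hu : BM u C) (x : ℝ) :
    |cv κ u x| ≤ C * N0 κ := by
  simpa [cv] using (lin_int κ (hu.shift x) (a := C) (b := 0) (fun z => by simpa using hu.2 _)).2

lemma cv_swap (κ : 𝓢(ℝ, ℝ)) (u : ℝ → ℝ) (x : ℝ) : cv κ u x = ∫ y, κ (x - y) * u y := by
  have := integral_sub_left_eq_self (fun y => κ y * u (x - y)) volume x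
  rw [cv, ← this]
  simp

lemma cv_hasDerivAt (κ : 𝓢(ℝ, ℝ)) {u : ℝ → ℝ} {C : ℝ} (hu : BM u C) (x : ℝ) :
    HasDerivAt (cv κ u) (cv (sd κ) u x) x := by
  have e1 : cv κ u = fun x => ∫ y, κ (x - y) * u y := funext (cv_swap κ u)
  rw [e1, cv_swap]
  have hC : 0 ≤ C := (abs_nonneg _).trans (hu.2 0)
  obtain ⟨M0, hM0⟩ : ∃ M, ∀ z, |sd κ z| ≤ M :=
    ⟨_, fun z => by simpa using SchwartzMap.norm_le_seminorm ℝ (sd κ) z⟩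
  obtain ⟨M2, hM2⟩ : ∃ M, ∀ z, |z| ^ 2 * |sd κ z| ≤ M :=
    ⟨_, fun z => by simpa using SchwartzMap.norm_pow_mul_le_seminorm ℝ (sd κ) 2 z⟩
  refine (hasDerivAt_integral_of_dominated_loc_of_deriv_le (F := fun x y => κ (x - y) * u y)
    (F' := fun x y => sd κ (x - y) * u y)
    (bound := fun y => (3 * (M0 + M2) * C) * (1 + (x - y) ^ 2)⁻¹)
    (Metric.ball_mem_nhds x one_pos) ?_ ?_ ?_ ?_ ?_ ?_).2
  · refine Eventually.of_forall fun x' => Measurable.aestronglyMeasurable ?_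
    exact (κ.continuous.measurable.comp (measurable_const.sub measurable_id)).mul hu.1
  · have h := cv_int κ hu x
    have h2 := h.comp_sub_left x
    simpa using h2
  · exact (((sd κ).continuous.measurable.comp
      (measurable_const.sub measurable_id)).mul hu.1).aestronglyMeasurable
  · refine Eventually.of_forall fun y x' hx' => ?_
    have hd : |x' - x| < 1 := by simpa [Real.dist_eq] using hx'
    rw [Real.norm_eq_abs, abs_mul]
    have h1 : |sd κ (x' - y)| * (1 + (x' - y) ^ 2) ≤ M0 + M2 := by
      have := hM0 (x' - y); have h3 := hM2 (x' - y)
      rw [sq_abs] at h3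
      linarith
    have h2 : 1 + (x - y) ^ 2 ≤ 3 * (1 + (x' - y) ^ 2) := by
      have := abs_lt.1 hd
      nlinarith [sq_nonneg (2 * (x' - y) + (x' - x)), sq_nonneg (x' - x), sq_nonneg (x'-y + (x'-x))]
    have h4 : |sd κ (x' - y)| ≤ 3 * (M0 + M2) * (1 + (x - y) ^ 2)⁻¹ := by
      rw [← div_eq_mul_inv, le_div_iff₀ (by positivity)]
      nlinarith [abs_nonneg (sd κ (x' - y))]
    calc |sd κ (x' - y)| * |u y| ≤ (3 * (M0 + M2) * (1 + (x - y) ^ 2)⁻¹) * C :=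
          mul_le_mul h4 (hu.2 y) (abs_nonneg _) ((abs_nonneg _).trans h4)
      _ = _ := by ring
  · apply Integrable.const_mul
    exact integrable_inv_one_add_sq.comp_sub_left x
  · refine Eventually.of_forall fun y x' _ => ?_
    have := (sd_hasDerivAt κ (x' - y)).comp_sub_const x' y
    exact this.mul_const (u y)

lemma cv_continuous (κ : 𝓢(ℝ, ℝ)) {u : ℝ → ℝ} {C : ℝ} (hu : BM u C) : Continuous (cv κ u) :=
  continuous_iff_continuousAt.2 fun x => (cv_hasDerivAt κ hu x).continuousAt

lemma cv_BM (κ : 𝓢(ℝ, ℝ)) {u : ℝ → ℝ} {C : ℝ} (hu : BM u C) : BM (cv κ u) (C * N0 κ) :=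
  ⟨(cv_continuous κ hu).measurable, cv_bound κ hu⟩

lemma cv_lip (κ : 𝓢(ℝ, ℝ)) {u : ℝ → ℝ} {C : ℝ} (hu : BM u C) {K : ℝ≥0} (hL : LipschitzWith K u)
    (x : ℝ) : HasDerivAt (cv κ u) (cv κ (deriv u) x) x := by
  refine (hasDerivAt_integral_of_dominated_loc_of_lip (F := fun x y => κ y * u (x - y))
    (F' := fun y => κ y * deriv u (x - y)) (bound := fun y => |κ y| * K) (s := univ)
    univ_mem ?_ (cv_int κ hu x) ?_ ?_ ((N0_int κ).mul_const _) ?_).2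
  · exact Eventually.of_forall fun x' => (cv_int κ hu x').aestronglyMeasurable
  · exact (κ.continuous.measurable.mul ((measurable_deriv u).comp
      (measurable_const.sub measurable_id))).aestronglyMeasurable
  · refine Eventually.of_forall fun y => ?_
    apply LipschitzOnWith.of_dist_le_mul
    intro a _ b _
    rw [Real.dist_eq, ← mul_sub, abs_mul]
    have := hL.dist_le_mul (a - y) (b - y)
    rw [Real.dist_eq, Real.dist_eq, sub_sub_sub_cancel_right] at this
    rw [Real.coe_nnabs, abs_of_nonneg (by positivity : 0 ≤ |κ y| * (K:ℝ)), Real.dist_eq, mul_assoc]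
    exact mul_le_mul_of_nonneg_left this (abs_nonneg _)
  · have h1 : ∀ᵐ z : ℝ, DifferentiableAt ℝ u z := hL.ae_differentiableAt_real
    have h2 : ∀ᵐ y : ℝ, DifferentiableAt ℝ u (x - y) :=
      (Measure.measurePreserving_sub_left volume x).quasiMeasurePreserving.ae h1
    filter_upwards [h2] with y hy
    exact (hy.hasDerivAt.comp_sub_const x y).const_mul (κ y)

lemma cv_assoc {lam mu nu : 𝓢(ℝ, ℝ)} (h : ∀ x, ∫ y, lam y * mu (x - y) = nu x)
    {u : ℝ → ℝ} {C : ℝ} (hu : BM u C) (x : ℝ) : cv lam (cv mu u) x = cv nu u x := by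
  have hmu : BM mu (SchwartzMap.seminorm ℝ 0 0 mu) :=
    ⟨mu.continuous.measurable, fun z => by simpa using SchwartzMap.norm_le_seminorm ℝ mu z⟩
  have key := MeasureTheory.convolution_assoc (ContinuousLinearMap.mul ℝ ℝ)
    (ContinuousLinearMap.mul ℝ ℝ) (ContinuousLinearMap.mul ℝ ℝ) (ContinuousLinearMap.mul ℝ ℝ)
    (f := lam) (g := mu) (k := u) (x₀ := x) (μ := volume) (ν := volume)
    (fun x y z => by simp [mul_assoc]) lam.continuous.aestronglyMeasurable
    mu.continuous.aestronglyMeasurable hu.1.aestronglyMeasurable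
    (Eventually.of_forall fun y => by simpa [ConvolutionExistsAt] using cv_int lam hmu y)
    (Eventually.of_forall fun y => by
      simpa [ConvolutionExistsAt, abs_mul] using (cv_int mu hu y).abs)
    (by
      have hua : Measurable fun z => |u z| := hu.1.abs
      have hc : ∀ z, abs (∫ t, |mu t| * |u (z - t)|) ≤ C * N0 mu := by
        intro z
        have := norm_integral_le_of_norm_le ((N0_int mu).mul_const C)
          (f := fun t => |mu t| * |u (z - t)|) (Eventually.of_forall fun t => by
            rw [Real.norm_eq_abs, abs_mul, abs_abs, abs_abs]
            exact mul_le_mul_of_nonneg_left (hu.2 _) (abs_nonneg _))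
        rw [integral_mul_const, mul_comm] at this
        exact this
      have hm : Measurable fun z => ∫ t, |mu t| * |u (z - t)| := by
        refine StronglyMeasurable.measurable ?_
        apply StronglyMeasurable.integral_prod_right
          (f := fun z t : ℝ => |mu t| * |u (z - t)|)
        apply Measurable.stronglyMeasurable
        exact ((mu.continuous.measurable.comp measurable_snd).abs).mul
          (hua.comp (measurable_fst.sub measurable_snd))
      have := (lin_int lam (hm.comp (measurable_const.sub measurable_id) : Measurable
        (fun y => ∫ t, |mu t| * |u ((x - y) - t)|)) (a := C * N0 mu) (b := 0)
        (fun z => by simpa using hc _)).1.abs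
      simp only [ConvolutionExistsAt, MeasureTheory.convolution_def, ContinuousLinearMap.mul_apply',
        Real.norm_eq_abs]
      refine this.congr (Eventually.of_forall fun y => ?_)
      simp only [abs_mul]
      congr 1
      exact abs_of_nonneg (integral_nonneg fun t => by positivity))
  simp only [MeasureTheory.convolution_def, ContinuousLinearMap.mul_apply', h] at key
  exact key.symm

end

end CW
namespace CW

noncomputable section

lemma ibp {Q κ : 𝓢(ℝ, ℝ)} (hQ : ∀ x, HasDerivAt Q (κ x) x) {q q1 : ℝ → ℝ}
    (hq : ∀ z, HasDerivAt q (q1 z) z) (hm : Measurable q1) {a b c d : ℝ}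
    (h1 : ∀ z, |q z| ≤ a + b * |z|) (h2 : ∀ z, |q1 z| ≤ c + d * |z|) :
    ∫ z, κ z * q z = - ∫ z, Q z * q1 z := by
  have hqm : Measurable q :=
    (continuous_iff_continuousAt.2 fun z => (hq z).continuousAt).measurable
  have := integral_mul_deriv_eq_deriv_mul_of_integrable (u := Q) (v := q) (u' := κ) (v' := q1)
    (fun x _ => hQ x) (fun x _ => hq x) (lin_int Q hm h2).1 (lin_int κ hqm h1).1 (lin_int Q hqm h1).1
  rw [this, neg_neg]

lemma incr {F a : ℝ → ℝ} {α : ℝ} (hF : ∀ x, HasDerivAt F (a x) x) (ha : ∀ x, |a x| ≤ α)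
    (x z : ℝ) : |F (x - z) - F x| ≤ α * |z| := by
  have := Convex.norm_image_sub_le_of_norm_hasDerivWithin_le (f := F) (f' := a) (s := univ)
    (C := α) (fun y _ => (hF y).hasDerivWithinAt) (fun y _ => ha y) convex_univ (mem_univ x)
    (mem_univ (x - z))
  simpa using this

lemma hd_shift {F a : ℝ → ℝ} (hF : ∀ x, HasDerivAt F (a x) x) (x z : ℝ) :
    HasDerivAt (fun z => F (x - z)) (-(a (x - z))) z := by
  simpa using (hF (x - z)).comp_const_sub x z

/-- the commutator integral -/
def R (κ : 𝓢(ℝ, ℝ)) (F b : ℝ → ℝ) (x : ℝ) : ℝ := ∫ z, κ z * ((F (x - z) - F x) * b (x - z))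

lemma meas_shift {a : ℝ → ℝ} (ha : Measurable a) (x : ℝ) : Measurable fun z => a (x - z) :=
  ha.comp (measurable_const.sub measurable_id)

lemma meas_of_deriv {F a : ℝ → ℝ} (hF : ∀ x, HasDerivAt F (a x) x) : Measurable F :=
  (continuous_iff_continuousAt.2 fun z => (hF z).continuousAt).measurable

lemma R_int (κ : 𝓢(ℝ, ℝ)) {F a b : ℝ → ℝ} {α β : ℝ} (hF : ∀ x, HasDerivAt F (a x) x)
    (ha : ∀ x, |a x| ≤ α) (hb : BM b β) (x : ℝ) :
    Integrable (fun z => κ z * ((F (x - z) - F x) * b (x - z))) := by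
  have hα : 0 ≤ α := (abs_nonneg _).trans (ha 0)
  refine (lin_int κ (q := fun z => (F (x - z) - F x) * b (x - z))
    (((meas_shift (meas_of_deriv hF) x).sub_const _).mul (meas_shift hb.1 x))
    (a := 0) (b := α * β) (fun z => ?_)).1
  rw [abs_mul]
  have h1 := incr hF ha x z
  have h2 := hb.2 (x - z)
  calc _ ≤ (α * |z|) * β := mul_le_mul h1 h2 (abs_nonneg _) (by positivity)
    _ = _ := by ring

lemma R2 (κ : 𝓢(ℝ, ℝ)) {F a G b : ℝ → ℝ} {α β β' : ℝ} (hF : ∀ x, HasDerivAt F (a x) x)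
    (hG : ∀ x, HasDerivAt G (b x) x) (ha : BM a α) (hGb : ∀ x, |G x| ≤ β) (hb : BM b β') (x : ℝ) :
    |R κ F b x| ≤ α * β * (N1 (sd κ) + N0 κ) := by
  have hα : 0 ≤ α := (abs_nonneg _).trans (ha.2 0)
  have hβ : 0 ≤ β := (abs_nonneg _).trans (hGb 0)
  have hβ' : 0 ≤ β' := (abs_nonneg _).trans (hb.2 0)
  have mF := meas_shift (meas_of_deriv hF) x
  have mG := meas_shift (meas_of_deriv hG) x
  have ma := meas_shift ha.1 x
  have mb := meas_shift hb.1 x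
  have b1 : ∀ z, |(F (x - z) - F x) * G (x - z)| ≤ 0 + α * β * |z| := fun z => by
    rw [abs_mul]
    calc _ ≤ (α * |z|) * β := mul_le_mul (incr hF ha.2 x z) (hGb _) (abs_nonneg _) (by positivity)
      _ = _ := by ring
  have b2 : ∀ z, |a (x - z) * G (x - z)| ≤ α * β + 0 * |z| := fun z => by
    rw [abs_mul, zero_mul, add_zero]
    exact mul_le_mul (ha.2 _) (hGb _) (abs_nonneg _) hα
  have b3 : ∀ z, |(F (x - z) - F x) * b (x - z)| ≤ 0 + α * β' * |z| := fun z => by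
    rw [abs_mul]
    calc _ ≤ (α * |z|) * β' := mul_le_mul (incr hF ha.2 x z) (hb.2 _) (abs_nonneg _) (by positivity)
      _ = _ := by ring
  have key := ibp (Q := κ) (κ := sd κ) (sd_hasDerivAt κ)
    (q := fun z => (F (x - z) - F x) * G (x - z))
    (q1 := fun z => -(a (x - z) * G (x - z)) - (F (x - z) - F x) * b (x - z))
    (fun z => by
      have := ((hd_shift hF x z).sub_const (F x)).mul (hd_shift hG x z)
      exact this.congr_deriv (by ring))
    (((ma.mul mG).neg).sub ((mF.sub_const _).mul mb)) b1 (c := α * β) (d := α * β')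
    (fun z => by
      refine (abs_sub _ _).trans ?_
      rw [abs_neg]
      linarith [b2 z, b3 z])
  have l1 := lin_int (sd κ) (q := fun z => (F (x - z) - F x) * G (x - z)) ((mF.sub_const (F x)).mul mG) b1
  have l2 := lin_int κ (q := fun z => a (x - z) * G (x - z)) (ma.mul mG) b2
  have l3 := lin_int κ (q := fun z => (F (x - z) - F x) * b (x - z)) ((mF.sub_const (F x)).mul mb) b3
  have e : ∫ z, κ z * (-(a (x - z) * G (x - z)) - (F (x - z) - F x) * b (x - z)) =
      - (∫ z, κ z * (a (x - z) * G (x - z))) - R κ F b x := by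
    have h := integral_sub l2.1.neg l3.1
    simp only [Pi.neg_apply, integral_neg] at h
    rw [R, ← h]
    congr 1; ext z; ring
  rw [e] at key
  have e2 : R κ F b x = (∫ z, sd κ z * ((F (x - z) - F x) * G (x - z)))
     - ∫ z, κ z * (a (x - z) * G (x - z)) := by linarith
  rw [e2]
  refine (abs_sub _ _).trans ?_
  linarith [l1.2, l2.2]

lemma R3 (κ : 𝓢(ℝ, ℝ)) {F b : ℝ → ℝ} {φ β : ℝ} (hF : BM F φ)
    (hb : BM b β) (x : ℝ) : |R κ F b x| ≤ 2 * φ * β * N0 κ := by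
  have hβ : 0 ≤ β := (abs_nonneg _).trans (hb.2 0)
  have hφ : 0 ≤ φ := (abs_nonneg _).trans (hF.2 0)
  have := (lin_int κ (q := fun z => (F (x - z) - F x) * b (x - z)) (((meas_shift hF.1 x).sub_const (F x)).mul (meas_shift hb.1 x))
    (a := 2 * φ * β) (b := 0) (fun z => by
      rw [abs_mul, zero_mul, add_zero]
      refine mul_le_mul ?_ (hb.2 _) (abs_nonneg _) (by positivity)
      refine (abs_sub _ _).trans ?_
      linarith [hF.2 (x - z), hF.2 x])).2
  simpa [R] using this

lemma R4 {P Q κ : 𝓢(ℝ, ℝ)} (hP : ∀ x, HasDerivAt P (Q x) x) (hQ : ∀ x, HasDerivAt Q (κ x) x)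
    {F a a1 b b1 b2 : ℝ → ℝ} {α α1 β β1 β2 : ℝ} (hF : ∀ x, HasDerivAt F (a x) x)
    (ha : ∀ x, HasDerivAt a (a1 x) x) (hb : ∀ x, HasDerivAt b (b1 x) x)
    (hb1 : ∀ x, HasDerivAt b1 (b2 x) x) (Ba : ∀ x, |a x| ≤ α) (Ba1 : BM a1 α1)
    (Bb : ∀ x, |b x| ≤ β) (Bb1 : ∀ x, |b1 x| ≤ β1) (Bb2 : BM b2 β2) (x : ℝ) :
    |R κ F b x| ≤ (α1 * β + 2 * (α * β1)) * N0 P + α * β2 * N1 P := by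
  have hα : 0 ≤ α := (abs_nonneg _).trans (Ba 0)
  have hα1 : 0 ≤ α1 := (abs_nonneg _).trans (Ba1.2 0)
  have hβ : 0 ≤ β := (abs_nonneg _).trans (Bb 0)
  have hβ1 : 0 ≤ β1 := (abs_nonneg _).trans (Bb1 0)
  have hβ2 : 0 ≤ β2 := (abs_nonneg _).trans (Bb2.2 0)
  have mF := meas_shift (meas_of_deriv hF) x
  have ma := meas_shift (meas_of_deriv ha) x
  have mb := meas_shift (meas_of_deriv hb) x
  have mb1 := meas_shift (meas_of_deriv hb1) x
  have ma1 := meas_shift Ba1.1 x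
  have mb2 := meas_shift Bb2.1 x
  have prodF : ∀ (w : ℝ → ℝ) (γ : ℝ), 0 ≤ γ → (∀ x, |w x| ≤ γ) → ∀ z,
      |(F (x - z) - F x) * w (x - z)| ≤ α * γ * |z| := fun w γ hγ hw z => by
    rw [abs_mul]
    calc _ ≤ (α * |z|) * γ := mul_le_mul (incr hF Ba x z) (hw _) (abs_nonneg _) (by positivity)
      _ = _ := by ring
  have prod : ∀ (v w : ℝ → ℝ) (δ γ : ℝ), 0 ≤ δ → (∀ x, |v x| ≤ δ) → (∀ x, |w x| ≤ γ) → ∀ z,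
      |v (x - z) * w (x - z)| ≤ δ * γ := fun v w δ γ hγ hv hw z => by
    rw [abs_mul]
    exact mul_le_mul (hv _) (hw _) (abs_nonneg _) hγ
  have key1 := ibp hQ (q := fun z => (F (x - z) - F x) * b (x - z))
    (q1 := fun z => -(a (x - z) * b (x - z)) - (F (x - z) - F x) * b1 (x - z))
    (fun z => by
      have := ((hd_shift hF x z).sub_const (F x)).mul (hd_shift hb x z)
      exact this.congr_deriv (by ring))
    (((ma.mul mb).neg).sub ((mF.sub_const _).mul mb1)) (a := 0) (b := α * β) (c := α * β)
    (d := α * β1)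
    (fun z => by linarith [prodF b β hβ Bb z])
    (fun z => by
      refine (abs_sub _ _).trans ?_
      rw [abs_neg]
      linarith [prod a b α β hα Ba Bb z, prodF b1 β1 hβ1 Bb1 z])
  have mq2 : Measurable (fun z => a1 (x - z) * b (x - z) + 2 * (a (x - z) * b1 (x - z))
      + (F (x - z) - F x) * b2 (x - z)) :=
    ((ma1.mul mb).add ((ma.mul mb1).const_mul 2)).add ((mF.sub_const (F x)).mul mb2)
  have bq2 : ∀ z, |a1 (x - z) * b (x - z) + 2 * (a (x - z) * b1 (x - z))
      + (F (x - z) - F x) * b2 (x - z)| ≤ (α1 * β + 2 * (α * β1)) + α * β2 * |z| := fun z => by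
    refine (abs_add_three _ _ _).trans ?_
    rw [abs_mul 2, abs_two]
    linarith [prod a1 b α1 β hα1 Ba1.2 Bb z, prod a b1 α β1 hα Ba Bb1 z, prodF b2 β2 hβ2 Bb2.2 z]
  have key2 := ibp hP
    (q := fun z => -(a (x - z) * b (x - z)) - (F (x - z) - F x) * b1 (x - z))
    (q1 := fun z => a1 (x - z) * b (x - z) + 2 * (a (x - z) * b1 (x - z))
      + (F (x - z) - F x) * b2 (x - z))
    (fun z => by
      have := (((hd_shift ha x z).mul (hd_shift hb x z)).neg).sub
        (((hd_shift hF x z).sub_const (F x)).mul (hd_shift hb1 x z))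
      exact this.congr_deriv (by ring)) mq2 (a := α * β) (b := α * β1)
    (fun z => by
      refine (abs_sub _ _).trans ?_
      rw [abs_neg]
      linarith [prod a b α β hα Ba Bb z, prodF b1 β1 hβ1 Bb1 z]) bq2
  rw [R, key1, key2, neg_neg]
  exact (lin_int P mq2 bq2).2

end

end CW
namespace CW

noncomputable section

/-- the L1-normalised dilation of a Schwartz function -/
def dil (j : ℤ) (κ : 𝓢(ℝ, ℝ)) : 𝓢(ℝ, ℝ) :=
  (2:ℝ) ^ j • SchwartzMap.compCLMOfContinuousLinearEquiv ℝ
    (ContinuousLinearEquiv.unitsEquivAut ℝ (Units.mk0 ((2:ℝ) ^ j) (by positivity))) κ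

lemma dil_apply (j : ℤ) (κ : 𝓢(ℝ, ℝ)) (x : ℝ) : dil j κ x = 2 ^ j * κ (2 ^ j * x) := by
  simp [dil, mul_comm]

lemma N0_dil (j : ℤ) (κ : 𝓢(ℝ, ℝ)) : N0 (dil j κ) = N0 κ := by
  have h := Measure.integral_comp_mul_left (fun x => |κ x|) ((2:ℝ) ^ j)
  have hp : (0:ℝ) < 2 ^ j := by positivity
  simp only [N0, dil_apply, abs_mul, abs_of_pos hp, integral_const_mul]
  rw [h, abs_of_pos (inv_pos.2 hp), smul_eq_mul]
  field_simp

lemma N1_dil (j : ℤ) (κ : 𝓢(ℝ, ℝ)) : N1 (dil j κ) = (2 ^ j)⁻¹ * N1 κ := by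
  have h := Measure.integral_comp_mul_left (fun x => |x| * |κ x|) ((2:ℝ) ^ j)
  have hp : (0:ℝ) < 2 ^ j := by positivity
  have e : ∀ y, |y| * |dil j κ y| = |2 ^ j * y| * |κ (2 ^ j * y)| := by
    intro y
    rw [dil_apply, abs_mul, abs_mul, abs_of_pos hp]; ring
  simp only [N1, e]
  rw [h, abs_of_pos (inv_pos.2 hp), smul_eq_mul]

lemma hd_dil (j : ℤ) {κ lam : 𝓢(ℝ, ℝ)} (h : ∀ x, HasDerivAt κ (lam x) x) (x : ℝ) :
    HasDerivAt (dil j κ) (2 ^ j * dil j lam x) x := by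
  have e : (dil j κ : ℝ → ℝ) = fun x => 2 ^ j * κ (2 ^ j * x) := funext (dil_apply j κ)
  rw [e, dil_apply]
  have h1 := (h (2 ^ j * x)).comp x ((hasDerivAt_id x).const_mul ((2:ℝ) ^ j))
  exact (h1.const_mul ((2:ℝ) ^ j)).congr_deriv (by ring)

lemma sd_dil (j : ℤ) (κ : 𝓢(ℝ, ℝ)) : sd (dil j κ) = (2:ℝ) ^ j • dil j (sd κ) := by
  ext x
  rw [(sd_hasDerivAt (dil j κ) x).unique (hd_dil j (sd_hasDerivAt κ) x)]
  simp

lemma sd_smul (c : ℝ) (κ : 𝓢(ℝ, ℝ)) : sd (c • κ) = c • sd κ := by simp [sd]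

lemma N0_smul (c : ℝ) (κ : 𝓢(ℝ, ℝ)) : N0 (c • κ) = |c| * N0 κ := by
  simp [N0, abs_mul, integral_const_mul]

lemma N1_smul (c : ℝ) (κ : 𝓢(ℝ, ℝ)) : N1 (c • κ) = |c| * N1 κ := by
  simp only [N1, ← integral_const_mul]
  congr 1; ext y
  simp [abs_mul]; ring

lemma Lr_dil (D : LPData) (a : ℤ) : Lr D a = dil a (Lr D 0) := by
  ext x; rw [Lr_scale, dil_apply]

lemma Lr_dil2 (D : LPData) (a b : ℤ) : Lr D (a + b) = dil a (Lr D b) := by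
  ext x; rw [Lr_scale, dil_apply, Lr_scale D b, zpow_add₀ two_ne_zero, mul_assoc, mul_left_comm _ (2 ^ b)]
  ring_nf

lemma dil_sub (j : ℤ) (κ lam : 𝓢(ℝ, ℝ)) : dil j (κ - lam) = dil j κ - dil j lam := by
  ext x; simp [dil_apply, mul_sub]

/-- the block kernels, shifted by one -/
def K (D : LPData) : ℕ → 𝓢(ℝ, ℝ)
  | 0 => Lr D 0
  | n + 1 => Lr D ((n:ℤ) + 1) - Lr D n

/-- mother kernel -/
def Lam (D : LPData) : 𝓢(ℝ, ℝ) := Lr D 1 - Lr D 0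

lemma K_succ (D : LPData) (n : ℕ) : K D (n + 1) = dil n (Lam D) := by
  rw [Lam, dil_sub, ← Lr_dil2, ← Lr_dil]; rfl

lemma N0_K (D : LPData) (n : ℕ) : N0 (K D n) ≤ N0 (Lr D 0) + N0 (Lam D) := by
  cases n with
  | zero => exact le_add_of_nonneg_right (N0_nonneg _)
  | succ n => rw [K_succ, N0_dil]; exact le_add_of_nonneg_left (N0_nonneg _)

lemma N1_sd_K (D : LPData) (n : ℕ) :
    N1 (sd (K D n)) ≤ N1 (sd (Lr D 0)) + N1 (sd (Lam D)) := by
  cases n with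
  | zero => exact le_add_of_nonneg_right (N1_nonneg _)
  | succ n =>
    rw [K_succ, sd_dil, N1_smul, N1_dil, abs_of_pos (by positivity), mul_inv_cancel_left₀ (by positivity)]
    exact le_add_of_nonneg_left (N1_nonneg _)

lemma N0_sd_Lr (D : LPData) (n : ℕ) (i : ℕ) :
    N0 (sd^[i] (Lr D n)) = (2 ^ n) ^ i * N0 (sd^[i] (Lr D 0)) := by
  have : ∀ i, sd^[i] (Lr D n) = ((2:ℝ) ^ n) ^ i • dil n (sd^[i] (Lr D 0)) := by
    intro i
    induction i with
    | zero => simp [Lr_dil D n]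
    | succ i ih =>
      rw [Function.iterate_succ_apply', Function.iterate_succ_apply', ih, sd_smul, sd_dil, smul_smul]
      simp [pow_succ]
  rw [this, N0_smul, N0_dil, abs_of_pos (by positivity)]

lemma Lr_int (D : LPData) (a b : ℤ) (x : ℝ) :
    Integrable fun y => Lr D a y * Lr D b (x - y) :=
  cv_int (u := Lr D b) (C := SchwartzMap.seminorm ℝ 0 0 (Lr D b)) _
    ⟨(Lr D b).continuous.measurable, fun z => by simpa using SchwartzMap.norm_le_seminorm ℝ (Lr D b) z⟩ x

lemma Lr_conv' (D : LPData) {a b : ℤ} (hab : a < b) (x : ℝ) :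
    ∫ y, Lr D a y * Lr D b (x - y) = Lr D a x := by
  rw [← Lr_conv D hab x, ← integral_sub_left_eq_self (fun y => Lr D a y * Lr D b (x - y)) volume x]
  simp [mul_comm]

lemma K_rep (D : LPData) (n : ℕ) (x : ℝ) :
    ∫ y, Lr D ((n:ℤ) + 1) y * K D n (x - y) = K D n x := by
  cases n with
  | zero => exact Lr_conv D (by norm_num) x
  | succ n =>
    simp only [K, sub_apply, mul_sub]
    rw [integral_sub (Lr_int D _ _ x) (Lr_int D _ _ x), Lr_conv D (by push_cast; omega),
      Lr_conv D (by push_cast; omega)]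

/-- wide annular kernel -/
def Aw (D : LPData) (m : ℕ) : 𝓢(ℝ, ℝ) := Lr D ((m:ℤ) + 2) - Lr D ((m:ℤ) + (-1))

lemma Aw_rep (D : LPData) (m : ℕ) (x : ℝ) :
    ∫ y, Aw D m y * K D (m + 1) (x - y) = K D (m + 1) x := by
  simp only [K, Aw, sub_apply, mul_sub, sub_mul]
  have hi : ∀ a b c : ℤ,
      Integrable fun y => Lr D a y * Lr D c (x - y) - Lr D b y * Lr D c (x - y) :=
    fun a b c => (Lr_int D a c x).sub (Lr_int D b c x)
  rw [integral_sub (hi _ _ _) (hi _ _ _), integral_sub (Lr_int D _ _ x) (Lr_int D _ _ x), integral_sub (Lr_int D _ _ x) (Lr_int D _ _ x),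
    Lr_conv D (show (m:ℤ) + 1 < m + 2 by omega), Lr_conv D (show (m:ℤ) < m + 2 by omega),
    Lr_conv' D (show (m:ℤ) + (-1) < m + 1 by omega), Lr_conv' D (show (m:ℤ) + (-1) < m by omega)]
  ring

lemma Aw_dil (D : LPData) (m : ℕ) : Aw D m = dil m (Lr D 2 - Lr D (-1)) := by
  rw [dil_sub, ← Lr_dil2, ← Lr_dil2]; rfl

lemma K_rep_cv (D : LPData) (n : ℕ) {u : ℝ → ℝ} {C : ℝ} (hu : BM u C) :
    cv (Lr D ((n:ℤ) + 1)) (cv (K D n) u) = cv (K D n) u :=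
  funext fun x => cv_assoc (K_rep D n) hu x

lemma Aw_rep_cv (D : LPData) (m : ℕ) {u : ℝ → ℝ} {C : ℝ} (hu : BM u C) :
    cv (Aw D m) (cv (K D (m + 1)) u) = cv (K D (m + 1)) u :=
  funext fun x => cv_assoc (Aw_rep D m) hu x

/-- Bernstein derivative -/
lemma bern (D : LPData) (n i : ℕ) {u : ℝ → ℝ} {γ : ℝ} (hu : BM u γ) :
    (∀ x, HasDerivAt (cv (sd^[i] (Lr D ((n:ℤ) + 1))) u) (cv (sd^[i+1] (Lr D ((n:ℤ) + 1))) u x) x) ∧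
    BM (cv (sd^[i] (Lr D ((n:ℤ) + 1))) u) (2 ^ i * N0 (sd^[i] (Lr D 0)) * (2 ^ n) ^ i * γ) := by
  constructor
  · intro x
    rw [Function.iterate_succ_apply']
    exact cv_hasDerivAt _ hu x
  · have := cv_BM (sd^[i] (Lr D ((n:ℤ) + 1))) hu
    have h := N0_sd_Lr D (n + 1) i
    push_cast at h
    rw [h] at this
    convert this using 1
    rw [pow_succ, mul_pow]; ring

end

end CW
namespace CW

noncomputable section

lemma BM.mono {u : ℝ → ℝ} {C C' : ℝ} (h : BM u C) (hC : C ≤ C') : BM u C' :=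
  ⟨h.1, fun x => (h.2 x).trans hC⟩

lemma BM.nonneg {u : ℝ → ℝ} {C : ℝ} (h : BM u C) : 0 ≤ C := (abs_nonneg _).trans (h.2 0)

/-- data for a piece of `f` -/
structure FP (c : ℝ) (k : ℕ) (F a a1 : ℝ → ℝ) (α : ℝ) : Prop where
  hF : ∀ x, HasDerivAt F (a x) x
  ha : ∀ x, HasDerivAt a (a1 x) x
  Ba : BM a α
  Ba1 : BM a1 (c * 2 ^ k * α)
  BF : 1 ≤ k → BM F (c * (2 ^ k)⁻¹ * α)

/-- data for a piece of `g` -/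
structure GP (c : ℝ) (l : ℕ) (G b b1 b2 : ℝ → ℝ) (β : ℝ) : Prop where
  hG : ∀ x, HasDerivAt G (b x) x
  hb : ∀ x, HasDerivAt b (b1 x) x
  hb1 : ∀ x, HasDerivAt b1 (b2 x) x
  BG : ∀ x, |G x| ≤ β
  Bb : BM b (c * 2 ^ l * β)
  Bb1 : BM b1 (c * (2 ^ l) ^ 2 * β)
  Bb2 : BM b2 (c * (2 ^ l) ^ 3 * β)

lemma exists_GP (D : LPData) : ∃ c : ℝ, 0 ≤ c ∧ ∀ (l : ℕ) (g : ℝ → ℝ) (Cg : ℝ) (β : ℝ), BM g Cg →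
    (∀ x, |cv (K D l) g x| ≤ β) → ∃ b b1 b2, GP c l (cv (K D l) g) b b1 b2 β := by
  set c1 := N0 (sd^[1] (Lr D 0))
  set c2 := N0 (sd^[2] (Lr D 0))
  set c3 := N0 (sd^[3] (Lr D 0))
  have h1 : 0 ≤ c1 := N0_nonneg _
  have h2 : 0 ≤ c2 := N0_nonneg _
  have h3 : 0 ≤ c3 := N0_nonneg _
  refine ⟨2 ^ 1 * c1 + 2 ^ 2 * c2 + 2 ^ 3 * c3, by positivity, fun l g Cg β hg hβ => ?_⟩
  have hG : BM (cv (K D l) g) β := ⟨(cv_continuous _ hg).measurable, hβ⟩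
  have hβ0 := hG.nonneg
  have B0 := bern D l 0 hG
  have B1 := bern D l 1 hG
  have B2 := bern D l 2 hG
  have B3 := bern D l 3 hG
  have e0 : cv (sd^[0] (Lr D ((l:ℤ) + 1))) (cv (K D l) g) = cv (K D l) g := K_rep_cv D l hg
  rw [e0] at B0
  refine ⟨_, _, _, B0.1, B1.1, B2.1, hβ, ?_, ?_, ?_⟩
  · refine B1.2.mono ?_
    rw [pow_one (2 ^ l : ℝ)]
    gcongr
    linarith
  · refine B2.2.mono ?_
    gcongr
    linarith
  · refine B3.2.mono ?_
    gcongr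
    linarith

lemma exists_FP (D : LPData) : ∃ c : ℝ, 0 ≤ c ∧ ∀ (k : ℕ) (f : ℝ → ℝ) (Cf : ℝ) (L : ℝ≥0) (α : ℝ),
    BM f Cf → LipschitzWith L f → 
    (∀ x, |cv (K D k) (deriv f) x| ≤ α) →
      ∃ a1, FP c k (cv (K D k) f) (cv (K D k) (deriv f)) a1 α := by
  obtain ⟨-, Q, -, hQ⟩ := exists_prim_diff D (show (-1:ℤ) < 2 by norm_num)
  set c1 := N0 (sd^[1] (Lr D 0))
  have h1 : 0 ≤ c1 := N0_nonneg _
  have h2 : 0 ≤ N0 Q := N0_nonneg _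
  refine ⟨2 ^ 1 * c1 + 2 * N0 Q, by positivity, fun k f Cf L α hf hL hα => ?_⟩
  have hdf : BM (deriv f) L := ⟨measurable_deriv f, fun x => by
    simpa using norm_deriv_le_of_lipschitz hL⟩
  have hG : BM (cv (K D k) (deriv f)) α := ⟨(cv_continuous _ hdf).measurable, hα⟩
  have hβ0 := hG.nonneg
  have B0 := bern D k 0 hG
  have B1 := bern D k 1 hG
  have e0 : cv (sd^[0] (Lr D ((k:ℤ) + 1))) (cv (K D k) (deriv f)) = cv (K D k) (deriv f) :=
    K_rep_cv D k hdf
  rw [e0] at B0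
  refine ⟨_, cv_lip _ hf hL, B0.1, hG, ?_, ?_⟩
  · refine B1.2.mono ?_
    rw [pow_one (2 ^ k : ℝ)]
    gcongr
    linarith
  · intro hk
    obtain ⟨m, rfl⟩ := Nat.exists_eq_add_of_le' hk
    have hF := cv_BM (K D (m + 1)) hf
    refine ⟨hF.1, fun x => ?_⟩
    rw [← Aw_rep_cv D m hf]
    have hA : ∀ x, HasDerivAt (((2:ℝ) ^ m)⁻¹ • dil m Q) (Aw D m x) x := fun x => by
      have := (hd_dil m (lam := Lr D 2 - Lr D (-1)) hQ x).const_mul (((2:ℝ) ^ m)⁻¹)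
      refine this.congr_deriv ?_
      rw [Aw_dil, zpow_natCast, inv_mul_cancel_left₀ (by positivity)]
    have key := ibp (Q := ((2:ℝ) ^ m)⁻¹ • dil m Q) (κ := Aw D m) hA
      (q := fun z => cv (K D (m + 1)) f (x - z))
      (q1 := fun z => - cv (K D (m + 1)) (deriv f) (x - z))
      (fun z => hd_shift (fun y => cv_lip _ hf hL y) x z) (meas_shift hG.1 x).neg
      (a := Cf * N0 (K D (m + 1))) (b := 0) (c := α) (d := 0)
      (fun z => by simpa using hF.2 _) (fun z => by simpa using hG.2 _)
    rw [cv, key, abs_neg]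
    refine ((lin_int _ (meas_shift hG.1 x).neg (a := α) (b := 0)
      (fun z => by simpa using hG.2 _)).2).trans ?_
    rw [N0_smul, N0_dil, abs_of_pos (by positivity), zero_mul, add_zero, pow_succ 2 m, mul_inv]
    have : (0:ℝ) < (2 ^ m)⁻¹ := by positivity
    have h5 : 0 ≤ α * (2 ^ m)⁻¹ * c1 := by positivity
    nlinarith

lemma exists_triple (D : LPData) (c : ℝ) (hc : 0 ≤ c) : ∃ C : ℝ, 0 ≤ C ∧
    ∀ (n k l : ℕ) (F a a1 G b b1 b2 : ℝ → ℝ) (α β : ℝ), FP c k F a a1 α → GP c l G b b1 b2 β →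
    ∀ x, 2 ^ n * |R (K D n) F b x| ≤ C * α * (2 ^ l * β) * (1 / 2) ^ ((n - max k l) + (max k l - n)) := by
  obtain ⟨P, Q, hP, hQ⟩ := exists_prim_diff D (show (0:ℤ) < 1 by norm_num)
  set C2 := N1 (sd (Lr D 0)) + N1 (sd (Lam D)) + (N0 (Lr D 0) + N0 (Lam D)) with hC2
  set C3 := 2 * c * c * (N0 (Lr D 0) + N0 (Lam D)) with hC3
  set C4 := 4 * (c * c * N0 P + 2 * c * N0 P + c * N1 P) with hC4
  have hp0 := N0_nonneg P
  have hp1 := N1_nonneg P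
  have hl0 := N0_nonneg (Lr D 0)
  have hl1 := N0_nonneg (Lam D)
  have h20 : 0 ≤ C2 := by
    have := N1_nonneg (sd (Lr D 0)); have := N1_nonneg (sd (Lam D)); positivity
  have h30 : 0 ≤ C3 := by positivity
  have h40 : 0 ≤ C4 := by positivity
  refine ⟨C2 + C3 + C4, by positivity, fun n k l F a a1 G b b1 b2 α β hf hg x => ?_⟩
  have hα : 0 ≤ α := hf.Ba.nonneg
  have hβ : 0 ≤ β := (abs_nonneg _).trans (hg.BG 0)
  rcases le_or_gt n (max k l) with hn | hn
  · obtain ⟨d, hd⟩ := Nat.exists_eq_add_of_le hn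
    have e : (n - max k l) + (max k l - n) = d := by omega
    have hpw : (2:ℝ) ^ n * (2 ^ (max k l))⁻¹ = (1 / 2) ^ d := by
      rw [hd, pow_add, one_div, inv_pow]; field_simp
    rw [e, ← hpw]
    suffices h : |R (K D n) F b x| ≤ (C2 + C3 + C4) * α * (2 ^ l * β) * (2 ^ (max k l))⁻¹ by
      calc _ ≤ 2 ^ n * ((C2 + C3 + C4) * α * (2 ^ l * β) * (2 ^ (max k l))⁻¹) := by gcongr
        _ = _ := by ring
    rcases le_or_gt k l with hkl | hkl
    · rw [max_eq_right hkl]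
      refine (R2 (K D n) hf.hF hg.hG hf.Ba hg.BG hg.Bb x).trans ?_
      have h1 : N1 (sd (K D n)) + N0 (K D n) ≤ C2 + C3 + C4 := by
        linarith [N1_sd_K D n, N0_K D n]
      calc _ ≤ α * β * (C2 + C3 + C4) := by gcongr
        _ = _ := by field_simp
    · rw [max_eq_left hkl.le]
      refine (R3 (K D n) (hf.BF (by omega)) hg.Bb x).trans ?_
      calc _ ≤ 2 * (c * (2 ^ k)⁻¹ * α) * (c * 2 ^ l * β) * (N0 (Lr D 0) + N0 (Lam D)) := by
            gcongr; exact N0_K D n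
        _ = C3 * α * (2 ^ l * β) * (2 ^ k)⁻¹ := by rw [hC3]; ring
        _ ≤ _ := by gcongr; linarith
  · obtain ⟨m, rfl⟩ := Nat.exists_eq_add_of_le' (show 1 ≤ n by omega)
    obtain ⟨d, hd⟩ := Nat.exists_eq_add_of_le (show max k l ≤ m by omega)
    have e : (m + 1 - max k l) + (max k l - (m + 1)) = d + 1 := by omega
    have hpw : ((2:ℝ) ^ m)⁻¹ * 2 ^ (max k l) = (1 / 2) ^ d := by
      rw [hd, pow_add, one_div, inv_pow]; field_simp
    set t : ℝ := ((2:ℝ) ^ m)⁻¹ with ht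
    have ht0 : 0 < t := by positivity
    have htm : (2:ℝ) ^ m * t = 1 := by rw [ht]; field_simp
    have hP' : ∀ x, HasDerivAt (t ^ 2 • dil m P) ((t • dil m Q) x) x := fun x => by
      have := (hd_dil m hP x).const_mul (t ^ 2)
      refine this.congr_deriv ?_
      rw [zpow_natCast]
      show t ^ 2 * (2 ^ m * dil m Q x) = t * dil m Q x
      linear_combination t * dil m Q x * htm
    have hQ' : ∀ x, HasDerivAt (t • dil m Q) (K D (m + 1) x) x := fun x => by
      have := (hd_dil m (lam := Lam D) hQ x).const_mul t
      refine this.congr_deriv ?_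
      rw [zpow_natCast, K_succ]
      linear_combination dil m (Lam D) x * htm
    have h := R4 hP' hQ' hf.hF hf.ha hg.hb hg.hb1 hf.Ba.2 hf.Ba1 hg.Bb.2 hg.Bb1.2 hg.Bb2 x
    rw [N0_smul, N1_smul, N0_dil, N1_dil, abs_of_pos (show 0 < t ^ 2 by positivity), zpow_natCast, ← ht] at h
    have hk : (2:ℝ) ^ k ≤ 2 ^ (max k l) := pow_le_pow_right₀ (by norm_num) (le_max_left _ _)
    have hl : (2:ℝ) ^ l ≤ 2 ^ (max k l) := pow_le_pow_right₀ (by norm_num) (le_max_right _ _)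
    have hlm : (2:ℝ) ^ l * t ≤ 1 := by
      rw [← htm]; gcongr; · norm_num
      · omega
    have h6 : |R (K D (m + 1)) F b x| ≤ C4 / 4 * α * (2 ^ l * β) * (t ^ 2 * 2 ^ max k l) := by
      refine h.trans ?_
      calc _ = α * (2 ^ l * β) * t ^ 2 * (c * c * N0 P * 2 ^ k + 2 * c * N0 P * 2 ^ l
              + c * N1 P * (2 ^ l * (2 ^ l * t))) := by ring
        _ ≤ α * (2 ^ l * β) * t ^ 2 * (c * c * N0 P * 2 ^ max k l + 2 * c * N0 P * 2 ^ max k l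
              + c * N1 P * (2 ^ max k l * 1)) := by gcongr
        _ = _ := by rw [hC4]; ring
    rw [e]
    calc _ ≤ 2 ^ (m + 1) * (C4 / 4 * α * (2 ^ l * β) * (t ^ 2 * 2 ^ max k l)) := by gcongr
      _ = C4 * α * (2 ^ l * β) * (1 / 2) ^ (d + 1) := by
        rw [pow_succ (1 / 2 : ℝ), ← hpw, pow_succ]
        linear_combination C4 * α * (2 ^ l * β) * (t * 2 ^ max k l) / 2 * htm
      _ ≤ _ := by gcongr; linarith

end

end CW
namespace CW

noncomputable section

lemma exp_chi_int (D : LPData) (a : ℤ) (y : ℝ) : Integrable (fun ξ : ℝ =>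
    Complex.exp (Complex.I * (y:ℂ) * (ξ:ℂ)) * (D.chi ((2:ℝ) ^ (-a) * ξ) : ℂ)) := by
  have hc : Continuous D.chi := D.chi_smooth.continuous
  refine Continuous.integrable_of_hasCompactSupport (by fun_prop) ?_
  apply HasCompactSupport.of_support_subset_isCompact (K := Metric.closedBall 0 ((2:ℝ) ^ a * 2))
    (isCompact_closedBall _ _)
  intro η hη
  by_contra hc
  apply hη
  simp only [Metric.mem_closedBall, dist_zero_right, Real.norm_eq_abs, not_le] at hc
  simp only
  rw [D.chi_supp, Complex.ofReal_zero, mul_zero]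
  rw [abs_mul, abs_of_pos (by positivity), zpow_neg, lt_inv_mul_iff₀ (by positivity)]
  have h3 : (0:ℝ) < 2 ^ a := by positivity
  nlinarith [abs_nonneg η]

lemma invFT_phi (D : LPData) (n : ℕ) (y : ℝ) :
    invFT (fun ξ => (D.phi ((2:ℝ) ^ (-(n:ℤ)) * ξ) : ℂ)) y = ((K D (n + 1) y : ℝ) : ℂ) := by
  have h1 := invFT_eq D ((n:ℤ) + 1) y
  have h2 := invFT_eq D n y
  have e : ∀ ξ : ℝ, D.phi ((2:ℝ) ^ (-(n:ℤ)) * ξ) =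
      D.chi ((2:ℝ) ^ (-((n:ℤ) + 1)) * ξ) - D.chi ((2:ℝ) ^ (-(n:ℤ)) * ξ) := by
    intro ξ
    rw [phi_eq, ← mul_assoc, neg_add, ← sub_eq_add_neg, zpow_sub_one₀ two_ne_zero, mul_comm (2:ℝ)⁻¹]
  simp only [K, sub_apply, Complex.ofReal_sub, ← Lc_real, ← h1, ← h2]
  simp only [invFT, e, Complex.ofReal_sub, mul_sub]
  rw [integral_sub (exp_chi_int D _ y) (exp_chi_int D _ y), mul_sub]

lemma LPblock_eq (D : LPData) (n : ℕ) (u : ℝ → ℝ) : LPblock D ((n:ℤ) - 1) u = cv (K D n) u := by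
  cases n with
  | zero =>
    have h : ∀ y, invFT (fun ξ => (D.chi ξ : ℂ)) y = ((Lr D 0 y : ℝ):ℂ) := fun y => by
      rw [← Lc_real, ← invFT_eq]; simp
    ext x
    simp only [LPblock, Nat.cast_zero, zero_sub, if_true, h, ← Complex.ofReal_mul]
    rw [integral_complex_ofReal, Complex.ofReal_re]; rfl
  | succ n =>
    ext x
    have h0 : ((n + 1 : ℕ):ℤ) - 1 = n := by simp
    have h1 : ¬ ((n:ℤ) = -1) := by omega
    have h2 : (0:ℤ) ≤ n := by omega
    rw [h0]
    simp only [LPblock, if_neg h1, if_pos h2, invFT_phi, ← Complex.ofReal_mul]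
    rw [integral_complex_ofReal, Complex.ofReal_re]; rfl

lemma LPblock_neg (D : LPData) (j : ℤ) (hj : j < -1) (u : ℝ → ℝ) : LPblock D j u = fun _ => 0 := by
  rw [LPblock, if_neg (by omega), if_neg (by omega)]

lemma tsum_shift (T : ℤ → ℝ≥0∞) (hT : ∀ j < -1, T j = 0) :
    ∑' j, T j = ∑' n : ℕ, T ((n:ℤ) - 1) := by
  have hi : Function.Injective (fun n : ℕ => (n:ℤ) - 1) := fun a b h => by
    simpa using h
  refine (hi.tsum_eq (f := T) ?_).symm
  intro j hj
  have : ¬ j < -1 := fun h => hj (hT j h)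
  exact ⟨(j + 1).toNat, by simp only; omega⟩

lemma bound_of_cont {u : ℝ → ℝ} (hu : Continuous u) (h : eLpNorm u ⊤ volume ≠ ⊤) (x : ℝ) :
    |u x| ≤ (eLpNorm u ⊤ volume).toReal := by
  have h1 : ∀ᵐ y, |u y| ≤ (eLpNorm u ⊤ volume).toReal := by
    have := ae_le_eLpNormEssSup (f := u) (μ := volume)
    filter_upwards [this] with y hy
    rw [← eLpNorm_exponent_top] at hy
    have := ENNReal.toReal_mono h hy
    simpa using this
  have h2 := Measure.dense_of_ae h1
  have h3 : IsClosed {y | |u y| ≤ (eLpNorm u ⊤ volume).toReal} :=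
    isClosed_le hu.abs continuous_const
  have := h2.closure_eq
  rw [h3.closure_eq] at this
  exact (Set.ext_iff.1 this x).2 (mem_univ x)

lemma geo_sum (m N : ℕ) :
    (N ≤ m → ∑ n ∈ Finset.range N, (1 / 2 : ℝ) ^ ((n - m) + (m - n)) ≤ (1 / 2) ^ (m - N)) ∧
    (m < N → ∑ n ∈ Finset.range N, (1 / 2 : ℝ) ^ ((n - m) + (m - n)) ≤ 3 - (1 / 2) ^ (N - 1 - m)) := by
  induction N with
  | zero => exact ⟨fun _ => by simp, fun h => by omega⟩
  | succ N ih =>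
    rw [Finset.sum_range_succ]
    constructor
    · intro h
      have h1 := ih.1 (by omega)
      obtain ⟨d, rfl⟩ := Nat.exists_eq_add_of_le h
      have e1 : (N - (N + 1 + d)) + (N + 1 + d - N) = d + 1 := by omega
      have e2 : N + 1 + d - N = d + 1 := by omega
      have e3 : N + 1 + d - (N + 1) = d := by omega
      rw [e1, e3]; rw [e2] at h1
      rw [pow_succ] at h1 ⊢
      linarith
    · intro h
      rcases Nat.lt_or_ge m N with h2 | h2
      · have h1 := ih.2 h2
        obtain ⟨d, rfl⟩ := Nat.exists_eq_add_of_le (show m + 1 ≤ N by omega)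
        have e1 : (m + 1 + d - m) + (m - (m + 1 + d)) = d + 1 := by omega
        have e2 : m + 1 + d - 1 - m = d := by omega
        have e3 : m + 1 + d + 1 - 1 - m = d + 1 := by omega
        rw [e1, e3]; rw [e2] at h1
        rw [pow_succ]
        linarith
      · have h3 : N = m := by omega
        subst h3
        have h1 := ih.1 le_rfl
        simp at h1 ⊢
        linarith

lemma geo_tsum (m : ℕ) :
    ∑' n : ℕ, ENNReal.ofReal ((1 / 2 : ℝ) ^ ((n - m) + (m - n))) ≤ ENNReal.ofReal 3 := by
  refine ENNReal.tsum_le_of_sum_range_le fun N => ?_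
  rw [← ENNReal.ofReal_sum_of_nonneg (fun _ _ => by positivity)]
  apply ENNReal.ofReal_le_ofReal
  have h := geo_sum m N
  rcases Nat.lt_or_ge m N with h2 | h2
  · have := h.2 h2
    have : (0:ℝ) ≤ (1 / 2) ^ (N - 1 - m) := by positivity
    linarith
  · have := h.1 h2
    have : ((1:ℝ) / 2) ^ (m - N) ≤ 1 := pow_le_one₀ (by norm_num) (by norm_num)
    linarith

lemma Lr_approx (D : LPData) {u : ℝ → ℝ} {C : ℝ} (hu : BM u C) {L : ℝ≥0} (hL : LipschitzWith L u)
    (n : ℕ) (x : ℝ) : |cv (Lr D n) u x - u x| ≤ L * N1 (Lr D 0) * (1 / 2) ^ n := by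
  have hone : ∫ y, Lr D n y = 1 := by
    have h := Measure.integral_comp_mul_left (fun x => Lr D 0 x) ((2:ℝ) ^ n)
    simp only [Lr_dil D n, dil_apply, zpow_natCast]
    rw [integral_const_mul, h, Lr_integral, abs_of_pos (by positivity)]
    simp
  have e : cv (Lr D n) u x - u x = ∫ y, Lr D n y * (u (x - y) - u x) := by
    simp only [mul_sub]
    rw [integral_sub (cv_int _ hu x) ((Lr D n).integrable.mul_const _), integral_mul_const, hone,
      one_mul]; rfl
  rw [e]
  have h := (lin_int (Lr D n) (q := fun y => u (x - y) - u x) ((hu.shift x).sub_const _) (a := 0)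
    (b := L) (fun z => by
      have := hL.dist_le_mul (x - z) x
      simpa [Real.dist_eq] using this)).2
  rw [Lr_dil D n, N1_dil] at h
  rw [Lr_dil D n]
  refine h.trans (le_of_eq ?_)
  rw [zpow_natCast, one_div, inv_pow]; ring

lemma K_sum (D : LPData) {u : ℝ → ℝ} {C : ℝ} (hu : BM u C) (x : ℝ) (n : ℕ) :
    ∑ k ∈ Finset.range (n + 1), cv (K D k) u x = cv (Lr D n) u x := by
  induction n with
  | zero => simp [K]
  | succ n ih =>
    rw [Finset.sum_range_succ, ih]
    simp only [cv, K, sub_apply, sub_mul]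
    rw [integral_sub (cv_int _ hu x) (cv_int _ hu x)]
    push_cast
    ring

lemma K_hasSum (D : LPData) {u : ℝ → ℝ} {C : ℝ} (hu : BM u C) {L : ℝ≥0} (hL : LipschitzWith L u)
    (x : ℝ) : HasSum (fun k => cv (K D k) u x) (u x) := by
  have hg : Summable fun n : ℕ => ((1:ℝ) / 2) ^ n := summable_geometric_two
  have hs : Summable (fun k => cv (K D k) u x) := by
    rw [← summable_nat_add_iff 1]
    refine Summable.of_norm_bounded (hg.mul_left (2 * (L * N1 (Lr D 0)))) fun n => ?_
    have e : cv (K D (n + 1)) u x = (cv (Lr D ((n + 1 : ℕ))) u x - u x) - (cv (Lr D n) u x - u x) := by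
      rw [← K_sum D hu, ← K_sum D hu, Finset.sum_range_succ]; ring
    rw [e, Real.norm_eq_abs]
    refine (abs_sub _ _).trans ?_
    have h1 := Lr_approx D hu hL n x
    have h2 := Lr_approx D hu hL (n + 1) x
    have h3 : 0 ≤ L * N1 (Lr D 0) * (1 / 2) ^ n := by
      have := N1_nonneg (Lr D 0); positivity
    rw [pow_succ] at h2
    linarith
  rw [hs.hasSum_iff_tendsto_nat, ← tendsto_add_atTop_iff_nat 1]
  simp only [K_sum D hu]
  rw [tendsto_iff_dist_tendsto_zero]
  refine squeeze_zero (fun _ => dist_nonneg) (fun n => Lr_approx D hu hL n x) ?_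
  have := (tendsto_pow_atTop_nhds_zero_of_lt_one (r := (1:ℝ)/2) (by norm_num) (by norm_num)).const_mul
    (L * N1 (Lr D 0))
  simpa using this

lemma comm_eq (κ : 𝓢(ℝ, ℝ)) {f b : ℝ → ℝ} {C B : ℝ} (hf : BM f C) (hb : BM b B) (x : ℝ) :
    cv κ (fun y => f y * b y) x - f x * cv κ b x = R κ f b x := by
  have h : BM (fun y => f y * b y) (C * B) := ⟨hf.1.mul hb.1, fun y => by
    rw [abs_mul]; exact mul_le_mul (hf.2 y) (hb.2 y) (abs_nonneg _) hf.nonneg⟩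
  rw [cv, cv, ← integral_const_mul, ← integral_sub (cv_int κ h x) ((cv_int κ hb x).const_mul _), R]
  congr 1; ext z; ring

lemma R_hasSum (κ : 𝓢(ℝ, ℝ)) {f g' : ℝ → ℝ} {fk ak gl : ℕ → ℝ → ℝ} {α B : ℕ → ℝ}
    (hd : ∀ k x, HasDerivAt (fk k) (ak k x) x) (ha : ∀ k, BM (ak k) (α k))
    (hb : ∀ l, BM (gl l) (B l)) (sα : Summable α) (sB : Summable B)
    (hf : ∀ x, HasSum (fun k => fk k x) (f x)) (hg : ∀ x, HasSum (fun l => gl l x) (g' x)) (x : ℝ) :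
    HasSum (fun p : ℕ × ℕ => R κ (fk p.1) (gl p.2) x) (R κ f g' x) := by
  have hα0 : ∀ k, 0 ≤ α k := fun k => (ha k).nonneg
  have hB0 : ∀ k, 0 ≤ B k := fun k => (hb k).nonneg
  have hbd : ∀ (p : ℕ × ℕ) z, ‖κ z * ((fk p.1 (x - z) - fk p.1 x) * gl p.2 (x - z))‖ ≤
      (|z| * |κ z|) * (α p.1 * B p.2) := fun p z => by
    rw [Real.norm_eq_abs, abs_mul, abs_mul]
    have h1 := incr (hd p.1) (ha p.1).2 x z
    have h2 := (hb p.2).2 (x - z)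
    calc _ ≤ |κ z| * ((α p.1 * |z|) * B p.2) := by
          have := hα0 p.1
          gcongr
      _ = _ := by ring
  have sp : Summable (fun p : ℕ × ℕ => α p.1 * B p.2) :=
    sα.mul_of_nonneg sB hα0 hB0
  have hi : ∀ p : ℕ × ℕ, Integrable fun z => κ z * ((fk p.1 (x - z) - fk p.1 x) * gl p.2 (x - z)) :=
    fun p => R_int κ (hd p.1) (ha p.1).2 (hb p.2) x
  have key := hasSum_integral_of_summable_integral_norm hi (by
    refine Summable.of_nonneg_of_le (fun p => integral_nonneg fun _ => norm_nonneg _) (fun p => ?_)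
      (sp.mul_left (N1 κ))
    rw [N1, ← integral_mul_const]
    exact integral_mono (hi p).norm ((N1_int κ).mul_const _) (hbd p))
  have e : ∀ z, ∑' p : ℕ × ℕ, κ z * ((fk p.1 (x - z) - fk p.1 x) * gl p.2 (x - z)) =
      κ z * ((f (x - z) - f x) * g' (x - z)) := fun z => by
    rw [tsum_mul_left]
    have h1 : HasSum (fun k => fk k (x - z) - fk k x) (f (x - z) - f x) := (hf _).sub (hf _)
    have h2 := hg (x - z)
    rw [← h1.tsum_eq, ← h2.tsum_eq, tsum_mul_tsum_of_summable_norm]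
    · refine Summable.of_nonneg_of_le (fun _ => norm_nonneg _) (fun k => incr (hd k) (ha k).2 x z)
        (sα.mul_right _)
    · exact Summable.of_nonneg_of_le (fun _ => norm_nonneg _) (fun l => (hb l).2 _) sB
  simp only [e] at key
  exact key

end

end CW
namespace CW

noncomputable section

lemma ofReal_toReal_eq (D : LPData) (u : ℝ → ℝ) (s : ℝ) (h : besovNorm D s ⊤ u < ⊤) (n : ℕ) :
    eLpNorm (cv (K D n) u) ⊤ volume ≠ ⊤ := by
  intro hc
  have h1 : ENNReal.ofReal ((2:ℝ) ^ ((((n:ℤ) - 1 : ℤ):ℝ) * s)) *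
      eLpNorm (LPblock D ((n:ℤ) - 1) u) ⊤ volume ≤ besovNorm D s ⊤ u :=
    ENNReal.le_tsum (f := fun j : ℤ => ENNReal.ofReal ((2:ℝ) ^ ((j:ℝ) * s)) *
      eLpNorm (LPblock D j u) ⊤ volume) ((n:ℤ) - 1)
  rw [LPblock_eq, hc, ENNReal.mul_top (by simpa using by positivity)] at h1
  exact absurd h1 (not_le.2 h)

lemma besov_eq (D : LPData) (u : ℝ → ℝ) (s : ℝ) : besovNorm D s ⊤ u =
    ∑' n : ℕ, ENNReal.ofReal ((2:ℝ) ^ (((n:ℝ) - 1) * s)) * eLpNorm (cv (K D n) u) ⊤ volume := by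
  rw [besovNorm, tsum_shift]
  · simp only [LPblock_eq]; push_cast; rfl
  · intro j hj
    rw [LPblock_neg D j hj]
    simp
    exact Or.inr (ae_eq_refl _)

theorem main (D : LPData) :
    ∃ C > (0:ℝ), ∀ f g : ℝ → ℝ, MemC01 f → MemC01 g →
      besovNorm D 0 ⊤ (deriv f) < ⊤ → besovNorm D 1 ⊤ g < ⊤ →
      (∑' j : ℤ, ENNReal.ofReal ((2:ℝ) ^ j) *
          eLpNorm (fun x => LPblock D j (fun y => f y * deriv g y) x
            - f x * LPblock D j (deriv g) x) ⊤ volume) ≤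
        ENNReal.ofReal C * besovNorm D 0 ⊤ (deriv f) * besovNorm D 1 ⊤ g := by
  obtain ⟨cf, hcf, HF⟩ := exists_FP D
  obtain ⟨cg, hcg, HG⟩ := exists_GP D
  obtain ⟨C, hC, HT⟩ := exists_triple D (cf + cg) (by positivity)
  refine ⟨3 * C + 1, by positivity, ?_⟩
  rintro f g ⟨⟨Lf, hLf⟩, ⟨Cf, hCf⟩⟩ ⟨⟨Lg, hLg⟩, ⟨Cg, hCg⟩⟩ hbf hbg
  have Bf : BM f Cf := ⟨hLf.continuous.measurable, fun x => hCf ⟨x, rfl⟩⟩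
  have Bg : BM g Cg := ⟨hLg.continuous.measurable, fun x => hCg ⟨x, rfl⟩⟩
  have Bdf : BM (deriv f) Lf := ⟨measurable_deriv f, fun x => by
    simpa using norm_deriv_le_of_lipschitz hLf⟩
  have Bdg : BM (deriv g) Lg := ⟨measurable_deriv g, fun x => by
    simpa using norm_deriv_le_of_lipschitz hLg⟩
  have tf := ofReal_toReal_eq D _ _ hbf
  have tg := ofReal_toReal_eq D _ _ hbg
  set α : ℕ → ℝ := fun n => (eLpNorm (cv (K D n) (deriv f)) ⊤ volume).toReal with hα
  set β : ℕ → ℝ := fun n => (eLpNorm (cv (K D n) g) ⊤ volume).toReal with hβ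
  have hα0 : ∀ n, 0 ≤ α n := fun n => ENNReal.toReal_nonneg
  have hβ0 : ∀ n, 0 ≤ β n := fun n => ENNReal.toReal_nonneg
  have ef : besovNorm D 0 ⊤ (deriv f) = ∑' n, ENNReal.ofReal (α n) := by
    rw [besov_eq]
    congr 1; ext n
    rw [hα, ENNReal.ofReal_toReal (tf n)]
    simp
  have eg : besovNorm D 1 ⊤ g = ∑' n, ENNReal.ofReal (2 ^ n * β n / 2) := by
    rw [besov_eq]
    congr 1; ext n
    have : (2:ℝ) ^ n * β n / 2 = (2:ℝ) ^ (((n:ℝ) - 1) * 1) * β n := by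
      rw [mul_one, Real.rpow_sub_one two_ne_zero, Real.rpow_natCast]; ring
    rw [this, ENNReal.ofReal_mul (by positivity), hβ, ENNReal.ofReal_toReal (tg _)]
  have sα : Summable α := by
    have h : ∑' n, ENNReal.ofReal (α n) ≠ ⊤ := by rw [← ef]; exact hbf.ne
    have := ENNReal.summable_toReal h
    simpa [ENNReal.toReal_ofReal, hα0] using this
  have sβ : Summable fun n => 2 ^ n * β n := by
    have h : ∑' n, ENNReal.ofReal (2 ^ n * β n / 2) ≠ ⊤ := by rw [← eg]; exact hbg.ne
    have h2 := (ENNReal.summable_toReal h).mul_left 2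
    refine h2.congr fun n => ?_
    rw [ENNReal.toReal_ofReal (by have := hβ0 n; positivity)]; ring
  have bα : ∀ k x, |cv (K D k) (deriv f) x| ≤ α k := fun k x =>
    bound_of_cont (cv_continuous _ Bdf) (tf k) x
  have bβ : ∀ k x, |cv (K D k) g x| ≤ β k := fun k x =>
    bound_of_cont (cv_continuous _ Bg) (tg k) x
  choose a1 hFP using fun k => HF k f Cf Lf (α k) Bf hLf (bα k)
  choose b b1 b2 hGP using fun l => HG l g Cg (β l) Bg (bβ l)
  have hFP' : ∀ k, FP (cf + cg) k (cv (K D k) f) (cv (K D k) (deriv f)) (a1 k) (α k) := fun k =>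
    ⟨(hFP k).hF, (hFP k).ha, (hFP k).Ba, (hFP k).Ba1.mono (by have := hα0 k; gcongr; linarith),
      fun h => ((hFP k).BF h).mono (by have := hα0 k; gcongr; linarith)⟩
  have hGP' : ∀ l, GP (cf + cg) l (cv (K D l) g) (b l) (b1 l) (b2 l) (β l) := fun l =>
    ⟨(hGP l).hG, (hGP l).hb, (hGP l).hb1, (hGP l).BG,
      (hGP l).Bb.mono (by have := hβ0 l; gcongr; linarith),
      (hGP l).Bb1.mono (by have := hβ0 l; gcongr; linarith),
      (hGP l).Bb2.mono (by have := hβ0 l; gcongr; linarith)⟩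
  have sB : Summable fun l => cg * 2 ^ l * β l := by
    simpa [mul_assoc] using sβ.mul_left cg
  have hg' : ∀ x, HasSum (fun l => b l x) (deriv g x) := by
    intro x
    have h1 := hasDerivAt_tsum (g := fun l => cv (K D l) g) (g' := b) (u := fun l => cg * 2 ^ l * β l)
      sB (fun l y => (hGP l).hG y) (fun l y => (hGP l).Bb.2 y) (K_hasSum D Bg hLg 0).summable x
    have e : (fun z => ∑' l, cv (K D l) g z) = g := funext fun z => (K_hasSum D Bg hLg z).tsum_eq
    rw [e] at h1
    rw [h1.deriv]
    exact (Summable.of_norm_bounded sB (fun l => (hGP l).Bb.2 x)).hasSum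
  have hR : ∀ n x, HasSum (fun p : ℕ × ℕ => R (K D n) (cv (K D p.1) f) (b p.2) x)
      (R (K D n) f (deriv g) x) := fun n x =>
    R_hasSum (K D n) (fun k y => (hFP k).hF y) (fun k => (hFP k).Ba) (fun l => (hGP l).Bb) sα sB
      (K_hasSum D Bf hLf) hg' x
  have hw : ∀ n : ℕ, ENNReal.ofReal ((2:ℝ) ^ ((n:ℤ) - 1)) *
      eLpNorm (fun x => R (K D n) f (deriv g) x) ⊤ volume ≤
      ∑' p : ℕ × ℕ, ENNReal.ofReal (C * α p.1 * (2 ^ p.2 * β p.2 / 2)) *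
        ENNReal.ofReal ((1 / 2 : ℝ) ^ ((n - max p.1 p.2) + (max p.1 p.2 - n))) := by
    intro n
    have hpos : (0:ℝ) < 2 ^ ((n:ℤ) - 1) := by positivity
    rw [mul_comm, ← ENNReal.le_div_iff_mul_le (Or.inl (by simpa using hpos)) (Or.inl (by simp))]
    rw [eLpNorm_exponent_top]
    refine eLpNormEssSup_le_of_ae_enorm_bound (Eventually.of_forall fun x => ?_)
    rw [ENNReal.le_div_iff_mul_le (Or.inl (by simpa using hpos)) (Or.inl (by simp)), mul_comm,
      ← (hR n x).tsum_eq]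
    refine (mul_le_mul_right (enorm_tsum_le_tsum_enorm) _).trans ?_
    rw [← ENNReal.tsum_mul_left]
    refine ENNReal.tsum_le_tsum fun p => ?_
    rw [Real.enorm_eq_ofReal_abs, ← ENNReal.ofReal_mul hpos.le, ← ENNReal.ofReal_mul (by
      have := hα0 p.1; have := hβ0 p.2; positivity)]
    apply ENNReal.ofReal_le_ofReal
    have := HT n p.1 p.2 _ _ _ _ _ _ _ _ _ (hFP' p.1) (hGP' p.2) x
    rw [zpow_sub_one₀ two_ne_zero, zpow_natCast]
    linarith
  rw [tsum_shift]
  swap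
  · intro j hj
    rw [LPblock_neg D j hj, LPblock_neg D j hj]
    simp
    exact Or.inr (ae_eq_refl _)
  simp only [LPblock_eq, comm_eq _ Bf Bdg]
  calc _ ≤ ∑' n : ℕ, ∑' p : ℕ × ℕ, ENNReal.ofReal (C * α p.1 * (2 ^ p.2 * β p.2 / 2)) *
        ENNReal.ofReal ((1 / 2 : ℝ) ^ ((n - max p.1 p.2) + (max p.1 p.2 - n))) :=
        ENNReal.tsum_le_tsum hw
    _ = ∑' p : ℕ × ℕ, ENNReal.ofReal (C * α p.1 * (2 ^ p.2 * β p.2 / 2)) *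
        ∑' n : ℕ, ENNReal.ofReal ((1 / 2 : ℝ) ^ ((n - max p.1 p.2) + (max p.1 p.2 - n))) := by
        rw [ENNReal.tsum_comm]
        simp only [ENNReal.tsum_mul_left]
    _ ≤ ∑' p : ℕ × ℕ, ENNReal.ofReal (C * α p.1 * (2 ^ p.2 * β p.2 / 2)) * ENNReal.ofReal 3 :=
        ENNReal.tsum_le_tsum fun p => mul_le_mul_right (geo_tsum _) _
    _ = ∑' p : ℕ × ℕ, ENNReal.ofReal (3 * C) *
          (ENNReal.ofReal (α p.1) * ENNReal.ofReal (2 ^ p.2 * β p.2 / 2)) := by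
        congr 1; ext p
        have := hα0 p.1
        have := hβ0 p.2
        rw [← ENNReal.ofReal_mul (by positivity), ← ENNReal.ofReal_mul (by positivity),
          ← ENNReal.ofReal_mul (by positivity)]
        congr 1; ring
    _ = ENNReal.ofReal (3 * C) * (besovNorm D 0 ⊤ (deriv f) * besovNorm D 1 ⊤ g) := by
        rw [ENNReal.tsum_mul_left, ENNReal.tsum_prod', ef, eg]
        simp only [ENNReal.tsum_mul_left, ENNReal.tsum_mul_right]
    _ ≤ _ := by
        rw [← mul_assoc]
        gcongr
        linarith

end

end CW
/-- commutator estimate, weighted version: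
`∑_{j ≥ -1} 2^j ‖Δ_j(f g_x) - f Δ_j g_x‖_{L^∞} ≤ C ‖f_x‖_{B^0_{∞,1}} ‖g‖_{B^1_{∞,1}}`. -/
theorem commutator_weighted_est (D : LPData) :
    ∃ C > (0:ℝ), ∀ f g : ℝ → ℝ, MemC01 f → MemC01 g →
      besovNorm D 0 ⊤ (deriv f) < ⊤ → besovNorm D 1 ⊤ g < ⊤ →
      (∑' j : ℤ, ENNReal.ofReal ((2:ℝ) ^ j) *
          eLpNorm (fun x => LPblock D j (fun y => f y * deriv g y) x
            - f x * LPblock D j (deriv g) x) ⊤ volume) ≤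
        ENNReal.ofReal C * besovNorm D 0 ⊤ (deriv f) * besovNorm D 1 ⊤ g := by
  exact CW.main D
end

section
/- Lower bound on the square of the derivative of the explicit initial datum: there exists a constant C>0 such that for all sufficiently large N∈ℕ⁺, the function u₀ defined from N satisfies ‖u₀ₓ²‖_{B^0_{∞,1}} ≥ C·N^{3/5}; consequently E₀:=−∂_x(1−∂_{xx})^{−1}(u₀ₓ²/2) satisfies ‖E₀‖_{B^1_{∞,1}} ≥ C'·N^{3/5} for some constant C'>0. -/
open MeasureTheory Set Filter
open scoped ENNReal NNReal Topology

open MeasureTheory Set Filter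
open scoped ENNReal NNReal Topology

structure GoodKer (k k' : ℝ → ℝ) : Prop where
  cont : Continuous k
  hder : ∀ x, HasDerivAt k (k' x) x
  cont' : Continuous k'
  int : Integrable k
  int' : Integrable k'
  int2 : Integrable (fun x => (1 + x ^ 2) * |k x|)
  bdd : ∃ C, ∀ x, |k x| ≤ C
  one : ∫ x, k x = 1
  pos : 0 < k 0

lemma phi_zero_small (D : LPData) {ξ : ℝ} (h : |ξ| < 3/4) : D.phi ξ = 0 :=
  D.phi_supp ξ (Or.inl h)

lemma chi_part_small (D : LPData) {ξ : ℝ} (h : |ξ| < 3/2) : D.chi ξ + D.phi ξ = 1 := by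
  have := D.partition ξ
  rw [tsum_eq_single 0] at this
  · simpa using this
  · intro j hj
    apply phi_zero_small
    rw [abs_mul, abs_of_pos (by positivity)]
    have : (2:ℝ) ^ (-(j:ℤ)) ≤ 1/2 := by
      rw [zpow_neg, zpow_natCast, one_div]
      apply inv_anti₀ (by norm_num)
      calc (2:ℝ) = 2^1 := by norm_num
        _ ≤ 2^j := pow_le_pow_right₀ (by norm_num) (by omega)
    nlinarith [abs_nonneg ξ]

lemma chi_small (D : LPData) {ξ : ℝ} (h : |ξ| < 3/4) : D.chi ξ = 1 := by
  have := chi_part_small D (ξ := ξ) (by linarith)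
  rw [phi_zero_small D h] at this; linarith

lemma chi_part_mid (D : LPData) {ξ : ℝ} (h : |ξ| < 3) :
    D.chi ξ + (D.phi ξ + D.phi (ξ/2)) = 1 := by
  have := D.partition ξ
  rw [tsum_eq_sum (s := Finset.range 2)] at this
  · simp only [Finset.sum_range_succ, Finset.sum_range_zero] at this
    have h2 : (2:ℝ) ^ (-((1:ℕ):ℤ)) * ξ = ξ/2 := by
      rw [zpow_neg, zpow_natCast]; ring
    rw [h2] at this
    simpa using this
  · intro j hj
    apply phi_zero_small
    rw [abs_mul, abs_of_pos (by positivity)]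
    have : (2:ℝ) ^ (-(j:ℤ)) ≤ 1/4 := by
      rw [zpow_neg, zpow_natCast, one_div]
      apply inv_anti₀ (by norm_num)
      simp at hj
      calc (4:ℝ) = 2^2 := by norm_num
        _ ≤ 2^j := pow_le_pow_right₀ (by norm_num) (by omega)
    nlinarith [abs_nonneg ξ]

lemma phi_eq (D : LPData) (ξ : ℝ) : D.phi ξ = D.chi (ξ/2) - D.chi ξ := by
  have e : |ξ/2| = |ξ|/2 := by rw [abs_div]; simp
  rcases lt_or_ge (|ξ|) (3/2) with h | h
  · rw [chi_small D (ξ := ξ/2) (by rw [e]; linarith)]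
    linarith [chi_part_small D h]
  · have hc : D.chi ξ = 0 := D.chi_supp ξ (by linarith)
    rcases lt_or_ge (|ξ|) 3 with h3 | h3
    · have h1 := chi_part_mid D h3
      have h2 := chi_part_small D (ξ := ξ/2) (by rw [e]; linarith)
      linarith
    · rw [D.phi_supp ξ (Or.inr (by linarith)), D.chi_supp (ξ/2) (by rw [e]; linarith), hc]; simp

open scoped SchwartzMap FourierTransform in
lemma exists_schwartz (D : LPData) : ∃ K : 𝓢(ℝ, ℂ),
    (∀ y, invFT (fun ξ => (D.chi ξ : ℂ)) y = K y) ∧ ∫ y, K y = 1 := by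
  have hcs : HasCompactSupport (fun ξ => (D.chi ξ : ℂ)) := by
    apply HasCompactSupport.of_support_subset_isCompact (isCompact_Icc (a := (-2:ℝ)) (b := 2))
    intro ξ hξ
    by_contra hn
    apply hξ
    have : (4:ℝ)/3 < |ξ| := by
      by_contra h
      push Not at h
      have := abs_le.1 h
      exact hn ⟨by linarith, by linarith⟩
    simp [D.chi_supp ξ this]
  have hsm : ContDiff ℝ (⊤ : ℕ∞) (fun ξ => (D.chi ξ : ℂ)) :=
    Complex.ofRealCLM.contDiff.comp D.chi_smooth
  let X : 𝓢(ℝ, ℂ) := hcs.toSchwartzMap hsm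
  have hX : ∀ ξ, X ξ = (D.chi ξ : ℂ) := fun ξ => rfl
  let F : 𝓢(ℝ, ℂ) := 𝓕⁻ X
  have h2pi : (2 * Real.pi)⁻¹ ≠ 0 := by positivity
  let g : ℝ ≃L[ℝ] ℝ := ContinuousLinearEquiv.unitsEquivAut ℝ (Units.mk0 _ h2pi)
  have hg : ∀ y, g y = y * (2 * Real.pi)⁻¹ := fun y => by
    simp [g]
  let K : 𝓢(ℝ, ℂ) := (1 / (2 * Real.pi) : ℂ) • SchwartzMap.compCLMOfContinuousLinearEquiv ℂ g F
  have hK : ∀ y, K y = (1 / (2 * Real.pi) : ℂ) * F (y * (2 * Real.pi)⁻¹) := fun y => by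
    simp [K, hg]
  refine ⟨K, ?_, ?_⟩
  · intro y
    rw [hK]
    simp only [invFT, F]
    congr 1
    rw [SchwartzMap.fourierInv_coe, Real.fourierInv_eq']
    apply integral_congr_ae
    filter_upwards with ξ
    rw [hX]
    simp only [smul_eq_mul]
    congr 2
    simp
    have : (Real.pi:ℂ) ≠ 0 := by exact_mod_cast Real.pi_ne_zero
    field_simp
  · simp_rw [hK]
    rw [integral_const_mul, Measure.integral_comp_mul_right (fun z => F z)]
    have : ∫ y, F y = 1 := by
      have h1 : (𝓕 F) 0 = X 0 := by
        simp [F]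
      rw [SchwartzMap.fourier_coe, Real.fourier_eq'] at h1
      simp at h1
      rw [h1, hX, chi_small D (by simp)]; simp
    rw [this]
    have hp := Real.pi_pos
    rw [abs_of_pos (by positivity)]
    simp
    field_simp

/-- The real Littlewood-Paley kernel. -/
noncomputable def kD (D : LPData) : ℝ → ℝ := fun y => (invFT (fun ξ => (D.chi ξ : ℂ)) y).re

lemma invFT_chi_integrable (D : LPData) : Integrable (invFT (fun ξ => (D.chi ξ : ℂ))) := by
  obtain ⟨K, hK, -⟩ := exists_schwartz D
  rw [funext hK]; exact K.integrable

lemma chi_integrable (D : LPData) : Integrable (fun ξ => D.chi ξ) := by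
  have hcs : HasCompactSupport D.chi := by
    apply HasCompactSupport.of_support_subset_isCompact (isCompact_Icc (a := (-2:ℝ)) (b := 2))
    intro ξ hξ
    by_contra hn
    apply hξ
    have : (4:ℝ)/3 < |ξ| := by
      by_contra h
      push Not at h
      have := abs_le.1 h
      exact hn ⟨by linarith, by linarith⟩
    simp [D.chi_supp ξ this]
  exact D.chi_smooth.continuous.integrable_of_hasCompactSupport hcs

lemma exists_goodKer (D : LPData) : ∃ k', GoodKer (kD D) k' := by
  obtain ⟨K, hK, hone⟩ := exists_schwartz D
  have hk : kD D = fun y => (K y).re := by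
    funext y; simp [kD, hK]
  let K' := SchwartzMap.derivCLM ℂ ℂ K
  have hd : ∀ x, HasDerivAt K (K' x) x := fun x => by
    simp only [K', SchwartzMap.derivCLM_apply]
    exact (K.differentiable x).hasDerivAt
  refine ⟨fun y => (K' y).re, ?_⟩
  refine ⟨?_, ?_, ?_, ?_, ?_, ?_, ?_, ?_, ?_⟩
  · rw [hk]; exact Complex.continuous_re.comp K.continuous
  · intro x
    rw [hk]
    exact Complex.reCLM.hasFDerivAt.comp_hasDerivAt x (hd x)
  · exact Complex.continuous_re.comp K'.continuous
  · rw [hk]; exact K.integrable.re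
  · exact K'.integrable.re
  · rw [hk]
    have h0 := K.integrable_pow_mul volume 0
    have h2 := K.integrable_pow_mul volume 2
    refine (h0.add h2).mono' ?_ ?_
    · apply Continuous.aestronglyMeasurable
      have := Complex.continuous_re.comp K.continuous
      have h3 : Continuous fun y => (K y).re := this
      fun_prop
    · filter_upwards with x
      have := Complex.abs_re_le_norm (K x)
      rw [Real.norm_of_nonneg (by positivity)]
      simp only [Pi.add_apply, pow_zero, Real.norm_eq_abs, sq_abs]
      nlinarith [sq_nonneg x]
  · refine ⟨SchwartzMap.seminorm ℝ 0 0 K, fun x => ?_⟩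
    rw [hk]
    exact (Complex.abs_re_le_norm _).trans (SchwartzMap.norm_le_seminorm ℝ K x)
  · rw [hk]
    have := integral_re (𝕜 := ℂ) (μ := volume) (f := fun y => K y) K.integrable
    simp only [RCLike.re_eq_complex_re] at this
    rw [this, hone]; simp
  · simp only [kD, invFT]
    simp only [Complex.ofReal_zero, mul_zero, zero_mul, Complex.exp_zero, one_mul]
    rw [integral_complex_ofReal]
    have hp : 0 < ∫ ξ, D.chi ξ := by
      have hi := chi_integrable D
      rw [integral_pos_iff_support_of_nonneg (fun ξ => (D.chi_mem ξ).1) hi]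
      have : Ioo (0:ℝ) (1/2) ⊆ Function.support D.chi := by
        intro ξ hξ
        rw [Function.mem_support, chi_small D (by rw [abs_of_pos hξ.1]; linarith [hξ.2])]
        norm_num
      refine lt_of_lt_of_le ?_ (measure_mono this)
      simp
    have h3 : (1 / (2 * Real.pi) : ℂ) * ((∫ ξ, D.chi ξ : ℝ) : ℂ) = ((1 / (2 * Real.pi) * ∫ ξ, D.chi ξ : ℝ) : ℂ) := by
      push_cast; ring
    rw [h3, Complex.ofReal_re]
    have := Real.pi_pos
    positivity

open MeasureTheory Set Filter
open scoped ENNReal NNReal Topology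

/-- dilated difference kernel -/
noncomputable def kap (k : ℝ → ℝ) : ℝ → ℝ := fun z => 2 * k (2 * z) - k z

/-- primitive of the kernel -/
noncomputable def Hk (k : ℝ → ℝ) : ℝ → ℝ := fun x => ∫ t in Iic x, k t

lemma kap_cont {k k'} (h : GoodKer k k') : Continuous (kap k) := by
  have := h.cont
  unfold kap; fun_prop

lemma kap_int {k k'} (h : GoodKer k k') : Integrable (kap k) :=
  ((h.int.comp_mul_left' (by norm_num : (2:ℝ) ≠ 0)).const_mul 2).sub h.int

lemma kap_hder {k k'} (h : GoodKer k k') (x : ℝ) :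
    HasDerivAt (kap k) (4 * k' (2 * x) - k' x) x := by
  have h1 : HasDerivAt (fun z : ℝ => 2 * z) 2 x := by simpa using (hasDerivAt_id x).const_mul 2
  have h2 := ((h.hder (2 * x)).comp x h1).const_mul 2
  have := h2.sub (h.hder x)
  exact this.congr_deriv (by ring)

lemma kap_int' {k k'} (h : GoodKer k k') : Integrable (fun x => 4 * k' (2 * x) - k' x) :=
  ((h.int'.comp_mul_left' (by norm_num : (2:ℝ) ≠ 0)).const_mul 4).sub h.int'

lemma kap_integral {k k'} (h : GoodKer k k') : ∫ z, kap k z = 0 := by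
  unfold kap
  rw [integral_sub ((h.int.comp_mul_left' (by norm_num : (2:ℝ) ≠ 0)).const_mul 2) h.int,
    integral_const_mul, Measure.integral_comp_mul_left, h.one]
  norm_num

lemma kap_bdd {k k'} (h : GoodKer k k') : ∃ C, 0 < C ∧ ∀ x, |kap k x| ≤ C := by
  obtain ⟨C, hC⟩ := h.bdd
  refine ⟨3 * C + 1, ?_, fun x => ?_⟩
  · have := (abs_nonneg _).trans (hC 0); linarith
  · unfold kap
    have h1 := abs_le.1 (hC x)
    have h2 := abs_le.1 (hC (2*x))
    rw [abs_le]; constructor <;> linarith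

lemma kap_int2 {k k'} (h : GoodKer k k') : Integrable (fun x => (1 + x ^ 2) * |kap k x|) := by
  have h1 := (h.int2.comp_mul_left' (by norm_num : (2:ℝ) ≠ 0)).const_mul 2
  refine (h1.add h.int2).mono' ?_ ?_
  · have := kap_cont h
    exact (by fun_prop : Continuous (fun x => (1 + x ^ 2) * |kap k x|)).aestronglyMeasurable
  · filter_upwards with x
    rw [Real.norm_of_nonneg (by positivity)]
    simp only [Pi.add_apply]
    have h3 : |kap k x| ≤ 2 * |k (2*x)| + |k x| := by
      unfold kap
      refine (abs_sub _ _).trans ?_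
      rw [abs_mul]; simp
    have := abs_nonneg (k (2*x))
    calc (1 + x^2) * |kap k x| ≤ (1+x^2) * (2 * |k (2*x)| + |k x|) := by gcongr
      _ ≤ _ := by nlinarith [sq_nonneg x, mul_nonneg (sq_nonneg x) this]

lemma Hk_bdd {k k'} (h : GoodKer k k') (x : ℝ) : |Hk k x| ≤ ∫ t, |k t| := by
  unfold Hk
  refine (abs_integral_le_integral_abs).trans ?_
  exact setIntegral_le_integral h.int.norm (by filter_upwards with t; positivity)

lemma Hk_hder {k k'} (h : GoodKer k k') (x : ℝ) : HasDerivAt (Hk k) (k x) x := by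
  have : Hk k = fun x => Hk k 0 + ∫ t in (0:ℝ)..x, k t := by
    funext x
    unfold Hk
    rw [← intervalIntegral.integral_Iic_sub_Iic h.int.integrableOn h.int.integrableOn]; ring
  rw [this]
  exact ((h.cont.integral_hasStrictDerivAt 0 x).hasDerivAt).const_add _

lemma Hk_heav {k k'} (h : GoodKer k k') (x : ℝ) :
    |Hk k x - heaviside x| ≤ (∫ t, (1 + t ^ 2) * |k t|) * (1 + x ^ 2)⁻¹ := by
  have key : ∀ s : Set ℝ, MeasurableSet s → (∀ t ∈ s, x ^ 2 ≤ t ^ 2) →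
      |∫ t in s, k t| ≤ (∫ t, (1 + t ^ 2) * |k t|) * (1 + x ^ 2)⁻¹ := by
    intro s hs hst
    rw [← div_eq_mul_inv, le_div_iff₀ (by positivity)]
    calc |∫ t in s, k t| * (1 + x^2) ≤ (∫ t in s, |k t|) * (1 + x^2) := by
          gcongr; exact abs_integral_le_integral_abs
      _ = ∫ t in s, |k t| * (1 + x^2) := (integral_mul_const _ _).symm
      _ ≤ ∫ t in s, (1 + t ^ 2) * |k t| := by
          apply setIntegral_mono_on (h.int.norm.mul_const _).integrableOn h.int2.integrableOn hs
          intro t ht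
          have := hst t ht
          rw [mul_comm]
          simp only [Real.norm_eq_abs]
          gcongr
      _ ≤ _ := setIntegral_le_integral h.int2 (by filter_upwards with t; positivity)
  unfold heaviside
  split_ifs with hx
  · have h1 : Hk k x - 1 = - ∫ t in Ioi x, k t := by
      rw [← h.one]
      unfold Hk
      have := intervalIntegral.integral_Iic_add_Ioi (b := x) (f := k) (μ := volume) h.int.integrableOn h.int.integrableOn
      linarith
    rw [h1, abs_neg]
    apply key _ measurableSet_Ioi
    intro t ht
    have : x < t := ht
    nlinarith
  · rw [sub_zero]
    apply key _ measurableSet_Iic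
    intro t ht
    have : t ≤ x := ht
    push Not at hx
    nlinarith

lemma heav_meas : Measurable heaviside := by
  unfold heaviside
  exact Measurable.ite measurableSet_Ici measurable_const measurable_const

lemma heav_scale {a : ℝ} (ha : 0 < a) (x : ℝ) : heaviside (a * x) = heaviside x := by
  unfold heaviside
  simp [mul_nonneg_iff_of_pos_left ha]

lemma heav_bdd (x : ℝ) : |heaviside x| ≤ 1 := by
  unfold heaviside; split_ifs <;> simp

lemma heav_sq (x : ℝ) : heaviside x ^ 2 = heaviside x := by
  unfold heaviside; split_ifs <;> simp

lemma ker_heav (k : ℝ → ℝ) (x : ℝ) :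
    ∫ z, k z * heaviside (x - z) = Hk k x := by
  unfold Hk
  rw [← integral_indicator measurableSet_Iic]
  congr 1
  funext z
  unfold heaviside indicator
  simp

lemma kap_heav {k k'} (h : GoodKer k k') {a : ℝ} (ha : 0 < a) (x : ℝ) :
    ∫ z, kap k z * heaviside (x - z / a) = Hk k (2 * (a * x)) - Hk k (a * x) := by
  have e1 : ∀ z, heaviside (x - z / a) = heaviside (a * x - z) := fun z => by
    rw [← heav_scale ha]; congr 1; field_simp
  have e2 : ∀ z, heaviside (a * x - z) = heaviside (2 * (a * x) - 2 * z) := fun z => by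
    rw [← heav_scale (two_pos)]; congr 1; ring
  have hi : ∀ c, Integrable (fun z => k z * heaviside (c - z)) := fun c => by
    refine h.int.mul_bdd (c := 1) ?_ ?_
    · exact (heav_meas.comp (measurable_const.sub measurable_id)).aestronglyMeasurable
    · filter_upwards with z; exact heav_bdd _
  have hi2 := ((hi (2 * (a*x))).comp_mul_left' (by norm_num : (2:ℝ) ≠ 0)).const_mul 2
  have : ∀ z, kap k z * heaviside (x - z / a) =
      2 * (k (2 * z) * heaviside (2 * (a * x) - 2 * z)) - k z * heaviside (a * x - z) := fun z => by
    rw [e1, ← e2]; unfold kap; ring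
  simp_rw [this]
  rw [integral_sub hi2 (hi _), integral_const_mul,
    Measure.integral_comp_mul_left (fun z => k z * heaviside (2 * (a*x) - z)), ker_heav, ker_heav]
  simp

lemma invFT_scale (g : ℝ → ℂ) {a : ℝ} (ha : 0 < a) (y : ℝ) :
    invFT (fun ξ => g (a⁻¹ * ξ)) y = a * invFT g (a * y) := by
  unfold invFT
  have := Measure.integral_comp_mul_left
    (fun η => Complex.exp (Complex.I * ((a * y : ℝ):ℂ) * (η:ℂ)) * g η) a⁻¹
  rw [inv_inv, abs_of_pos ha] at this
  have e : ∀ ξ : ℝ, Complex.exp (Complex.I * (y:ℂ) * (ξ:ℂ)) * g (a⁻¹ * ξ) =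
      Complex.exp (Complex.I * ((a * y : ℝ):ℂ) * ((a⁻¹ * ξ : ℝ):ℂ)) * g (a⁻¹ * ξ) := fun ξ => by
    congr 2
    push_cast
    have : (a:ℂ) ≠ 0 := by exact_mod_cast ha.ne'
    field_simp
  simp_rw [e]
  rw [this]
  simp only [Complex.real_smul]
  ring

lemma chi_ft_integrable (D : LPData) (y : ℝ) (a : ℝ) (ha : a ≠ 0) :
    Integrable (fun ξ : ℝ => Complex.exp (Complex.I * (y:ℂ) * (ξ:ℂ)) * (D.chi (a * ξ) : ℂ)) := by
  have h1 : Integrable (fun ξ : ℝ => (D.chi (a * ξ) : ℂ)) :=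
    ((chi_integrable D).comp_mul_left' ha).ofReal
  refine h1.bdd_mul (c := 1) ?_ ?_
  · exact (by fun_prop : Continuous fun ξ : ℝ => Complex.exp (Complex.I * (y:ℂ) * (ξ:ℂ))).aestronglyMeasurable
  · filter_upwards with ξ
    have : Complex.I * (y:ℂ) * (ξ:ℂ) = ((y * ξ : ℝ) : ℂ) * Complex.I := by push_cast; ring
    rw [this, Complex.norm_exp_ofReal_mul_I]

lemma invFT_phi (D : LPData) (j : ℕ) (y : ℝ) :
    invFT (fun ξ => (D.phi ((2:ℝ) ^ (-(j:ℤ)) * ξ) : ℂ)) y =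
      2 ^ j * (2 * invFT (fun ξ => (D.chi ξ : ℂ)) (2 * (2 ^ j * y)) -
        invFT (fun ξ => (D.chi ξ : ℂ)) (2 ^ j * y)) := by
  have s1 := invFT_scale (fun ξ => (D.chi ξ : ℂ)) (a := 2 ^ j) (by positivity) y
  have s2 := invFT_scale (fun ξ => (D.chi ξ : ℂ)) (a := 2 * 2 ^ j) (by positivity) y
  have : invFT (fun ξ => (D.phi ((2:ℝ) ^ (-(j:ℤ)) * ξ) : ℂ)) y =
      invFT (fun ξ => (D.chi ((2 * 2 ^ j)⁻¹ * ξ) : ℂ)) y - invFT (fun ξ => (D.chi ((2 ^ j)⁻¹ * ξ) : ℂ)) y := by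
    unfold invFT
    rw [← mul_sub, ← integral_sub (chi_ft_integrable D y _ (by positivity)) (chi_ft_integrable D y _ (by positivity))]
    congr 2
    funext ξ
    beta_reduce
    rw [phi_eq, ← mul_sub, ← Complex.ofReal_sub]
    congr 4
    · rw [zpow_neg, zpow_natCast]; field_simp
    · rw [zpow_neg, zpow_natCast]
  rw [this, s1, s2]
  push_cast
  rw [mul_assoc (2:ℝ)]
  ring

lemma LPblock_nat (D : LPData) (j : ℕ) (f : ℝ → ℝ) (hf : Measurable f) {B : ℝ}
    (hB : ∀ x, |f x| ≤ B) (x : ℝ) :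
    LPblock D j f x = ∫ z, kap (kD D) z * f (x - z / 2 ^ j) := by
  unfold LPblock
  rw [if_neg (by omega), if_pos (by omega)]
  simp_rw [invFT_phi]
  set kc := invFT (fun ξ => (D.chi ξ : ℂ)) with hkc
  have h2 : (2:ℝ)^j ≠ 0 := by positivity
  have hkci : Integrable kc := invFT_chi_integrable D
  have hI : Integrable (fun z => 2 * kc (2 * z) - kc z) :=
    ((hkci.comp_mul_left' (by norm_num : (2:ℝ) ≠ 0)).const_mul 2).sub hkci
  have hI2 : Integrable (fun y => 2 ^ j * (2 * kc (2 * (2^j * y)) - kc (2^j * y)) * (f (x - y) : ℂ)) := by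
    refine ((hI.comp_mul_left' h2).const_mul (2^j)).mul_bdd (c := B) ?_ ?_
    · exact (Complex.measurable_ofReal.comp (hf.comp (measurable_const.sub measurable_id))).aestronglyMeasurable
    · filter_upwards with y
      simpa using hB _
  have := integral_re (𝕜 := ℂ) hI2
  simp only [RCLike.re_eq_complex_re] at this
  rw [← this]
  have e : ∀ y, (2 ^ j * (2 * kc (2 * (2^j * y)) - kc (2^j * y)) * (f (x - y) : ℂ)).re =
      2 ^ j * (kap (kD D) (2 ^ j * y) * f (x - (2 ^ j * y) / 2 ^ j)) := fun y => by
    have e1 : (2 ^ j * y) / 2 ^ j = y := by field_simp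
    rw [e1, Complex.re_mul_ofReal]
    have : ((2:ℂ)^j) = ((2^j : ℝ) : ℂ) := by push_cast; rfl
    rw [this, Complex.re_ofReal_mul]
    unfold kap kD
    simp
    ring
  simp_rw [e]
  rw [integral_const_mul, Measure.integral_comp_mul_left (fun z => kap (kD D) z * f (x - z / 2 ^ j))]
  rw [abs_of_pos (by positivity), smul_eq_mul, ← mul_assoc, mul_inv_cancel₀ h2, one_mul]

lemma LPblock_neg_one (D : LPData) (x : ℝ) :
    LPblock D (-1) heaviside x = Hk (kD D) x := by
  unfold LPblock
  rw [if_pos rfl]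
  set kc := invFT (fun ξ => (D.chi ξ : ℂ)) with hkc
  have hkci : Integrable kc := invFT_chi_integrable D
  have hI2 : Integrable (fun y => kc y * (heaviside (x - y) : ℂ)) := by
    refine hkci.mul_bdd (c := 1) ?_ ?_
    · exact (Complex.measurable_ofReal.comp (heav_meas.comp (measurable_const.sub measurable_id))).aestronglyMeasurable
    · filter_upwards with y
      simpa using heav_bdd _
  have := integral_re (𝕜 := ℂ) hI2
  simp only [RCLike.re_eq_complex_re] at this
  rw [← this, ← ker_heav]
  congr 1
  funext y
  rw [Complex.re_mul_ofReal]; rfl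

lemma SN_eq (D : LPData) (N : ℕ) (x : ℝ) : SNsum D N heaviside x = Hk (kD D) (2 ^ N * x) := by
  obtain ⟨k', hk⟩ := exists_goodKer D
  unfold SNsum
  induction N with
  | zero => simp [LPblock_neg_one]
  | succ n ih =>
    rw [Finset.sum_range_succ, ih]
    have : ((n + 1 : ℕ) : ℤ) - 1 = (n : ℤ) := by push_cast; ring
    rw [this, LPblock_nat D n heaviside heav_meas heav_bdd, kap_heav hk (by positivity)]
    rw [pow_succ']
    ring_nf

open MeasureTheory Set Filter
open scoped ENNReal NNReal Topology

noncomputable def Aop (f : ℝ → ℝ) (x : ℝ) : ℝ := ∫ y in Ioi (0:ℝ), Real.exp (-y) * f (x - y)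
noncomputable def Bop (f : ℝ → ℝ) (x : ℝ) : ℝ := ∫ y in Ioi (0:ℝ), Real.exp (-y) * f (x + y)

/-- bounded measurable -/
def BM (f : ℝ → ℝ) (B : ℝ) : Prop := Measurable f ∧ ∀ x, |f x| ≤ B

lemma BM.neg_arg {f B} (h : BM f B) : BM (fun x => f (-x)) B :=
  ⟨h.1.comp measurable_neg, fun x => h.2 _⟩

lemma BM.add {f g B C} (h : BM f B) (h' : BM g C) : BM (fun x => f x + g x) (B + C) :=
  ⟨h.1.add h'.1, fun x => (abs_add_le _ _).trans (add_le_add (h.2 x) (h'.2 x))⟩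

lemma BM.const_mul {f B} (h : BM f B) (c : ℝ) : BM (fun x => c * f x) (|c| * B) :=
  ⟨h.1.const_mul c, fun x => by rw [abs_mul]; exact mul_le_mul_of_nonneg_left (h.2 x) (abs_nonneg _)⟩

lemma Bop_eq (f : ℝ → ℝ) (x : ℝ) : Bop f x = Aop (fun t => f (-t)) (-x) := by
  unfold Aop Bop
  congr 1
  funext y
  congr 2
  ring

lemma A_int {f B} (h : BM f B) (x : ℝ) :
    IntegrableOn (fun y => Real.exp (-y) * f (x - y)) (Ioi (0:ℝ)) := by
  have h1 : IntegrableOn (fun y : ℝ => Real.exp (-y)) (Ioi 0) := integrableOn_exp_neg_Ioi 0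
  refine Integrable.mul_bdd (c := B) h1 ?_ ?_
  · exact (h.1.comp (measurable_const.sub measurable_id)).aestronglyMeasurable
  · filter_upwards with y; exact h.2 _

lemma B_int {f B} (h : BM f B) (x : ℝ) :
    IntegrableOn (fun y => Real.exp (-y) * f (x + y)) (Ioi (0:ℝ)) := by
  have := A_int h.neg_arg (-x)
  refine this.congr_fun (fun y _ => ?_) measurableSet_Ioi
  simp only
  congr 2
  ring

lemma A_bdd {f B} (h : BM f B) (x : ℝ) : |Aop f x| ≤ B := by
  unfold Aop
  calc _ ≤ ∫ y in Ioi (0:ℝ), Real.exp (-y) * B := by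
        refine abs_integral_le_integral_abs.trans ?_
        refine setIntegral_mono_on (A_int h x).norm ((integrableOn_exp_neg_Ioi 0).mul_const B) measurableSet_Ioi ?_
        intro y _
        rw [abs_mul, abs_of_pos (Real.exp_pos _)]
        exact mul_le_mul_of_nonneg_left (h.2 _) (Real.exp_pos _).le
    _ = B := by
        rw [integral_mul_const, integral_exp_neg_Ioi]; simp

lemma B_bdd {f B} (h : BM f B) (x : ℝ) : |Bop f x| ≤ B := by
  rw [Bop_eq]; exact A_bdd h.neg_arg _

lemma A_add {f g B C} (h : BM f B) (h' : BM g C) (x : ℝ) :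
    Aop (fun x => f x + g x) x = Aop f x + Aop g x := by
  unfold Aop
  rw [← integral_add (A_int h x) (A_int h' x)]
  congr 1; funext y; ring

lemma A_const_mul (f : ℝ → ℝ) (c : ℝ) (x : ℝ) :
    Aop (fun x => c * f x) x = c * Aop f x := by
  unfold Aop
  rw [← integral_const_mul]
  congr 1; funext y; ring

lemma A_L1 {f} (hi : Integrable f) (x : ℝ) : |Aop f x| ≤ ∫ t, |f t| := by
  unfold Aop
  refine abs_integral_le_integral_abs.trans ?_
  have hi2 : Integrable (fun y => |f (x - y)|) := (hi.comp_sub_left x).norm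
  calc _ ≤ ∫ y in Ioi (0:ℝ), |f (x - y)| := by
        have hm : IntegrableOn (fun y => |Real.exp (-y) * f (x - y)|) (Ioi 0) := by
          refine Integrable.norm (f := fun y => Real.exp (-y) * f (x - y)) ?_
          refine Integrable.bdd_mul (c := 1) (hi.comp_sub_left x).integrableOn ?_ ?_
          · exact (by fun_prop : Continuous fun y : ℝ => Real.exp (-y)).aestronglyMeasurable
          · rw [ae_restrict_iff' measurableSet_Ioi]
            filter_upwards with y hy
            have : (0:ℝ) < y := hy
            rw [Real.norm_of_nonneg (Real.exp_pos _).le]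
            simp [this.le]
        refine setIntegral_mono_on hm hi2.integrableOn measurableSet_Ioi ?_
        intro y hy
        have : (0:ℝ) < y := hy
        rw [abs_mul, abs_of_pos (Real.exp_pos _)]
        have h1 : Real.exp (-y) ≤ 1 := by simp [this.le]
        nlinarith [abs_nonneg (f (x - y))]
    _ ≤ ∫ y, |f (x - y)| := setIntegral_le_integral hi2 (by filter_upwards with y; positivity)
    _ = _ := integral_sub_left_eq_self (fun t => |f t|) volume x

lemma tendsto_exp_bdd {Q : ℝ → ℝ} {b : ℝ} (hb : ∀ x, |Q x| ≤ b) :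
    Tendsto (fun y => Real.exp (-y) * Q y) atTop (𝓝 0) := by
  have h1 : Tendsto (fun y : ℝ => Real.exp (-y) * b) atTop (𝓝 0) := by
    simpa using (Real.tendsto_exp_neg_atTop_nhds_zero).mul_const b
  refine squeeze_zero_norm (fun y => ?_) h1
  rw [Real.norm_eq_abs, abs_mul, abs_of_pos (Real.exp_pos _)]
  exact mul_le_mul_of_nonneg_left (hb y) (Real.exp_pos _).le

lemma A_deriv {Q q : ℝ → ℝ} {b c : ℝ} (hQ : ∀ x, HasDerivAt Q (q x) x) (hb : BM Q b)
    (hc : BM q c) (x : ℝ) : Aop q x = Q x - Aop Q x := by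
  have hd : ∀ y ∈ Ici (0:ℝ), HasDerivAt (fun y => -(Real.exp (-y) * Q (x - y)))
      (Real.exp (-y) * Q (x - y) + Real.exp (-y) * q (x - y)) y := fun y _ => by
    have h1 : HasDerivAt (fun y : ℝ => Real.exp (-y)) (-Real.exp (-y)) y := by
      simpa using (hasDerivAt_neg y).exp
    have h2 : HasDerivAt (fun y : ℝ => Q (x - y)) (-q (x - y)) y := by
      exact ((hQ (x - y)).comp y ((hasDerivAt_id y).const_sub x)).congr_deriv (by simp)
    exact (h1.mul h2).neg.congr_deriv (by ring)
  have ht : Tendsto (fun y => -(Real.exp (-y) * Q (x - y))) atTop (𝓝 0) := by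
    simpa using (tendsto_exp_bdd (Q := fun y => Q (x - y)) (fun y => hb.2 (x - y))).neg
  have := integral_Ioi_of_hasDerivAt_of_tendsto' hd ((A_int hb x).add (A_int hc x)) ht
  rw [integral_add (A_int hb x) (A_int hc x)] at this
  unfold Aop
  simp at this
  linarith

lemma B_deriv {Q q : ℝ → ℝ} {b c : ℝ} (hQ : ∀ x, HasDerivAt Q (q x) x) (hb : BM Q b)
    (hc : BM q c) (x : ℝ) : Bop q x = Bop Q x - Q x := by
  have h2 : ∀ y, HasDerivAt (fun y : ℝ => Q (-y)) (-q (-y)) y := fun y => by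
    exact ((hQ (-y)).comp y (hasDerivAt_neg y)).congr_deriv (by simp)
  have hc2 : BM (fun y => -q (-y)) c := ⟨hc.neg_arg.1.neg, fun y => by rw [abs_neg]; exact hc.2 _⟩
  have := A_deriv h2 hb.neg_arg hc2 (-x)
  have e := A_const_mul (fun y => q (-y)) (-1) (-x)
  simp only [neg_mul, one_mul] at e
  rw [e, ← Bop_eq, ← Bop_eq] at this
  simp at this
  linarith

lemma A_alt (f : ℝ → ℝ) (x : ℝ) : Aop f x = Real.exp (-x) * ∫ t in Iic x, Real.exp t * f t := by
  unfold Aop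
  rw [← integral_const_mul, integral_Iic_eq_integral_Iio, ← integral_indicator measurableSet_Ioi,
    ← integral_indicator measurableSet_Iio,
    ← integral_sub_left_eq_self ((Iio x).indicator fun t => Real.exp (-x) * (Real.exp t * f t)) volume x]
  congr 1
  funext y
  unfold indicator
  simp only [mem_Ioi, mem_Iio, sub_lt_self_iff]
  congr 1
  rw [← mul_assoc, ← Real.exp_add]
  congr 2
  ring

lemma A_hder {f B} (h : BM f B) (hc : Continuous f) (x : ℝ) :
    HasDerivAt (Aop f) (f x - Aop f x) x := by
  have hinteg : ∀ x, IntegrableOn (fun t => Real.exp t * f t) (Iic x) := fun x => by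
    refine Integrable.mul_bdd (c := B) (integrableOn_exp_Iic x) ?_ ?_
    · exact h.1.aestronglyMeasurable
    · filter_upwards with y; exact h.2 _
  have hf : Aop f = fun x => Real.exp (-x) *
      ((∫ t in Iic 0, Real.exp t * f t) + ∫ t in (0:ℝ)..x, Real.exp t * f t) := by
    funext x
    rw [A_alt, ← intervalIntegral.integral_Iic_sub_Iic (hinteg 0) (hinteg x)]; ring
  have h1 : HasDerivAt (fun y : ℝ => Real.exp (-y)) (-Real.exp (-x)) x := by
    simpa using (hasDerivAt_neg x).exp
  have hcc : Continuous (fun t => Real.exp t * f t) := by fun_prop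
  have h2 := ((hcc.integral_hasStrictDerivAt 0 x).hasDerivAt).const_add (∫ t in Iic 0, Real.exp t * f t)
  have h3 := h1.mul h2
  rw [hf]
  refine h3.congr_deriv ?_
  have : Real.exp (-x) * Real.exp x = 1 := by rw [← Real.exp_add]; simp
  linear_combination (f x) * this

lemma B_hder {f B} (h : BM f B) (hc : Continuous f) (x : ℝ) :
    HasDerivAt (Bop f) (Bop f x - f x) x := by
  have h1 := A_hder h.neg_arg (hc.comp continuous_neg) (-x)
  have h2 := h1.comp x (hasDerivAt_neg x)
  have e : Bop f = Aop (fun t => f (-t)) ∘ fun x => -x := by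
    funext x; exact Bop_eq f x
  rw [e]
  refine h2.congr_deriv ?_
  simp

lemma invOneSub_eq {f B} (h : BM f B) : invOneSub f = fun x => (1/2) * (Aop f x + Bop f x) := by
  funext x
  unfold invOneSub
  congr 1
  have e1 : EqOn (fun y => Real.exp (-y) * f (x - y)) (fun y => Real.exp (-|y|) * f (x - y)) (Ioi 0) := by
    intro y hy
    have : (0:ℝ) < y := hy
    simp [abs_of_pos this]
  have i1 : IntegrableOn (fun y => Real.exp (-|y|) * f (x - y)) (Ioi 0) :=
    (A_int h x).congr_fun e1 measurableSet_Ioi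
  have e2 : EqOn (fun y => Real.exp (-y) * f (x + y)) (fun y => Real.exp (-|(-y)|) * f (x - (-y))) (Ioi 0) := by
    intro y hy
    have : (0:ℝ) < y := hy
    simp [abs_of_pos this]
  have i2 : IntegrableOn (fun y => Real.exp (-|y|) * f (x - y)) (Iic 0) := by
    have := (B_int h x).congr_fun e2 measurableSet_Ioi
    have h3 := (integrableOn_Ici_iff_integrableOn_Ioi).2 this
    have := (integrable_indicator_iff measurableSet_Ici).2 h3
    rw [← integrable_indicator_iff measurableSet_Iic]
    have e3 := this.comp_neg
    refine e3.congr ?_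
    filter_upwards with y
    unfold indicator
    simp
  rw [← intervalIntegral.integral_Iic_add_Ioi i2 i1, add_comm]
  congr 1
  · exact (setIntegral_congr_fun measurableSet_Ioi e1).symm
  · have := integral_comp_neg_Ioi (0:ℝ) (fun y => Real.exp (-|y|) * f (x - y))
    rw [neg_zero] at this
    rw [← this]
    exact (setIntegral_congr_fun measurableSet_Ioi e2).symm

noncomputable def Tp (f : ℝ → ℝ) (x : ℝ) : ℝ := (1/2) * (Aop f x - Bop f x)

lemma invOneSub_hder {f B} (h : BM f B) (hc : Continuous f) (x : ℝ) :
    HasDerivAt (invOneSub f) (- Tp f x) x := by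
  rw [invOneSub_eq h]
  refine (((A_hder h hc x).add (B_hder h hc x)).const_mul (1/2)).congr_deriv ?_
  unfold Tp; ring

lemma invOneSub_deriv {Q q : ℝ → ℝ} {b c : ℝ} (hQ : ∀ x, HasDerivAt Q (q x) x) (hb : BM Q b)
    (hc : BM q c) (x : ℝ) : invOneSub q x = - Tp Q x := by
  rw [invOneSub_eq hc]
  unfold Tp
  simp only
  rw [A_deriv hQ hb hc, B_deriv hQ hb hc]; ring

lemma Tp_hder {f B} (h : BM f B) (hc : Continuous f) (x : ℝ) :
    HasDerivAt (Tp f) (f x - invOneSub f x) x := by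
  rw [invOneSub_eq h]
  refine (((A_hder h hc x).sub (B_hder h hc x)).const_mul (1/2)).congr_deriv ?_
  ring

lemma Tp_bdd {f B} (h : BM f B) (x : ℝ) : |Tp f x| ≤ B := by
  unfold Tp
  have h1 := abs_le.1 (A_bdd h x)
  have h2 := abs_le.1 (B_bdd h x)
  rw [abs_le]; constructor <;> linarith

lemma Tp_add {f g B C} (h : BM f B) (h' : BM g C) (x : ℝ) :
    Tp (fun x => f x + g x) x = Tp f x + Tp g x := by
  unfold Tp
  rw [A_add h h', Bop_eq, A_add h.neg_arg h'.neg_arg, ← Bop_eq, ← Bop_eq]; ring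

lemma Tp_const_mul (f : ℝ → ℝ) (c : ℝ) (x : ℝ) :
    Tp (fun x => c * f x) x = c * Tp f x := by
  unfold Tp
  rw [A_const_mul, Bop_eq, A_const_mul, ← Bop_eq]; ring

lemma Tp_const (c x : ℝ) : Tp (fun _ => c) x = 0 := by
  unfold Tp Aop Bop; simp

lemma Tp_L1 {f} (hi : Integrable f) (x : ℝ) : |Tp f x| ≤ ∫ t, |f t| := by
  unfold Tp
  have h1 := abs_le.1 (A_L1 hi x)
  have h2 := A_L1 hi.comp_neg (-x)
  rw [← Bop_eq, integral_neg_eq_self (fun t => |f t|) volume] at h2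
  have h2 := abs_le.1 h2
  rw [abs_le]; constructor <;> linarith

lemma Tp_deriv {Q q : ℝ → ℝ} {b c : ℝ} (hQ : ∀ x, HasDerivAt Q (q x) x) (hb : BM Q b)
    (hc : BM q c) (x : ℝ) : |Tp q x| ≤ 2 * b := by
  unfold Tp
  rw [A_deriv hQ hb hc, B_deriv hQ hb hc]
  have h1 := abs_le.1 (A_bdd hb x)
  have h2 := abs_le.1 (B_bdd hb x)
  have h3 := abs_le.1 (hb.2 x)
  rw [abs_le]; constructor <;> linarith

lemma heav_BM : BM heaviside 1 := ⟨heav_meas, heav_bdd⟩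

lemma Tp_heav (x : ℝ) : Tp heaviside x = -(1/2) * Real.exp (-|x|) := by
  have hA : Aop heaviside x = if 0 ≤ x then 1 - Real.exp (-x) else 0 := by
    rw [A_alt]
    split_ifs with hx
    · have : ∀ t, Real.exp t * heaviside t = (Ici 0).indicator Real.exp t := fun t => by
        unfold heaviside indicator; simp
      simp_rw [this]
      rw [setIntegral_indicator measurableSet_Ici]
      have : Iic x ∩ Ici 0 = Icc 0 x := by ext; simp [and_comm]
      rw [this, integral_Icc_eq_integral_Ioc, ← intervalIntegral.integral_of_le hx, integral_exp, mul_sub,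
        ← Real.exp_add]
      simp
    · rw [setIntegral_eq_zero_of_forall_eq_zero]; · simp
      intro t ht
      have : t ≤ x := ht
      unfold heaviside
      rw [if_neg (by linarith)]; simp
  have hB : Bop heaviside x = if 0 ≤ x then 1 else Real.exp x := by
    rw [Bop_eq, A_alt]
    have : ∀ t, Real.exp t * heaviside (-t) = (Iic 0).indicator Real.exp t := fun t => by
        unfold heaviside indicator; simp
    simp_rw [this]
    rw [setIntegral_indicator measurableSet_Iic, Iic_inter_Iic, integral_exp_Iic, ← Real.exp_add]
    split_ifs with hx
    · rw [inf_eq_left.2 (by linarith)]; simp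
    · rw [inf_eq_right.2 (by linarith)]; simp
  unfold Tp
  rw [hA, hB]
  split_ifs with hx
  · rw [abs_of_nonneg hx]; ring
  · rw [abs_of_neg (by linarith)]; simp

open MeasureTheory Set Filter
open scoped ENNReal NNReal Topology

lemma osc_primitive {F F' : ℝ → ℝ} {b b' ω : ℝ} (hω : 0 < ω) (hF : ∀ x, HasDerivAt F (F' x) x)
    (hc : Continuous F') (hi : Integrable F') (hb : ∀ x, |F x| ≤ b) (hb' : ∫ x, |F' x| ≤ b') :
    ∃ Q : ℝ → ℝ, (∀ x, HasDerivAt Q (Real.cos (ω * x) * F x) x) ∧ ∀ x, |Q x| ≤ (b + b') / ω := by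
  have hsc : Continuous (fun t => Real.sin (ω * t) * F' t) := by fun_prop
  refine ⟨fun x => (Real.sin (ω * x) * F x - ∫ t in (0:ℝ)..x, Real.sin (ω * t) * F' t) / ω, ?_, ?_⟩
  · intro x
    have h0 : HasDerivAt (fun x : ℝ => ω * x) ω x := by simpa using (hasDerivAt_id x).const_mul ω
    have h1 := (h0.sin.mul (hF x)).sub (hsc.integral_hasStrictDerivAt 0 x).hasDerivAt
    refine (h1.div_const ω).congr_deriv ?_
    field_simp
    ring
  · intro x
    rw [abs_div, abs_of_pos hω]
    gcongr
    refine (abs_sub _ _).trans (add_le_add ?_ ?_)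
    · rw [abs_mul]
      have := Real.abs_sin_le_one (ω * x)
      nlinarith [hb x, abs_nonneg (F x)]
    · refine le_trans ?_ hb'
      have h1 : |∫ t in (0:ℝ)..x, Real.sin (ω * t) * F' t| ≤ abs (∫ t in (0:ℝ)..x, abs (F' t)) := by
        refine intervalIntegral.norm_integral_le_abs_of_norm_le
          (f := fun t => Real.sin (ω * t) * F' t) (g := fun t => |F' t|) (μ := volume) ?_ ?_
        · filter_upwards with t
          rw [Real.norm_eq_abs, abs_mul]
          have := Real.abs_sin_le_one (ω * t)
          nlinarith [abs_nonneg (F' t)]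
        · exact (hc.abs).intervalIntegrable _ _
      refine h1.trans ?_
      rw [intervalIntegral.abs_intervalIntegral_eq]
      rw [abs_of_nonneg (integral_nonneg fun t => abs_nonneg _)]
      exact setIntegral_le_integral hi.norm (by filter_upwards with t; positivity)

/-- decomposition of the square of the derivative of the datum -/
structure Decomp (w : ℝ → ℝ) (ε δ : ℝ) : Prop where
  ex : ∃ e q r Q : ℝ → ℝ, ∃ Be Bq : ℝ,
    (∀ x, w x = ε ^ 2 * (1/2 + (ε + ε ^ 2 / 2) * heaviside x + e x + q x + r x)) ∧
    BM e Be ∧ Integrable e ∧ (∫ x, |e x|) ≤ δ ∧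
    BM q Bq ∧ (∀ x, HasDerivAt Q (q x) x) ∧ BM Q δ ∧ BM r δ
  cont : Continuous w

lemma S_facts {k k'} (h : GoodKer k k') {a : ℝ} (ha : 0 < a) (x : ℝ) :
    HasDerivAt (fun x => Hk k (a * x)) (a * k (a * x)) x := by
  have h0 : HasDerivAt (fun x : ℝ => a * x) a x := by simpa using (hasDerivAt_id x).const_mul a
  exact ((Hk_hder h (a * x)).comp x h0).congr_deriv (by ring)

lemma S_L1 {k k'} (h : GoodKer k k') {a : ℝ} (ha : 0 < a) :
    Integrable (fun x => Hk k (a * x) - heaviside x) ∧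
    ∫ x, |Hk k (a * x) - heaviside x| ≤ (∫ t, (1 + t ^ 2) * |k t|) * Real.pi / a := by
  set C2 := ∫ t, (1 + t ^ 2) * |k t|
  have hcont : Continuous (Hk k) := continuous_iff_continuousAt.2 fun x => (Hk_hder h x).continuousAt
  have hi : Integrable (fun x => Hk k x - heaviside x) := by
    refine (integrable_inv_one_add_sq.const_mul C2).mono'
      (hcont.measurable.sub heav_meas).aestronglyMeasurable ?_
    filter_upwards with x
    exact Hk_heav h x
  have e : ∀ x, Hk k (a * x) - heaviside x = Hk k (a * x) - heaviside (a * x) := fun x => by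
    rw [heav_scale ha]
  simp_rw [e]
  refine ⟨hi.comp_mul_left' ha.ne', ?_⟩
  rw [Measure.integral_comp_mul_left (fun x => |Hk k x - heaviside x|), abs_of_pos (by positivity), smul_eq_mul]
  have : ∫ x, |Hk k x - heaviside x| ≤ C2 * Real.pi := by
    rw [← integral_univ_inv_one_add_sq, ← integral_const_mul]
    exact integral_mono hi.norm (integrable_inv_one_add_sq.const_mul C2) (Hk_heav h)
  rw [div_eq_inv_mul]
  gcongr

set_option maxHeartbeats 1000000 in
lemma decomp_aux {k k'} (h : GoodKer k k') : ∃ C, 0 < C ∧ ∀ (N : ℕ) (ε : ℝ), 0 < ε → ε ≤ 1 →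
    Decomp (fun x => (deriv (fun x => -ε * invOneSub (deriv fun y =>
      Real.cos ((2:ℝ) ^ (N + 5) * y) * (1 + ε * Hk k (2 ^ N * y))) x) x) ^ 2) ε (C / 2 ^ N) := by
  set I := ∫ t, |k t| with hI
  set C2 := ∫ t, (1 + t ^ 2) * |k t| with hC2
  have hI0 : 0 ≤ I := integral_nonneg fun t => abs_nonneg _
  have hC20 : 0 ≤ C2 := integral_nonneg fun t => by positivity
  set b := 1 + I with hb
  have hb1 : 1 ≤ b := by linarith
  have hpi := Real.pi_pos
  refine ⟨8 * b ^ 2 + (1 + b) * (C2 * Real.pi), by positivity, ?_⟩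
  intro N ε hε hε1
  set a : ℝ := 2 ^ N with ha_def
  have ha : 0 < a := by positivity
  have ha1 : 1 ≤ a := one_le_pow₀ (by norm_num)
  set ω : ℝ := 2 ^ (N + 5) with hω_def
  have hωa : ω = 32 * a := by rw [hω_def, pow_add]; ring
  have hω : 0 < ω := by positivity
  set S : ℝ → ℝ := fun x => Hk k (a * x) with hS
  set S' : ℝ → ℝ := fun x => a * k (a * x) with hS'
  have hSd : ∀ x, HasDerivAt S (S' x) x := S_facts h ha
  have hS'c : Continuous S' := by have := h.cont; fun_prop
  have hSc : Continuous S := continuous_iff_continuousAt.2 fun x => (hSd x).continuousAt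
  have hS'i : Integrable S' := (h.int.comp_mul_left' ha.ne').const_mul a
  have hS'1 : ∫ x, |S' x| = I := by
    have : ∀ x, |S' x| = a * |k (a * x)| := fun x => by
      rw [hS', abs_mul, abs_of_pos ha]
    simp_rw [this]
    rw [integral_const_mul, Measure.integral_comp_mul_left (fun x => |k x|), abs_of_pos (by positivity),
      smul_eq_mul, ← mul_assoc, mul_inv_cancel₀ ha.ne', one_mul]
  have hSb : ∀ x, |S x| ≤ I := fun x => Hk_bdd h _
  set G : ℝ → ℝ := fun x => 1 + ε * S x with hG
  have hGd : ∀ x, HasDerivAt G (ε * S' x) x := fun x => ((hSd x).const_mul ε).const_add 1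
  have hGc : Continuous G := by fun_prop
  have hGb : ∀ x, |G x| ≤ b := fun x => by
    rw [hG, hb]
    refine (abs_add_le _ _).trans ?_
    rw [abs_one, abs_mul, abs_of_pos hε]
    nlinarith [hSb x, abs_nonneg (S x)]
  set g : ℝ → ℝ := fun x => Real.cos (ω * x) * G x with hg
  have hgc : Continuous g := by fun_prop
  have hgb : BM g b := ⟨hgc.measurable, fun x => by
    rw [hg, abs_mul]
    have := Real.abs_cos_le_one (ω * x)
    nlinarith [hGb x, abs_nonneg (G x)]⟩
  have hgd : ∀ x, HasDerivAt g (-(ω * Real.sin (ω * x)) * G x + Real.cos (ω * x) * (ε * S' x)) x := fun x => by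
    have h0 : HasDerivAt (fun x : ℝ => ω * x) ω x := by simpa using (hasDerivAt_id x).const_mul ω
    exact (h0.cos.mul (hGd x)).congr_deriv (by ring)
  have hdg : deriv g = fun x => -(ω * Real.sin (ω * x)) * G x + Real.cos (ω * x) * (ε * S' x) :=
    funext fun x => (hgd x).deriv
  obtain ⟨Ck, hCk⟩ := h.bdd
  have hdgb : BM (deriv g) (ω * b + ε * (a * Ck)) := by
    rw [hdg]
    refine ⟨Continuous.measurable (by fun_prop), fun x => ?_⟩
    refine (abs_add_le _ _).trans (add_le_add ?_ ?_)
    · rw [abs_mul, abs_neg, abs_mul, abs_of_pos hω]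
      gcongr
      · have := Real.abs_sin_le_one (ω * x)
        nlinarith
      · exact hGb x
    · rw [abs_mul, abs_mul, abs_of_pos hε, hS', abs_mul, abs_of_pos ha]
      have := Real.abs_cos_le_one (ω * x)
      have h2 := hCk (a * x)
      have h3 : ε * (a * |k (a * x)|) ≤ ε * (a * Ck) := by gcongr
      have h4 : 0 ≤ ε * (a * |k (a * x)|) := by positivity
      nlinarith
  have hdgd : ∀ x, HasDerivAt g (deriv g x) x := fun x => by rw [hdg]; exact hgd x
  have hu : (fun x => -ε * invOneSub (deriv g) x) = fun x => ε * Tp g x := by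
    funext x
    rw [invOneSub_deriv hdgd hgb hdgb]; ring
  have hud : ∀ x, HasDerivAt (fun x => -ε * invOneSub (deriv g) x) (ε * (g x - invOneSub g x)) x := fun x => by
    rw [hu]; exact (Tp_hder hgb hgc x).const_mul ε
  set R := invOneSub g with hR
  have hRc : Continuous R := continuous_iff_continuousAt.2 fun x => (invOneSub_hder hgb hgc x).continuousAt
  have hG'i : ∫ x, |ε * S' x| ≤ I := by
    simp_rw [abs_mul, abs_of_pos hε]
    rw [integral_const_mul, hS'1]
    nlinarith
  obtain ⟨Q1, hQ1d, hQ1b⟩ := osc_primitive hω hGd (by fun_prop) (hS'i.const_mul ε) hGb hG'i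
  have hQ1c : Continuous Q1 := continuous_iff_continuousAt.2 fun x => (hQ1d x).continuousAt
  have hRb : ∀ x, |R x| ≤ 2 * b / a := fun x => by
    have hQBM : BM Q1 ((b + I) / ω) := ⟨hQ1c.measurable, hQ1b⟩
    rw [hR, invOneSub_deriv hQ1d hQBM hgb, abs_neg]
    refine (Tp_bdd hQBM x).trans ?_
    gcongr
    · linarith
    · linarith
  have hFd : ∀ x, HasDerivAt (fun x => (1/2) * G x ^ 2) (G x * (ε * S' x)) x := fun x => by
    exact (((hGd x).pow 2).const_mul (1/2)).congr_deriv (by simp; ring)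
  have hFi : Integrable (fun x => G x * (ε * S' x)) :=
    (hS'i.const_mul ε).bdd_mul (c := b) hGc.aestronglyMeasurable (by filter_upwards with x; exact hGb x)
  have hFi1 : ∫ x, |G x * (ε * S' x)| ≤ b * I := by
    calc _ ≤ ∫ x, b * |ε * S' x| := by
          refine integral_mono hFi.norm ((hS'i.const_mul ε).norm.const_mul b) fun x => ?_
          simp only [Real.norm_eq_abs]
          rw [abs_mul]
          exact mul_le_mul_of_nonneg_right (hGb x) (abs_nonneg _)
      _ = b * ∫ x, |ε * S' x| := integral_const_mul _ _
      _ ≤ _ := by gcongr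
  have hFb : ∀ x, |(1/2) * G x ^ 2| ≤ b ^ 2 := fun x => by
    rw [abs_mul, abs_pow]
    have : |G x| ^ 2 ≤ b ^ 2 := by gcongr; exact hGb x
    have h3 : |(1/2:ℝ)| = 1/2 := by norm_num
    rw [h3]
    nlinarith [sq_nonneg b]
  obtain ⟨Q, hQd, hQb⟩ := osc_primitive (ω := 2 * ω) (by positivity) hFd (by fun_prop) hFi hFb hFi1
  have hQc : Continuous Q := continuous_iff_continuousAt.2 fun x => (hQd x).continuousAt
  obtain ⟨hei, heb⟩ := S_L1 h ha
  have heq : ∀ x, ε * (S x - heaviside x) + ε ^ 2 / 2 * (S x ^ 2 - heaviside x) =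
      (S x - heaviside x) * (ε + ε ^ 2 / 2 * (S x + heaviside x)) := fun x => by
    have := heav_sq x
    linear_combination (ε^2/2) * this
  have hfac : ∀ x, |ε + ε ^ 2 / 2 * (S x + heaviside x)| ≤ 1 + b := fun x => by
    refine (abs_add_le _ _).trans (add_le_add ?_ ?_)
    · rw [abs_of_pos hε]; exact hε1
    · rw [abs_mul, abs_of_pos (by positivity)]
      have h1 : |S x + heaviside x| ≤ b := by
        refine (abs_add_le _ _).trans ?_
        linarith [hSb x, heav_bdd x]
      have h2 : ε ^ 2 / 2 ≤ 1 := by nlinarith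
      nlinarith [abs_nonneg (S x + heaviside x)]
  have hebm : ∀ x, |ε * (S x - heaviside x) + ε ^ 2 / 2 * (S x ^ 2 - heaviside x)| ≤
      |S x - heaviside x| * (1 + b) := fun x => by
    rw [heq, abs_mul]
    exact mul_le_mul_of_nonneg_left (hfac x) (abs_nonneg _)
  have hem : Measurable fun x => ε * (S x - heaviside x) + ε ^ 2 / 2 * (S x ^ 2 - heaviside x) := by
    have := hSc.measurable
    have := heav_meas
    fun_prop
  have hei2 : Integrable fun x => ε * (S x - heaviside x) + ε ^ 2 / 2 * (S x ^ 2 - heaviside x) := by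
    refine (hei.norm.mul_const (1 + b)).mono' hem.aestronglyMeasurable ?_
    filter_upwards with x
    exact hebm x
  have hderiv : ∀ x, deriv (fun x => -ε * invOneSub (deriv g) x) x = ε * (g x - R x) := fun x => (hud x).deriv
  refine ⟨⟨fun x => ε * (S x - heaviside x) + ε ^ 2 / 2 * (S x ^ 2 - heaviside x),
    fun x => Real.cos (2 * ω * x) * ((1/2) * G x ^ 2), fun x => -2 * g x * R x + R x ^ 2, Q,
    b * (1 + b), b ^ 2, ?_, ⟨hem, ?_⟩, hei2, ?_, ⟨Continuous.measurable (by fun_prop), ?_⟩, hQd,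
    ⟨hQc.measurable, ?_⟩, ⟨Continuous.measurable (by fun_prop), ?_⟩⟩, ?_⟩
  · intro x
    show (deriv (fun x => -ε * invOneSub (deriv g) x) x) ^ 2 = _
    rw [hderiv]
    have hc2 : Real.cos (2 * ω * x) = 2 * Real.cos (ω * x) ^ 2 - 1 := by
      rw [mul_assoc, Real.cos_two_mul]
    have hgx : g x = Real.cos (ω * x) * G x := rfl
    have hGx : G x = 1 + ε * S x := rfl
    simp only
    rw [hc2]
    have : (g x) ^ 2 = Real.cos (ω * x) ^ 2 * (1 + ε * S x) ^ 2 := by rw [hgx, hGx]; ring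
    rw [hGx]
    linear_combination ε ^ 2 * this
  · intro x
    refine (hebm x).trans ?_
    gcongr
    refine (abs_sub _ _).trans ?_
    linarith [hSb x, heav_bdd x]
  · calc _ ≤ ∫ x, |S x - heaviside x| * (1 + b) := integral_mono hei2.norm (hei.norm.mul_const _) hebm
      _ = (∫ x, |S x - heaviside x|) * (1 + b) := integral_mul_const _ _
      _ ≤ (C2 * Real.pi / a) * (1 + b) := by gcongr
      _ = ((1 + b) * (C2 * Real.pi)) / a := by ring
      _ ≤ _ := by gcongr; nlinarith [sq_nonneg b]
  · intro x
    rw [abs_mul]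
    have := Real.abs_cos_le_one (2 * ω * x)
    nlinarith [hFb x, abs_nonneg ((1/2) * G x ^ 2)]
  · intro x
    refine (hQb x).trans ?_
    have : 0 ≤ (1 + b) * (C2 * Real.pi) := by positivity
    refine div_le_div₀ (by positivity) ?_ ha ?_
    · nlinarith
    · linarith
  · intro x
    have h1 : |g x| ≤ b := hgb.2 x
    have h2 := hRb x
    have h3 : |(-2 * g x * R x + R x ^ 2)| ≤ 2 * (|g x| * |R x|) + |R x| * |R x| := by
      refine (abs_add_le _ _).trans ?_
      rw [abs_mul, abs_mul, abs_pow]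
      simp
      nlinarith
    refine h3.trans ?_
    have h4 : |g x| * |R x| ≤ b * (2 * b / a) := by gcongr
    have h5 : |R x| * |R x| ≤ (2 * b) * (2 * b / a) := by
      gcongr
      refine h2.trans ?_
      rw [div_le_iff₀ ha]
      nlinarith
    have h6 : (8 * b ^ 2 + (1 + b) * (C2 * Real.pi)) / a = 8 * b ^ 2 / a + ((1 + b) * (C2 * Real.pi)) / a := add_div _ _ _
    have h7 : 0 ≤ ((1 + b) * (C2 * Real.pi)) / a := by positivity
    have h8 : 2 * (b * (2 * b / a)) + (2 * b) * (2 * b / a) = 8 * b ^ 2 / a := by ring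
    linarith
  · show Continuous (fun x => (deriv (fun x => -ε * invOneSub (deriv g) x) x) ^ 2)
    have hfin : (fun x => (deriv (fun x => -ε * invOneSub (deriv g) x) x) ^ 2) =
        fun x => (ε * (g x - R x)) ^ 2 := funext fun x => by rw [hderiv x]
    rw [hfin]
    exact (continuous_const.mul (hgc.sub hRc)).pow 2

open MeasureTheory Set Filter
open scoped ENNReal NNReal Topology

lemma L_int {k k'} (h : GoodKer k k') {f : ℝ → ℝ} {B : ℝ} (hf : BM f B) (x a : ℝ) :
    Integrable (fun z => kap k z * f (x - z / a)) := by
  refine (kap_int h).mul_bdd (c := B) ?_ ?_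
  · exact (hf.1.comp (by fun_prop)).aestronglyMeasurable
  · filter_upwards with z
    exact hf.2 _

lemma L_le {k k'} (h : GoodKer k k') {f : ℝ → ℝ} {B : ℝ} (hf : BM f B) (x a : ℝ) :
    |∫ z, kap k z * f (x - z / a)| ≤ (∫ z, |kap k z|) * B := by
  refine (abs_integral_le_integral_abs).trans ?_
  rw [← integral_mul_const]
  refine integral_mono (L_int h hf x a).norm ((kap_int h).norm.mul_const B) fun z => ?_
  simp only [Real.norm_eq_abs]
  rw [abs_mul]
  exact mul_le_mul_of_nonneg_left (hf.2 _) (abs_nonneg _)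

lemma L_cont {k k'} (h : GoodKer k k') {f : ℝ → ℝ} {B : ℝ} (hf : BM f B) (hc : Continuous f) (a : ℝ) :
    Continuous (fun x => ∫ z, kap k z * f (x - z / a)) := by
  refine continuous_of_dominated (bound := fun z => |kap k z| * B) ?_ ?_ ?_ ?_
  · intro x; exact (L_int h hf x a).aestronglyMeasurable
  · intro x; filter_upwards with z
    rw [Real.norm_eq_abs, abs_mul]
    exact mul_le_mul_of_nonneg_left (hf.2 _) (abs_nonneg _)
  · exact (kap_int h).norm.mul_const B
  · filter_upwards with z
    fun_prop

lemma sup_le_eLp {f : ℝ → ℝ} (hc : Continuous f) (x : ℝ) :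
    ENNReal.ofReal |f x| ≤ eLpNorm f ⊤ volume := by
  by_contra hlt
  push Not at hlt
  have h1 : ∀ᵐ y, ENNReal.ofReal |f y| ≤ eLpNorm f ⊤ volume := by
    have := ae_le_eLpNormEssSup (f := f) (μ := volume)
    rw [eLpNorm_exponent_top]
    filter_upwards [this] with y hy
    rwa [← Real.enorm_eq_ofReal_abs]
  have hg : Continuous fun y => ENNReal.ofReal |f y| := ENNReal.continuous_ofReal.comp hc.abs
  have ho : IsOpen {y | eLpNorm f ⊤ volume < ENNReal.ofReal |f y|} := isOpen_lt continuous_const hg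
  have := ho.measure_pos volume ⟨x, hlt⟩
  have h2 : volume {y | eLpNorm f ⊤ volume < ENNReal.ofReal |f y|} = 0 := by
    have := ae_iff.1 h1
    simpa using this
  exact this.ne' h2

lemma L_L1 {k k'} (h : GoodKer k k') {Ck : ℝ} (hCk : ∀ x, |kap k x| ≤ Ck) {e : ℝ → ℝ} {B : ℝ} (hf : BM e B)
    (hi : Integrable e) (x : ℝ) {a : ℝ} (ha : 0 < a) :
    |∫ z, kap k z * e (x - z / a)| ≤ Ck * a * ∫ x, |e x| := by
  refine (abs_integral_le_integral_abs).trans ?_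
  have hi2 : Integrable (fun z => e (x - z / a)) := by
    have := (hi.comp_sub_left x).comp_mul_left' (R := a⁻¹) (by positivity)
    simpa [div_eq_inv_mul] using this
  have h2 : ∫ z, |e (x - z / a)| = a * ∫ x, |e x| := by
    have h3 := Measure.integral_comp_mul_left (fun y => |e (x - y)|) a⁻¹
    rw [integral_sub_left_eq_self (fun y => |e y|) volume x, inv_inv, abs_of_pos ha] at h3
    simpa [div_eq_inv_mul] using h3
  rw [mul_assoc, ← h2, ← integral_const_mul]
  refine integral_mono (L_int h hf x a).norm (hi2.norm.const_mul Ck) fun z => ?_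
  simp only [Real.norm_eq_abs]
  rw [abs_mul]
  exact mul_le_mul_of_nonneg_right (hCk _) (abs_nonneg _)

lemma L_q {k k'} (h : GoodKer k k') {q Q : ℝ → ℝ} {B δ : ℝ} (hq : BM q B) (hQ : ∀ x, HasDerivAt Q (q x) x)
    (hQb : BM Q δ) (x : ℝ) {a : ℝ} (ha : 0 < a) :
    |∫ z, kap k z * q (x - z / a)| ≤ (∫ z, |4 * k' (2 * z) - k' z|) * a * δ := by
  have hv : ∀ z, HasDerivAt (fun z => -a * Q (x - z / a)) (q (x - z / a)) z := fun z => by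
    have h0 : HasDerivAt (fun z : ℝ => x - z / a) (-(1 / a)) z := ((hasDerivAt_id z).div_const a).const_sub x
    refine (((hQ (x - z / a)).comp z h0).const_mul (-a)).congr_deriv ?_
    field_simp
  have hvb : BM (fun z => -a * Q z) (a * δ) := ⟨hQb.1.const_mul _, fun z => by
    rw [abs_mul, abs_neg, abs_of_pos ha]
    exact mul_le_mul_of_nonneg_left (hQb.2 _) ha.le⟩
  have hi1 : Integrable (fun z => (4 * k' (2 * z) - k' z) * (-a * Q (x - z / a))) := by
    refine (kap_int' h).mul_bdd (c := a * δ) ?_ ?_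
    · exact (hvb.1.comp (g := fun z => -a * Q z) (f := fun z => x - z / a) (by fun_prop)).aestronglyMeasurable
    · filter_upwards with z
      exact hvb.2 _
  have := integral_mul_deriv_eq_deriv_mul_of_integrable (u := kap k) (v := fun z => -a * Q (x - z / a))
    (fun z _ => kap_hder h z) (fun z _ => hv z) (L_int h hq x a) hi1 (L_int h hvb x a)
  rw [this, abs_neg]
  refine (abs_integral_le_integral_abs).trans ?_
  rw [mul_assoc, ← integral_mul_const]
  refine integral_mono hi1.norm ((kap_int' h).norm.mul_const _) fun z => ?_
  simp only [Real.norm_eq_abs]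
  rw [abs_mul]
  exact mul_le_mul_of_nonneg_left (hvb.2 _) (abs_nonneg _)

lemma Phi_ne {k k'} (h : GoodKer k k') : ∃ x, Hk k (2 * x) - Hk k x ≠ 0 := by
  by_contra hcon
  push Not at hcon
  have h0 : HasDerivAt (fun x : ℝ => 2 * x) 2 0 := by simpa using (hasDerivAt_id (0:ℝ)).const_mul 2
  have h1 : HasDerivAt (fun x => Hk k (2 * x) - Hk k x) (k (2 * 0) * 2 - k 0) 0 :=
    (HasDerivAt.comp (h₂ := Hk k) (h := fun x : ℝ => 2 * x) 0 (Hk_hder h (2 * 0)) h0).sub (Hk_hder h 0)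
  have h2 : (fun x => Hk k (2 * x) - Hk k x) = fun _ => 0 := funext hcon
  rw [h2] at h1
  have := h1.unique (hasDerivAt_const 0 0)
  have := h.pos
  simp at *
  linarith

lemma block_A {k k'} (h : GoodKer k k') : ∃ c > 0, ∃ C > 0, ∃ x0 : ℝ, ∀ (w : ℝ → ℝ) (ε δ a : ℝ),
    0 < ε → 0 ≤ δ → 1 ≤ a → Decomp w ε δ →
    ε ^ 2 * (ε * c - C * δ * a) ≤ |∫ z, kap k z * w (x0 / a - z / a)| := by
  obtain ⟨x0, hx0⟩ := Phi_ne h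
  obtain ⟨Ck, hCk0, hCk⟩ := kap_bdd h
  set K1 := ∫ z, |kap k z|
  set K2 := ∫ z, |4 * k' (2 * z) - k' z|
  have hK1 : 0 ≤ K1 := integral_nonneg fun z => abs_nonneg _
  have hK2 : 0 ≤ K2 := integral_nonneg fun z => abs_nonneg _
  refine ⟨|Hk k (2 * x0) - Hk k x0|, abs_pos.2 hx0, Ck + K2 + K1, by positivity, x0, ?_⟩
  intro w ε δ a hε hδ ha1 hw
  have ha : 0 < a := by linarith
  obtain ⟨⟨e, q, r, Q, Be, Bq, hdec, he, hei, heδ, hq, hQ, hQb, hr⟩, -⟩ := hw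
  set x := x0 / a
  have i1 := L_int h (f := fun _ => (1/2:ℝ)) (B := 1/2) ⟨measurable_const, fun _ => by norm_num⟩ x a
  have i2 := L_int h heav_BM x a
  have i3 := L_int h he x a
  have i4 := L_int h hq x a
  have i5 := L_int h hr x a
  have key : ∫ z, kap k z * w (x - z / a) = ε ^ 2 * ((ε + ε ^ 2 / 2) * (Hk k (2 * x0) - Hk k x0)
      + (∫ z, kap k z * e (x - z / a)) + (∫ z, kap k z * q (x - z / a)) + ∫ z, kap k z * r (x - z / a)) := by
    have e1 : ∀ z, kap k z * w (x - z / a) = ε ^ 2 * (kap k z * (1/2) + (ε + ε ^ 2 / 2) * (kap k z * heaviside (x - z / a))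
      + kap k z * e (x - z / a) + kap k z * q (x - z / a) + kap k z * r (x - z / a)) := fun z => by
      rw [hdec]; ring
    simp_rw [e1]
    rw [integral_const_mul, integral_add _ i5, integral_add _ i4, integral_add _ i3, integral_add i1 (i2.const_mul _),
      integral_const_mul, kap_heav h ha, integral_mul_const, kap_integral h]
    · have : a * x = x0 := by simp only [x]; field_simp
      rw [this]; ring
    · exact i1.add (i2.const_mul _)
    · exact (i1.add (i2.const_mul _)).add i3
    · exact ((i1.add (i2.const_mul _)).add i3).add i4
  rw [key, abs_mul, abs_of_pos (by positivity : 0 < ε ^ 2)]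
  gcongr
  have b1 := L_L1 h hCk he hei x ha
  have b2 := L_q h hq hQ hQb x ha
  have b3 := L_le h hr x a
  set E1 := ∫ z, kap k z * e (x - z / a)
  set E2 := ∫ z, kap k z * q (x - z / a)
  set E3 := ∫ z, kap k z * r (x - z / a)
  have b1' : |E1| ≤ Ck * a * δ := b1.trans (by gcongr)
  have b3' : |E3| ≤ K1 * δ * a := b3.trans (by
    have : 0 ≤ K1 * δ := by positivity
    nlinarith)
  set P := Hk k (2 * x0) - Hk k x0
  have m1 : (ε * |P|) ≤ |(ε + ε ^ 2 / 2) * P| := by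
    rw [abs_mul, abs_of_pos (by positivity : 0 < ε + ε ^ 2 / 2)]
    refine mul_le_mul_of_nonneg_right ?_ (abs_nonneg _)
    nlinarith [sq_nonneg ε]
  have m2 : |(ε + ε ^ 2 / 2) * P| ≤ |(ε + ε ^ 2 / 2) * P + E1 + E2 + E3| + |E1| + |E2| + |E3| := by
    have := abs_sub ((ε + ε ^ 2 / 2) * P + E1 + E2 + E3) (E1 + E2 + E3)
    have h3 := abs_add_three E1 E2 E3
    have h4 : (ε + ε ^ 2 / 2) * P + E1 + E2 + E3 - (E1 + E2 + E3) = (ε + ε ^ 2 / 2) * P := by ring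
    rw [h4] at this
    linarith
  have : (Ck + K2 + K1) * δ * a = Ck * a * δ + K2 * a * δ + K1 * δ * a := by ring
  linarith

open MeasureTheory Set Filter
open scoped ENNReal NNReal Topology

lemma kap_mom1 {k k'} (h : GoodKer k k') (x : ℝ) : Integrable (fun z => kap k z * |x - z|) := by
  refine ((kap_int2 h).const_mul (|x| + 1)).mono'
    (((kap_cont h).mul (by fun_prop)).aestronglyMeasurable) ?_
  filter_upwards with z
  rw [Real.norm_eq_abs, abs_mul, abs_abs]
  have h1 : |x - z| ≤ (|x| + 1) * (1 + z ^ 2) := by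
    have h2 := abs_sub x z
    have h3 : |z| ≤ 1 + z ^ 2 := by nlinarith [sq_abs z, sq_nonneg (|z| - 1), abs_nonneg z]
    nlinarith [abs_nonneg x, sq_nonneg z, mul_nonneg (abs_nonneg x) (sq_nonneg z)]
  calc |kap k z| * |x - z| ≤ |kap k z| * ((|x| + 1) * (1 + z ^ 2)) :=
        mul_le_mul_of_nonneg_left h1 (abs_nonneg _)
    _ = _ := by ring

lemma kap_mom2 {k k'} (h : GoodKer k k') (x : ℝ) : Integrable (fun z => |kap k z| * (x - z) ^ 2) := by
  refine ((kap_int2 h).const_mul (2 * x ^ 2 + 2)).mono'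
    (((kap_cont h).abs.mul (by fun_prop)).aestronglyMeasurable) ?_
  filter_upwards with z
  rw [Real.norm_eq_abs, abs_mul, abs_abs, abs_of_nonneg (sq_nonneg (x - z))]
  have h1 : (x - z) ^ 2 ≤ (2 * x ^ 2 + 2) * (1 + z ^ 2) := by
    nlinarith [sq_nonneg (x + z), mul_nonneg (sq_nonneg x) (sq_nonneg z)]
  calc |kap k z| * (x - z) ^ 2 ≤ |kap k z| * ((2 * x ^ 2 + 2) * (1 + z ^ 2)) :=
        mul_le_mul_of_nonneg_left h1 (abs_nonneg _)
    _ = _ := by ring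

lemma M_ne {k k'} (h : GoodKer k k') : ∃ x, (∫ z, kap k z * |x - z|) ≠ 0 := by
  by_contra hcon
  push Not at hcon
  have h0 : 0 < kap k 0 := by
    have := h.pos
    simp only [kap, mul_zero]; linarith
  have hc := kap_cont h
  obtain ⟨d, hd, hd2⟩ := Metric.continuousAt_iff.1 (hc.continuousAt (x := 0)) (kap k 0) h0
  have hpos : ∀ z, |z| < d → 0 < kap k z := fun z hz => by
    have := hd2 (x := z) (by simpa using hz)
    rw [Real.dist_eq, abs_lt] at this
    linarith [this.1]
  set hat : ℝ → ℝ := fun z => |d - z| + |-d - z| - 2 * |0 - z| with hhat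
  have hnn : ∀ z, 0 ≤ kap k z * hat z := fun z => by
    by_cases hz : |z| < d
    · refine mul_nonneg (hpos z hz).le ?_
      rw [abs_lt] at hz
      simp only [hhat]
      rw [abs_of_pos (by linarith : 0 < d - z), abs_of_neg (by linarith : -d - z < 0)]
      have : |0 - z| < d := by rw [abs_lt]; constructor <;> linarith
      linarith
    · have : hat z = 0 := by
        simp only [hhat]
        rw [not_lt, le_abs] at hz
        rcases hz with hz | hz
        · rw [abs_of_nonpos (by linarith : d - z ≤ 0), abs_of_neg (by linarith : -d - z < 0),
            abs_of_neg (by linarith : 0 - z < 0)]; ring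
        · rw [abs_of_nonneg (by linarith : 0 ≤ d - z), abs_of_nonneg (by linarith : 0 ≤ -d - z),
            abs_of_nonneg (by linarith : 0 ≤ 0 - z)]; ring
      rw [this, mul_zero]
  have hinteg : Integrable (fun z => kap k z * hat z) := by
    have := ((kap_mom1 h d).add (kap_mom1 h (-d))).sub ((kap_mom1 h 0).const_mul 2)
    refine this.congr (Eventually.of_forall fun z => ?_)
    simp only [Pi.add_apply, Pi.sub_apply, hhat]; ring
  have hz : ∫ z, kap k z * hat z = 0 := by
    have e : ∀ z, kap k z * hat z = kap k z * |d - z| + kap k z * |-d - z| - 2 * (kap k z * |0 - z|) := fun z => by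
      simp only [hhat]; ring
    simp_rw [e]
    have hadd : Integrable (fun z => kap k z * |d - z| + kap k z * |-d - z|) :=
      (kap_mom1 h d).add (kap_mom1 h (-d))
    rw [integral_sub hadd ((kap_mom1 h 0).const_mul 2),
      integral_add (kap_mom1 h d) (kap_mom1 h (-d)), integral_const_mul, hcon, hcon, hcon]
    ring
  rw [integral_eq_zero_iff_of_nonneg hnn hinteg] at hz
  have hcc : Continuous (fun z => kap k z * hat z) := by
    simp only [hhat]; fun_prop
  have := (hcc.ae_eq_iff_eq volume continuous_zero).1 hz
  have h3 := congrFun this 0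
  simp only [hhat, Pi.zero_apply, sub_zero, abs_zero, mul_zero] at h3
  rw [abs_neg, abs_of_pos hd] at h3
  have : 0 < kap k 0 * (d + d) := by positivity
  linarith

lemma exp_taylor {t : ℝ} (ht : 0 ≤ t) : |Real.exp (-t) - 1 + t| ≤ t ^ 2 := by
  have h1 := Real.add_one_le_exp (-t)
  rw [abs_of_nonneg (by linarith)]
  by_cases h : t ≤ 1
  · have := Real.abs_exp_sub_one_sub_id_le (x := -t) (by rw [abs_neg, abs_of_nonneg ht]; exact h)
    have h3 := (abs_le.1 this).2
    nlinarith
  · have : Real.exp (-t) ≤ 1 := Real.exp_le_one_iff.2 (by linarith)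
    nlinarith

lemma pk_est {k k'} (h : GoodKer k k') (x1 : ℝ) {a : ℝ} (ha : 0 < a) :
    abs (∫ z, kap k z * |x1 - z|) - (∫ z, |kap k z| * (x1 - z) ^ 2) / a ≤
      a * |∫ z, kap k z * Real.exp (-|x1 / a - z / a|)| := by
  have hp : BM (fun x : ℝ => Real.exp (-|x|)) 1 := ⟨Continuous.measurable (by fun_prop), fun x => by
    rw [abs_of_pos (Real.exp_pos _)]
    exact Real.exp_le_one_iff.2 (by simp)⟩
  have i1 := L_int h hp (x1 / a) a
  have i2 := kap_mom1 h x1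
  have i3 := kap_mom2 h x1
  have i0 := kap_int h
  have key : a * (∫ z, kap k z * Real.exp (-|x1 / a - z / a|)) + ∫ z, kap k z * |x1 - z| =
      a * ∫ z, kap k z * (Real.exp (-|x1 / a - z / a|) - 1 + |x1 - z| / a) := by
    have e : ∀ z, kap k z * (Real.exp (-|x1 / a - z / a|) - 1 + |x1 - z| / a) =
      kap k z * Real.exp (-|x1 / a - z / a|) - kap k z + a⁻¹ * (kap k z * |x1 - z|) := fun z => by
      field_simp
    simp_rw [e]
    have i4 : Integrable (fun z => kap k z * Real.exp (-|x1 / a - z / a|) - kap k z) := i1.sub i0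
    rw [integral_add i4 (i2.const_mul _), integral_sub i1 i0, kap_integral h, integral_const_mul]
    field_simp
    ring
  have hb : |∫ z, kap k z * (Real.exp (-|x1 / a - z / a|) - 1 + |x1 - z| / a)| ≤
      (∫ z, |kap k z| * (x1 - z) ^ 2) / a ^ 2 := by
    refine (abs_integral_le_integral_abs).trans ?_
    rw [← integral_div]
    refine integral_mono_of_nonneg (Eventually.of_forall fun z => abs_nonneg _) (i3.div_const _)
      (Eventually.of_forall fun z => ?_)
    simp only
    rw [abs_mul, mul_div_assoc]
    refine mul_le_mul_of_nonneg_left ?_ (abs_nonneg _)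
    have e : |x1 / a - z / a| = |x1 - z| / a := by rw [← sub_div, abs_div, abs_of_pos ha]
    rw [e]
    refine (exp_taylor (by positivity)).trans (le_of_eq ?_)
    rw [div_pow, sq_abs]
  set A := ∫ z, kap k z * Real.exp (-|x1 / a - z / a|)
  set M := ∫ z, kap k z * |x1 - z|
  set K := ∫ z, |kap k z| * (x1 - z) ^ 2
  set R := ∫ z, kap k z * (Real.exp (-|x1 / a - z / a|) - 1 + |x1 - z| / a)
  have h1 : |M| ≤ |a * R| + |a * A| := by
    have : M = a * R - a * A := by linarith
    rw [this]; exact abs_sub _ _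
  rw [abs_mul, abs_mul, abs_of_pos ha] at h1
  have h2 : a * |R| ≤ K / a := by
    calc a * |R| ≤ a * (K / a ^ 2) := by gcongr
      _ = K / a := by field_simp
  linarith

lemma Decomp.bm {w : ℝ → ℝ} {ε δ : ℝ} (hw : Decomp w ε δ) : ∃ B, BM w B := by
  obtain ⟨⟨e, q, r, Q, Be, Bq, hdec, he, hei, heδ, hq, hQ, hQb, hr⟩, hc⟩ := hw
  refine ⟨ε ^ 2 * (1/2 + |ε + ε ^ 2 / 2| * 1 + Be + Bq + δ), hc.measurable, fun x => ?_⟩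
  rw [hdec, abs_mul, abs_of_nonneg (sq_nonneg ε)]
  gcongr
  refine (abs_add_le _ _).trans (add_le_add ?_ (hr.2 x))
  refine (abs_add_le _ _).trans (add_le_add ?_ (hq.2 x))
  refine (abs_add_le _ _).trans (add_le_add ?_ (he.2 x))
  refine (abs_add_le _ _).trans (add_le_add (by norm_num) ?_)
  rw [abs_mul]
  gcongr
  exact heav_BM.2 x

lemma E_facts {w : ℝ → ℝ} {ε δ : ℝ} (hw : Decomp w ε δ) :
    Continuous (fun x => -deriv (invOneSub fun y => w y / 2) x) ∧
    (∃ B, BM (fun x => -deriv (invOneSub fun y => w y / 2) x) B) ∧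
    ∃ R, BM R (2 * δ) ∧ ∀ x, -deriv (invOneSub fun y => w y / 2) x =
      ε ^ 2 * (-((ε + ε ^ 2 / 2) / 4) * Real.exp (-|x|) + R x) := by
  obtain ⟨B, hB⟩ := hw.bm
  have hc := hw.cont
  have hc2 : Continuous fun y => w y / 2 := by fun_prop
  have hB2 : BM (fun y => w y / 2) (B / 2) := ⟨hc2.measurable, fun x => by
    rw [abs_div, abs_two]
    have := hB.2 x
    linarith⟩
  have hE : (fun x => -deriv (invOneSub fun y => w y / 2) x) = Tp (fun y => w y / 2) := by
    funext x
    rw [(invOneSub_hder hB2 hc2 x).deriv]; ring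
  have hTc : Continuous (Tp (fun y => w y / 2)) :=
    continuous_iff_continuousAt.2 fun x => (Tp_hder hB2 hc2 x).continuousAt
  have hTB : BM (Tp (fun y => w y / 2)) (B / 2) := ⟨hTc.measurable, Tp_bdd hB2⟩
  refine ⟨hE ▸ hTc, ⟨B / 2, hE ▸ hTB⟩, ?_⟩
  have hEx : ∀ x, -deriv (invOneSub fun y => w y / 2) x = Tp (fun y => w y / 2) x := congrFun hE
  simp_rw [hEx]
  obtain ⟨⟨e, q, r, Q, Be, Bq, hdec, he, hei, heδ, hq, hQ, hQb, hr⟩, -⟩ := hw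
  have hconst : BM (fun _ : ℝ => (1/2:ℝ)) (1/2) := ⟨measurable_const, fun _ => by norm_num⟩
  have hah := heav_BM.const_mul (ε + ε ^ 2 / 2)
  have s1 := hconst.add hah
  have s2 := s1.add he
  have s3 := s2.add hq
  have hT : ∀ x, Tp (fun y => w y / 2) x = ε ^ 2 * (-((ε + ε ^ 2 / 2) / 4) * Real.exp (-|x|) +
      (1/2) * (Tp e x + Tp q x + Tp r x)) := fun x => by
    have e1 : (fun y => w y / 2) = fun y => (ε ^ 2 / 2) *
      (1/2 + (ε + ε ^ 2 / 2) * heaviside y + e y + q y + r y) := funext fun y => by rw [hdec]; ring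
    rw [e1, Tp_const_mul, Tp_add s3 hr, Tp_add s2 hq, Tp_add s1 he, Tp_add hconst hah, Tp_const,
      Tp_const_mul, Tp_heav]
    ring
  by_cases hε : ε = 0
  · have hδ : 0 ≤ δ := (abs_nonneg _).trans (hr.2 0)
    refine ⟨fun _ => 0, ⟨measurable_const, fun _ => by simpa using hδ⟩, fun x => ?_⟩
    rw [hT, hε]; simp
  refine ⟨fun x => (1/2) * (Tp e x + Tp q x + Tp r x), ⟨?_, fun x => ?_⟩, hT⟩
  · have e2 : (fun x => (1/2) * (Tp e x + Tp q x + Tp r x)) = fun x =>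
      (Tp (fun y => w y / 2) x) / ε ^ 2 + ((ε + ε ^ 2 / 2) / 4) * Real.exp (-|x|) := by
      funext x
      rw [hT]; field_simp; ring
    rw [e2]
    exact Continuous.measurable (by fun_prop)
  · have h1 := (Tp_L1 hei x).trans heδ
    have h2 := Tp_deriv hQ hQb hq x
    have h3 := Tp_bdd hr x
    rw [abs_mul]
    have := abs_add_three (Tp e x) (Tp q x) (Tp r x)
    have h4 : |(1/2:ℝ)| = 1/2 := by norm_num
    rw [h4]
    linarith

lemma block_B {k k'} (h : GoodKer k k') : ∃ c > 0, ∃ C > 0, ∃ x0 a0 : ℝ, ∀ (w : ℝ → ℝ) (ε δ a : ℝ),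
    0 < ε → 0 ≤ δ → 1 ≤ a → a0 ≤ a → Decomp w ε δ →
    ε ^ 2 * (ε * c - C * δ * a) ≤ a * |∫ z, kap k z * (-deriv (invOneSub fun y => w y / 2) (x0 / a - z / a))| := by
  obtain ⟨x1, hx1⟩ := M_ne h
  set K1 := ∫ z, |kap k z|
  have hK1 : 0 ≤ K1 := integral_nonneg fun z => abs_nonneg _
  set M := ∫ z, kap k z * |x1 - z| with hM
  set K := ∫ z, |kap k z| * (x1 - z) ^ 2 with hK
  have hM0 : 0 < |M| := abs_pos.2 hx1
  refine ⟨|M| / 8, by positivity, 2 * K1 + 1, by positivity, x1, 2 * K / |M|, ?_⟩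
  intro w ε δ a hε hδ ha1 ha0 hw
  have ha : 0 < a := by linarith
  obtain ⟨-, -, R, hR, hER⟩ := E_facts hw
  have hp : BM (fun x : ℝ => Real.exp (-|x|)) 1 := ⟨Continuous.measurable (by fun_prop), fun x => by
    rw [abs_of_pos (Real.exp_pos _)]
    exact Real.exp_le_one_iff.2 (by simp)⟩
  have i1 := L_int h hp (x1 / a) a
  have i2 := L_int h hR (x1 / a) a
  have b1 := pk_est h x1 ha
  have b2 := L_le h hR (x1 / a) a
  have key : ∫ z, kap k z * (-deriv (invOneSub fun y => w y / 2) (x1 / a - z / a)) =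
      ε ^ 2 * (-((ε + ε ^ 2 / 2) / 4) * (∫ z, kap k z * Real.exp (-|x1 / a - z / a|)) +
        ∫ z, kap k z * R (x1 / a - z / a)) := by
    have e1 : ∀ z, kap k z * (-deriv (invOneSub fun y => w y / 2) (x1 / a - z / a)) =
      ε ^ 2 * (-((ε + ε ^ 2 / 2) / 4) * (kap k z * Real.exp (-|x1 / a - z / a|)) +
        kap k z * R (x1 / a - z / a)) := fun z => by rw [hER]; ring
    simp_rw [e1]
    rw [integral_const_mul, integral_add (i1.const_mul _) i2, integral_const_mul]
  rw [key, abs_mul, abs_of_pos (by positivity : 0 < ε ^ 2)]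
  set A := ∫ z, kap k z * Real.exp (-|x1 / a - z / a|)
  set S := ∫ z, kap k z * R (x1 / a - z / a)
  have h1 : |M| / 2 ≤ a * |A| := by
    have : K / a ≤ |M| / 2 := by
      rw [div_le_iff₀ hM0] at ha0
      rw [div_le_iff₀ ha]; linarith
    linarith
  have h2 : (ε / 4) * |A| ≤ |(-((ε + ε ^ 2 / 2) / 4) * A)| := by
    rw [abs_mul, abs_neg, abs_of_pos (by positivity : 0 < (ε + ε ^ 2 / 2) / 4)]
    refine mul_le_mul_of_nonneg_right ?_ (abs_nonneg _)
    nlinarith [sq_nonneg ε]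
  have h3 : |(-((ε + ε ^ 2 / 2) / 4) * A)| ≤ |(-((ε + ε ^ 2 / 2) / 4) * A + S)| + |S| := by
    have := abs_sub (-((ε + ε ^ 2 / 2) / 4) * A + S) S
    rwa [add_sub_cancel_right] at this
  set V := |(-((ε + ε ^ 2 / 2) / 4) * A + S)|
  have h4 : ε * (|M| / 8) - (2 * K1 + 1) * δ * a ≤ a * V := by
    have h5 : (ε / 4) * |A| - K1 * (2 * δ) ≤ V := by linarith
    have h6 : a * ((ε / 4) * |A| - K1 * (2 * δ)) ≤ a * V := by gcongr
    have h7 : (ε / 4) * (|M| / 2) ≤ (ε / 4) * (a * |A|) := by gcongr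
    have h8 : 0 ≤ δ * a := by positivity
    nlinarith
  calc _ ≤ ε ^ 2 * (a * V) := by gcongr
    _ = _ := by ring

open MeasureTheory Set Filter
open scoped ENNReal NNReal Topology

lemma sum_lower {c C : ℝ} (hc : 0 < c) (hC : 0 < C) (j0 : ℕ) : ∃ N0 : ℕ, ∀ N : ℕ, N0 ≤ N → ∀ T : ℤ → ℝ≥0∞,
    (∀ j : ℕ, j0 ≤ j → ENNReal.ofReal (((N:ℝ) ^ (-(1:ℝ)/10)) ^ 2 *
      ((N:ℝ) ^ (-(1:ℝ)/10) * c - C / 2 ^ N * 2 ^ j)) ≤ T j) →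
    ENNReal.ofReal (c / 8 * (N:ℝ) ^ ((3:ℝ)/5)) ≤ ∑' j, T j := by
  have ht : Tendsto (fun N : ℕ => (N:ℝ) ^ ((9:ℝ)/10)) atTop atTop :=
    (tendsto_rpow_atTop (by norm_num)).comp tendsto_natCast_atTop_atTop
  obtain ⟨N1, hN1⟩ := eventually_atTop.1 (ht.eventually_ge_atTop (4 * C / c))
  refine ⟨max N1 (4 * j0 + 4), fun N hN T hT => ?_⟩
  have hNa : N1 ≤ N := (le_max_left _ _).trans hN
  have hNb : 4 * j0 + 4 ≤ N := (le_max_right _ _).trans hN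
  have hN0 : (1:ℝ) ≤ N := by exact_mod_cast (by omega : 1 ≤ N)
  have hNp : (0:ℝ) < N := by linarith
  set ε := (N:ℝ) ^ (-(1:ℝ)/10) with hε
  have hεp : 0 < ε := Real.rpow_pos_of_pos hNp _
  have hterm : ∀ j ∈ Finset.Ico j0 (N / 2), ENNReal.ofReal (ε ^ 2 * (ε * (c / 2))) ≤ T (j:ℤ) := by
    intro j hj
    rw [Finset.mem_Ico] at hj
    refine le_trans (ENNReal.ofReal_le_ofReal ?_) (hT j hj.1)
    gcongr
    have h1 : (2:ℝ) ^ j * 2 ^ (N / 2) ≤ 2 ^ N := by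
      rw [← pow_add]
      exact pow_le_pow_right₀ (by norm_num) (by omega)
    have h2 : (N:ℝ) / 2 ≤ 2 ^ (N / 2) := by
      have h3 : (N / 2) + 1 ≤ 2 ^ (N / 2) := Nat.lt_two_pow_self
      have h4 : ((N / 2 : ℕ) : ℝ) + 1 ≤ 2 ^ (N / 2) := by exact_mod_cast h3
      have h5 : (N:ℝ) ≤ 2 * ((N / 2 : ℕ) : ℝ) + 1 := by exact_mod_cast (by omega : N ≤ 2 * (N / 2) + 1)
      linarith
    have h6 : C / 2 ^ N * 2 ^ j ≤ 2 * C / N := by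
      rw [div_mul_eq_mul_div, div_le_div_iff₀ (by positivity) hNp]
      have : (2:ℝ) ^ j * N ≤ 2 * 2 ^ N := by nlinarith [pow_pos (two_pos : (0:ℝ) < 2) j]
      nlinarith
    have h7 : 2 * C / N ≤ ε * (c / 2) := by
      have h8 := hN1 N hNa
      have h9 : ε * N = (N:ℝ) ^ ((9:ℝ)/10) := by
        rw [hε, ← Real.rpow_add_one hNp.ne']; norm_num
      rw [div_le_iff₀ hNp]
      rw [div_le_iff₀ hc, ← h9] at h8
      linarith
    linarith
  calc ENNReal.ofReal (c / 8 * (N:ℝ) ^ ((3:ℝ)/5))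
      ≤ ENNReal.ofReal ((N / 2 - j0 : ℕ) * (ε ^ 2 * (ε * (c / 2)))) := by
        refine ENNReal.ofReal_le_ofReal ?_
        have h1 : (N:ℝ) / 4 ≤ ((N / 2 - j0 : ℕ) : ℝ) := by
          rw [div_le_iff₀ (by norm_num)]
          exact_mod_cast (by omega : N ≤ (N / 2 - j0) * 4)
        have h2 : (N:ℝ) * ε ^ 3 = (N:ℝ) ^ ((7:ℝ)/10) := by
          rw [hε, ← Real.rpow_natCast, ← Real.rpow_mul hNp.le, mul_comm, ← Real.rpow_add_one hNp.ne']; norm_num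
        have h3 : (N:ℝ) ^ ((3:ℝ)/5) ≤ (N:ℝ) ^ ((7:ℝ)/10) := Real.rpow_le_rpow_of_exponent_le hN0 (by norm_num)
        calc c / 8 * (N:ℝ) ^ ((3:ℝ)/5) ≤ c / 8 * (N:ℝ) ^ ((7:ℝ)/10) := by gcongr
          _ = (N:ℝ) / 4 * (ε ^ 2 * (ε * (c / 2))) := by rw [← h2]; ring
          _ ≤ _ := by gcongr
    _ = ∑ j ∈ Finset.Ico j0 (N / 2), ENNReal.ofReal (ε ^ 2 * (ε * (c / 2))) := by
        rw [Finset.sum_const, Nat.card_Ico, nsmul_eq_mul, ENNReal.ofReal_mul (by positivity), ENNReal.ofReal_natCast]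
    _ ≤ ∑ j ∈ Finset.Ico j0 (N / 2), T (j:ℤ) := Finset.sum_le_sum hterm
    _ ≤ ∑' j : ℕ, T (j:ℤ) := ENNReal.sum_le_tsum _
    _ ≤ ∑' j, T j := ENNReal.tsum_comp_le_tsum_of_injective Nat.cast_injective T

lemma block_le (D : LPData) {f : ℝ → ℝ} {B : ℝ} (hf : BM f B) (hc : Continuous f) (j : ℕ) (x : ℝ) :
    ENNReal.ofReal |∫ z, kap (kD D) z * f (x / 2 ^ j - z / 2 ^ j)| ≤ eLpNorm (LPblock D j f) ⊤ volume := by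
  obtain ⟨k', hk⟩ := exists_goodKer D
  have e : LPblock D j f = fun x => ∫ z, kap (kD D) z * f (x - z / 2 ^ j) :=
    funext fun x => LPblock_nat D j f hf.1 hf.2 x
  rw [e]
  exact sup_le_eLp (L_cont hk hf hc _) (x / 2 ^ j)

/-- lower bound on the square of the derivative of the explicit initial
datum, `‖u₀ₓ²‖_{B^0_{∞,1}} ≥ C N^{3/5}`, and consequently
`‖E₀‖_{B^1_{∞,1}} ≥ C' N^{3/5}` where `E₀ = -∂_x(1-∂_{xx})⁻¹(u₀ₓ²/2)`. -/
theorem u0x_sq_lower_bound (D : LPData) :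
    ∃ C > (0:ℝ), ∃ C' > (0:ℝ), ∃ N₀ : ℕ, ∀ N : ℕ, N₀ ≤ N →
      ENNReal.ofReal (C * (N:ℝ) ^ ((3:ℝ)/5)) ≤
          besovNorm D 0 ⊤ (fun x => (deriv (u0def D N) x) ^ 2) ∧
      ENNReal.ofReal (C' * (N:ℝ) ^ ((3:ℝ)/5)) ≤
          besovNorm D 1 ⊤ (Edef (u0def D N)) := by
  obtain ⟨k', hk⟩ := exists_goodKer D
  obtain ⟨C0, hC0, hdec⟩ := decomp_aux hk
  obtain ⟨c1, hc1, C1, hC1, x1, hA⟩ := block_A hk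
  obtain ⟨c2, hc2, C2, hC2, x2, a0, hB⟩ := block_B hk
  obtain ⟨j0, hj0⟩ := pow_unbounded_of_one_lt a0 (by norm_num : (1:ℝ) < 2)
  obtain ⟨N1, hN1⟩ := sum_lower hc1 (mul_pos hC1 hC0) 0
  obtain ⟨N2, hN2⟩ := sum_lower hc2 (mul_pos hC2 hC0) j0
  refine ⟨c1 / 8, by positivity, c2 / 8, by positivity, max 1 (max N1 N2), fun N hN => ?_⟩
  have hNa : N1 ≤ N := ((le_max_left _ _).trans (le_max_right _ _)).trans hN
  have hNb : N2 ≤ N := ((le_max_right _ _).trans (le_max_right _ _)).trans hN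
  have hNc : 1 ≤ N := (le_max_left _ _).trans hN
  have hN1r : (1:ℝ) ≤ N := by exact_mod_cast hNc
  have hε : 0 < (N:ℝ) ^ (-(1:ℝ)/10) := Real.rpow_pos_of_pos (by linarith) _
  have hε1 : (N:ℝ) ^ (-(1:ℝ)/10) ≤ 1 := Real.rpow_le_one_of_one_le_of_nonpos hN1r (by norm_num)
  have hS : SNsum D N heaviside = fun y => Hk (kD D) (2 ^ N * y) := funext fun y => SN_eq D N y
  have hw : Decomp (fun x => (deriv (u0def D N) x) ^ 2) ((N:ℝ) ^ (-(1:ℝ)/10)) (C0 / 2 ^ N) := by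
    have := hdec N _ hε hε1
    unfold u0def
    rw [hS]
    exact this
  obtain ⟨Bw, hBw⟩ := hw.bm
  have hδ : 0 ≤ C0 / 2 ^ N := by positivity
  constructor
  · refine hN1 N hNa _ fun j _ => ?_
    have h1 := hA _ _ _ ((2:ℝ) ^ j) hε hδ (one_le_pow₀ (by norm_num)) hw
    have h2 := block_le D hBw hw.cont j x1
    rw [mul_zero, Real.rpow_zero, ENNReal.ofReal_one, one_mul]
    refine le_trans (ENNReal.ofReal_le_ofReal ?_) h2
    rw [mul_div_assoc]
    exact h1
  · refine hN2 N hNb _ fun j hj => ?_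
    obtain ⟨hEc, ⟨BE, hBE⟩, -⟩ := E_facts hw
    have h1 := hB _ _ _ ((2:ℝ) ^ j) hε hδ (one_le_pow₀ (by norm_num))
      (hj0.le.trans (pow_le_pow_right₀ (by norm_num) hj)) hw
    have h2 := block_le D hBE hEc j x2
    have h3 : (2:ℝ) ^ (((j:ℤ):ℝ) * 1) = 2 ^ j := by
      rw [mul_one, Int.cast_natCast, Real.rpow_natCast]
    rw [h3]
    refine le_trans ?_ (mul_le_mul_right h2 _)
    rw [← ENNReal.ofReal_mul (by positivity)]
    refine ENNReal.ofReal_le_ofReal ?_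
    rw [mul_div_assoc]
    exact h1
end
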